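/- arXiv:1805.10452 — 3 statements merged into one kernel-verified Lean document; each statement's English description precedes it below -/
import Mathlib

section
/- Let F be a finite field of characteristic 3 and order q. Then the Weil spectrum {W_{F,q−2}(a) : a ∈ F, a ≠ 0} is exactly the set of integers t that are divisible by 3 and satisfy 1 − 2√q ≤ t ≤ 1 + 2√q. -/
open scoped BigOperators

/-- The canonical additive character of a finite field `F` of characteristic `p`:
`ψ(x) = exp(2πi·Tr(x)/p)`, where `Tr` is the absolute trace from `F` to `𝔽_p = ZMod p`. -/
noncomputable def canonicalPsi (F : Type*) [Field F] [Fintype F] (p : ℕ) [CharP F p]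
    (x : F) : ℂ :=
  letI : Algebra (ZMod p) F := ZMod.algebra F p
  Complex.exp (2 * Real.pi * Complex.I * ((Algebra.trace (ZMod p) F x).val : ℂ) / (p : ℂ))

/-- The Weil sum `W_{F,d}(a) = ∑_{x ∈ F} ψ(x^d − a·x)`. -/
noncomputable def weilSum (F : Type*) [Field F] [Fintype F] (p : ℕ) [CharP F p]
    (d : ℕ) (a : F) : ℂ :=
  ∑ x : F, canonicalPsi F p (x ^ d - a * x)

/-- The sum of the quadratic character over the values of `x³ + (x + v)²`; in characteristic `3`
it is minus the Frobenius trace of the elliptic curve `y² = x³ + (x + v)²`. -/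
noncomputable def cubicCharSum (F : Type*) [Field F] [Fintype F] [DecidableEq F] (v : F) : ℤ :=
  ∑ x : F, quadraticChar F (x ^ 3 + (x + v) ^ 2)

theorem exists_addChar_canonicalPsi (F : Type*) [Field F] [Fintype F] [CharP F 3] :
    ∃ ψ : AddChar F ℂ, ψ.IsPrimitive ∧ (∀ x, ψ (x ^ 3) = ψ x) ∧
      ∀ x, canonicalPsi F 3 x = ψ x := by
  let _ : Algebra (ZMod 3) F := ZMod.algebra F 3
  have : Fact (Nat.Prime 3) := ⟨Nat.prime_three⟩
  let ψ : AddChar F ℂ :=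
    (ZMod.stdAddChar (N := 3)).compAddMonoidHom (Algebra.trace (ZMod 3) F).toAddMonoidHom
  have hψ : ∀ x, ψ x = ZMod.stdAddChar (Algebra.trace (ZMod 3) F x) := fun x => rfl
  refine ⟨ψ, ?_, ?_, ?_⟩
  · apply AddChar.IsPrimitive.of_ne_one
    obtain ⟨x, hx⟩ := Algebra.trace_surjective (ZMod 3) F 1
    intro h
    have h1 : ψ x = 1 := by rw [h]; rfl
    rw [hψ, hx] at h1
    have := (ZMod.isPrimitive_stdAddChar 3).zmod_char_eq_one_iff 3 (1 : ZMod 3)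
    exact absurd (this.1 h1) one_ne_zero
  · intro x
    rw [hψ, hψ]
    congr 1
    have := Algebra.trace_eq_of_algEquiv (FiniteField.frobeniusAlgEquiv (ZMod 3) F 3) x
    simpa using this
  · intro x
    rw [hψ, canonicalPsi]
    have := ZMod.stdAddChar_coe (N := 3) (((Algebra.trace (ZMod 3) F x).val : ℕ) : ℤ)
    simpa using this.symm

section WeilSum

variable {F : Type*} [Field F] [Fintype F]

theorem sum_units_neg [DecidableEq F] (f : F → ℂ) :
    ∑ x ∈ Finset.univ.erase (0 : F), f (-x) = ∑ x ∈ Finset.univ.erase (0 : F), f x := by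
  refine Finset.sum_nbij' (fun x => -x) (fun x => -x) ?_ ?_ ?_ ?_ ?_ <;> simp

variable [CharP F 3]

theorem weilSum_eq_sum_units (ψ : AddChar F ℂ) (hψ : ∀ x, canonicalPsi F 3 x = ψ x)
    [DecidableEq F] (a : F) :
    weilSum F 3 (Fintype.card F - 2) a =
      1 + ∑ x ∈ Finset.univ.erase (0 : F), ψ (x⁻¹ - a * x) := by
  have hq : 2 < Fintype.card F := by
    obtain ⟨n, hp, hn⟩ := FiniteField.card F 3
    rw [hn]
    calc 2 < 3 ^ 1 := by norm_num
      _ ≤ 3 ^ (n : ℕ) := Nat.pow_le_pow_right (by norm_num) n.2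
  rw [weilSum, ← Finset.add_sum_erase _ _ (Finset.mem_univ (0 : F))]
  congr 1
  · rw [zero_pow (by omega), hψ]; simp
  · refine Finset.sum_congr rfl fun x hx => ?_
    have hx0 : x ≠ 0 := Finset.ne_of_mem_erase hx
    rw [hψ]
    congr 2
    apply eq_inv_of_mul_eq_one_left
    rw [← pow_succ, ← FiniteField.pow_card_sub_one_eq_one x hx0]
    congr 1
    omega

theorem weilSum_eq_one_add_cubicCharSum [DecidableEq F] (a : F) :
    weilSum F 3 (Fintype.card F - 2) a = 1 + (cubicCharSum F (-a) : ℂ) := by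
  obtain ⟨ψ, hprim, hcube, hψ⟩ := exists_addChar_canonicalPsi F
  have : Fact (Nat.Prime 3) := ⟨Nat.prime_three⟩
  have h3 : (3 : F) = 0 := by exact_mod_cast CharP.cast_eq_zero F 3
  have h2 : ringChar F ≠ 2 := by rw [ringChar.eq F 3]; norm_num
  have h20 : (2 : F) ≠ 0 := by
    intro h
    have : (1 : F) = 0 := by linear_combination h3 - h
    exact one_ne_zero this
  rw [weilSum_eq_sum_units ψ hψ]
  set q : ℂ := (Fintype.card F : ℂ) with hqdef
  have hq0 : q ≠ 0 := by rw [hqdef]; exact_mod_cast Fintype.card_ne_zero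
  have hN1 : (∑ z : F, ∑ Q : F, if Q ^ 2 + (z - a) * Q - z ^ 3 = 0 then (1 : ℂ) else 0) =
      q + (cubicCharSum F (-a) : ℂ) := by
    have hz : ∀ z : F, (∑ Q : F, if Q ^ 2 + (z - a) * Q - z ^ 3 = 0 then (1 : ℂ) else 0) =
        ((quadraticChar F (z ^ 3 + (z + -a) ^ 2) + 1 : ℤ) : ℂ) := by
      intro z
      rw [← quadraticChar_card_sqrts h2, Finset.sum_boole]
      push_cast
      congr 1
      refine Finset.card_nbij' (fun Q => 2 * Q + (z - a)) (fun y => (y - (z - a)) / 2)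
        ?_ ?_ ?_ ?_
      · intro Q hQ
        simp only [Finset.coe_filter, Finset.mem_univ, true_and, Set.mem_ofPred_eq,
          Set.coe_toFinset] at hQ ⊢
        linear_combination 4 * hQ + z ^ 3 * h3
      · intro y hy
        simp only [Finset.coe_filter, Finset.mem_univ, true_and, Set.mem_ofPred_eq,
          Set.coe_toFinset] at hy ⊢
        field_simp
        linear_combination hy - z ^ 3 * h3
      · intro Q _
        field_simp
        ring
      · intro y _
        field_simp
        ring
    rw [Finset.sum_congr rfl fun z _ => hz z, cubicCharSum]
    push_cast
    rw [Finset.sum_add_distrib]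
    simp [hqdef, add_comm]
  have hN2 : (∑ z : F, ∑ Q : F, if Q ^ 2 + (z - a) * Q - z ^ 3 = 0 then (1 : ℂ) else 0) * q =
      q * (q + ∑ x ∈ Finset.univ.erase (0 : F), ψ (x⁻¹ - a * x)) := by
    have hzQ : ∀ z Q : F, (if Q ^ 2 + (z - a) * Q - z ^ 3 = 0 then (1 : ℂ) else 0) * q =
        ∑ b : F, ψ (-b ^ 3 * (Q ^ 2 - a * Q)) * ψ (z * (b - b ^ 3 * Q)) := by
      intro z Q
      have h := AddChar.sum_mulShift (Q ^ 2 + (z - a) * Q - z ^ 3) hprim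
      have hb := (frobeniusEquiv F 3).sum_comp
        (fun b => ψ (-b * (Q ^ 2 + (z - a) * Q - z ^ 3)))
      have hneg := Equiv.sum_comp (Equiv.neg F) (fun b => ψ (b * (Q ^ 2 + (z - a) * Q - z ^ 3)))
      simp only [Equiv.neg_apply] at hneg
      rw [hneg, h] at hb
      rw [ite_mul, one_mul, zero_mul, hqdef]
      have : (if Q ^ 2 + (z - a) * Q - z ^ 3 = 0 then (Fintype.card F : ℂ) else 0) =
          ((if Q ^ 2 + (z - a) * Q - z ^ 3 = 0 then Fintype.card F else 0 : ℕ) : ℂ) := by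
        split_ifs <;> simp
      rw [this]
      push_cast at hb ⊢
      rw [← hb]
      refine Finset.sum_congr rfl fun b _ => ?_
      rw [show (frobeniusEquiv F 3).toEquiv b = b ^ 3 from frobeniusEquiv_apply F 3 b]
      rw [show -b ^ 3 * (Q ^ 2 + (z - a) * Q - z ^ 3) =
        -b ^ 3 * (Q ^ 2 - a * Q) + (b * z) ^ 3 + -(b ^ 3 * z * Q) by ring,
        AddChar.map_add_eq_mul, AddChar.map_add_eq_mul, hcube, mul_assoc,
        ← AddChar.map_add_eq_mul]
      congr 2
      ring
    simp_rw [Finset.sum_mul, hzQ]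
    rw [Finset.sum_comm]
    have hQ : ∀ Q : F, ∑ z : F, ∑ b : F, ψ (-b ^ 3 * (Q ^ 2 - a * Q)) * ψ (z * (b - b ^ 3 * Q)) =
        ∑ b : F, if b - b ^ 3 * Q = 0 then ψ (-b ^ 3 * (Q ^ 2 - a * Q)) * q else 0 := by
      intro Q
      rw [Finset.sum_comm]
      refine Finset.sum_congr rfl fun b _ => ?_
      rw [← Finset.mul_sum, AddChar.sum_mulShift _ hprim]
      split_ifs <;> simp [hqdef]
    rw [Finset.sum_congr rfl fun Q _ => hQ Q, Finset.sum_comm,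
      ← Finset.add_sum_erase _ _ (Finset.mem_univ (0 : F)), mul_add]
    congr 1
    · simp [hqdef]
    · rw [← sum_units_neg, Finset.mul_sum]
      refine Finset.sum_congr rfl fun x hx => ?_
      have hx0 : x ≠ 0 := Finset.ne_of_mem_erase hx
      rw [Finset.sum_eq_single ((x ^ 2)⁻¹)]
      · rw [if_pos (by field_simp; ring), mul_comm]
        congr 2
        field_simp
      · intro Q _ hQ
        rw [if_neg]
        intro h
        apply hQ
        have : x * (Q * x ^ 2 - 1) = 0 := by linear_combination h
        rcases mul_eq_zero.1 this with h | h
        · exact absurd h hx0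
        · exact eq_inv_of_mul_eq_one_left (by linear_combination h)
      · simp
  rw [hN1, mul_comm] at hN2
  have := mul_left_cancel₀ hq0 hN2
  linear_combination -this

theorem three_dvd_one_add_cubicCharSum [DecidableEq F] (v : F) :
    (3 : ℤ) ∣ 1 + cubicCharSum F v := by
  obtain ⟨ψ, hprim, hcube, hψ⟩ := exists_addChar_canonicalPsi F
  have hW := weilSum_eq_one_add_cubicCharSum (-v)
  rw [neg_neg, weilSum_eq_sum_units ψ hψ] at hW
  have h3 : (3 : F) = 0 := by exact_mod_cast CharP.cast_eq_zero F 3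
  have hterm : ∀ x : F, ∃ k : ℤ, 1 + ψ x + ψ (-x) = 3 * (k : ℂ) := by
    intro x
    have hx3 : ψ x ^ 3 = 1 := by
      rw [← AddChar.map_nsmul_eq_pow]
      simp [nsmul_eq_mul, h3]
    have hinv : ψ (-x) * ψ x = 1 := by rw [← AddChar.map_add_eq_mul]; simp
    by_cases h1 : ψ x = 1
    · refine ⟨1, ?_⟩
      rw [h1] at hinv ⊢
      push_cast
      linear_combination hinv
    · refine ⟨0, ?_⟩
      have hx0 : ψ x ≠ 0 := right_ne_zero_of_mul_eq_one hinv
      have : (ψ x - 1) * (ψ x * (1 + ψ x + ψ (-x))) = 0 := by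
        linear_combination hx3 + (ψ x - 1) * hinv
      rcases mul_eq_zero.1 this with h | h
      · exact absurd (by linear_combination h) h1
      · rcases mul_eq_zero.1 h with h | h
        · exact absurd h hx0
        · rw [h]; simp
  choose k hk using hterm
  have hsum : ∑ x ∈ Finset.univ.erase (0 : F),
      (1 + ψ (x⁻¹ - -v * x) + ψ (-(x⁻¹ - -v * x))) =
      3 * ((∑ x ∈ Finset.univ.erase (0 : F), k (x⁻¹ - -v * x) : ℤ) : ℂ) := by
    push_cast
    rw [Finset.mul_sum]
    exact Finset.sum_congr rfl fun x _ => hk _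
  rw [Finset.sum_add_distrib, Finset.sum_add_distrib] at hsum
  have hneg : ∑ x ∈ Finset.univ.erase (0 : F), ψ (-(x⁻¹ - -v * x)) =
      ∑ x ∈ Finset.univ.erase (0 : F), ψ (x⁻¹ - -v * x) := by
    rw [← sum_units_neg fun x => ψ (x⁻¹ - -v * x)]
    refine Finset.sum_congr rfl fun x _ => ?_
    congr 1
    rw [inv_neg]
    ring
  obtain ⟨n, hp, hn⟩ := FiniteField.card F 3
  have hcard : (∑ x ∈ Finset.univ.erase (0 : F), (1 : ℂ)) = 3 ^ (n : ℕ) - 1 := by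
    rw [Finset.sum_const, Finset.card_erase_of_mem (Finset.mem_univ _), Finset.card_univ, hn,
      nsmul_one, Nat.cast_sub (Nat.one_le_pow _ _ (by norm_num))]
    push_cast
    ring
  rw [hneg, hcard] at hsum
  have hW' : ∑ x ∈ Finset.univ.erase (0 : F), ψ (x⁻¹ - -v * x) = (cubicCharSum F v : ℂ) := by
    linear_combination hW
  rw [hW'] at hsum
  have hZ : (3 : ℤ) ^ (n : ℕ) - 1 + cubicCharSum F v + cubicCharSum F v =
      3 * ∑ x ∈ Finset.univ.erase (0 : F), k (x⁻¹ - -v * x) := by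
    exact_mod_cast hsum
  have h3n : (3 : ℤ) ∣ 3 ^ (n : ℕ) := dvd_pow_self _ n.2.ne'
  omega

end WeilSum

section Hasse

open Polynomial

variable {K : Type*} [Field K]

/-- `f₀ / k₀` and `f / k` are the `x`-coordinates of two points of `y² = x³ + x² - a` over an
extension of `K(X)` whose difference has `x`-coordinate `X`, in polynomial form. -/
def XCoordLink (a : K) (f₀ k₀ f k : K[X]) : Prop :=
  (f - X * k) ^ 2 * f₀ ^ 2
    - 2 * ((f + X * k) * X * f + 2 * X * f * k - 2 * C a * k ^ 2) * (f₀ * k₀)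
    + (X ^ 2 * f ^ 2 + 4 * C a * k * (f + X * k + k)) * k₀ ^ 2 = 0

/-- A fraction `f/k` in lowest terms with a pole at infinity, or with `k = 0`. -/
def HasPoleAtInfinity (f k : K[X]) : Prop :=
  IsCoprime f k ∧ (k = 0 ∨ k.natDegree < f.natDegree)

theorem HasPoleAtInfinity.ne_zero {f k : K[X]} (h : HasPoleAtInfinity f k) : f ≠ 0 := by
  rintro rfl
  obtain ⟨h1, h2⟩ := h
  rcases h2 with rfl | h2
  · exact not_isCoprime_zero_zero h1
  · simp at h2

theorem isCoprime_sum_prod_of_isCoprime (h2 : (2 : K) ≠ 0) (a : K)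
    (hg : IsCoprime (X ^ 3 + X ^ 2 - C a : K[X]) (3 * X ^ 2 + 2 * X)) {f k : K[X]}
    (hfk : IsCoprime f k) {f₀ k₀ f₁ k₁ : K[X]}
    (hB0 : (f - X * k) ^ 2 = k₀ * k₁)
    (hB1 : 2 * ((f + X * k) * X * f + 2 * X * f * k - 2 * C a * k ^ 2) = k₁ * f₀ + f₁ * k₀)
    (hB2 : X ^ 2 * f ^ 2 + 4 * C a * k * (f + X * k + k) = f₀ * f₁) : IsCoprime f₁ k₁ := by
  have h4 : (4 : K[X]) ∣ 1 := by
    refine ⟨C (4⁻¹), ?_⟩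
    have : (4 : K) ≠ 0 := by
      rw [show (4 : K) = 2 * 2 by norm_num]; exact mul_ne_zero h2 h2
    rw [show (4 : K[X]) = C 4 from (map_ofNat C 4).symm, ← C_mul, mul_inv_cancel₀ this, C_1]
  by_cases h00 : f₁ = 0 ∧ k₁ = 0
  · exfalso
    obtain ⟨rfl, rfl⟩ := h00
    have hf : f = X * k := by
      have : (f - X * k) ^ 2 = 0 := by rw [hB0, mul_zero]
      linear_combination pow_eq_zero_iff (two_ne_zero) |>.1 this
    subst hf
    have hu : IsUnit k := hfk.isUnit_of_dvd' (Dvd.intro_left X rfl) dvd_rfl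
    have e1 : 4 * k ^ 2 * (X ^ 3 + X ^ 2 - C a) = 0 := by linear_combination hB1
    have e2 : k ^ 2 * (X ^ 4 + 4 * C a * (2 * X + 1)) = 0 := by linear_combination hB2
    have hk0 : k ^ 2 ≠ 0 := pow_ne_zero _ hu.ne_zero
    have h40 : (4 : K[X]) ≠ 0 := by rintro h; rw [h] at h4; exact one_ne_zero (zero_dvd_iff.1 h4)
    have e3 := (mul_eq_zero.1 e1).resolve_left (mul_ne_zero h40 hk0)
    have e4 := (mul_eq_zero.1 e2).resolve_left hk0
    have e5 : (3 * X ^ 2 + 2 * X : K[X]) ^ 2 = 0 := by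
      linear_combination e4 + 4 * (2 * X + 1) * e3
    rw [e3, pow_eq_zero_iff two_ne_zero |>.1 e5] at hg
    exact not_isCoprime_zero_zero hg
  refine isCoprime_of_prime_dvd h00 fun p hp hpf hpk => ?_
  have d0 : p ∣ (f - X * k) ^ 2 := hB0 ▸ hpk.mul_left k₀
  have d0' : p ∣ f - X * k := hp.dvd_of_dvd_pow d0
  have d1 := hB1 ▸ dvd_add (hpk.mul_right f₀) (hpf.mul_right k₀)
  have d2 := hB2 ▸ hpf.mul_left f₀
  have hk : ¬ p ∣ k := fun hk => hp.not_isUnit <| hfk.isUnit_of_dvd'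
    (by simpa using dvd_add d0' (hk.mul_left X)) hk
  have e1 : p ∣ 4 * (k ^ 2 * (X ^ 3 + X ^ 2 - C a)) := by
    have := dvd_sub d1 (d0'.mul_right (2 * (X * (f + 2 * X * k) + 2 * X * k)))
    convert this using 1
    ring
  have e2 : p ∣ k ^ 2 * (X ^ 4 + 4 * C a * (2 * X + 1)) := by
    have := dvd_sub d2 (d0'.mul_right (X ^ 2 * (f + X * k) + 4 * C a * k))
    convert this using 1
    ring
  have hp4 : ¬ p ∣ 4 := fun h => hp.not_isUnit (isUnit_of_dvd_one (h.trans h4))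
  have hpk2 : ¬ p ∣ k ^ 2 := fun h => hk (hp.dvd_of_dvd_pow h)
  have e3 := (hp.dvd_or_dvd ((hp.dvd_or_dvd e1).resolve_left hp4)).resolve_left hpk2
  have e4 := (hp.dvd_or_dvd e2).resolve_left hpk2
  have e5 : p ∣ (3 * X ^ 2 + 2 * X) ^ 2 := by
    have := dvd_add e4 (e3.mul_left (4 * (2 * X + 1)))
    convert this using 1
    ring
  exact hp.not_isUnit (hg.isUnit_of_dvd' e3 (hp.dvd_of_dvd_pow e5))

theorem XCoordLink.exists_next (h2 : (2 : K) ≠ 0) (a : K)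
    (hg : IsCoprime (X ^ 3 + X ^ 2 - C a : K[X]) (3 * X ^ 2 + 2 * X)) {f₀ k₀ f k : K[X]}
    (h₀ : HasPoleAtInfinity f₀ k₀) (h : HasPoleAtInfinity f k) (hl : XCoordLink a f₀ k₀ f k) :
    ∃ f₁ k₁ : K[X], HasPoleAtInfinity f₁ k₁ ∧ XCoordLink a f k f₁ k₁ ∧
      f₁.natDegree + f₀.natDegree = 2 * f.natDegree + 2 := by
  have hf₀ := h₀.ne_zero
  have hf := h.ne_zero
  obtain ⟨f₁, k₁, hB0, hB1, hB2⟩ : ∃ f₁ k₁ : K[X], (f - X * k) ^ 2 = k₀ * k₁ ∧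
      2 * ((f + X * k) * X * f + 2 * X * f * k - 2 * C a * k ^ 2) = k₁ * f₀ + f₁ * k₀ ∧
      X ^ 2 * f ^ 2 + 4 * C a * k * (f + X * k + k) = f₀ * f₁ := by
    unfold XCoordLink at hl
    have d2 : f₀ ∣ X ^ 2 * f ^ 2 + 4 * C a * k * (f + X * k + k) := by
      refine (h₀.1.pow_right (n := 2)).dvd_of_dvd_mul_right ⟨-((f - X * k) ^ 2 * f₀
        - 2 * ((f + X * k) * X * f + 2 * X * f * k - 2 * C a * k ^ 2) * k₀), ?_⟩
      linear_combination hl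
    obtain ⟨f₁, hf₁⟩ := d2
    by_cases hk₀ : k₀ = 0
    · subst hk₀
      have hu : IsUnit f₀ := isCoprime_zero_right.1 h₀.1
      obtain ⟨k₁, hk₁⟩ := hu.dvd (a := 2 * ((f + X * k) * X * f + 2 * X * f * k - 2 * C a * k ^ 2))
      refine ⟨f₁, k₁, ?_, by rw [hk₁]; ring, hf₁⟩
      have : (f - X * k) ^ 2 * f₀ ^ 2 = 0 := by linear_combination hl
      rw [(mul_eq_zero.1 this).resolve_right (pow_ne_zero _ hf₀), zero_mul]
    · have d0 : k₀ ∣ (f - X * k) ^ 2 := by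
        refine (h₀.1.symm.pow_right (n := 2)).dvd_of_dvd_mul_right
          ⟨2 * ((f + X * k) * X * f + 2 * X * f * k - 2 * C a * k ^ 2) * f₀ -
            (X ^ 2 * f ^ 2 + 4 * C a * k * (f + X * k + k)) * k₀, ?_⟩
        linear_combination hl
      obtain ⟨k₁, hk₁⟩ := d0
      refine ⟨f₁, k₁, hk₁, ?_, hf₁⟩
      apply mul_left_cancel₀ (mul_ne_zero hf₀ hk₀)
      linear_combination -hl + f₀ ^ 2 * hk₁ + k₀ ^ 2 * hf₁
  have hcop := isCoprime_sum_prod_of_isCoprime h2 a hg h.1 hB0 hB1 hB2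
  have hkle : k.natDegree ≤ f.natDegree := by
    rcases h.2 with rfl | h
    · simp
    · exact h.le
  have hXf : (X ^ 2 * f ^ 2).natDegree = 2 * f.natDegree + 2 := by
    rw [natDegree_mul (by simp) (pow_ne_zero _ hf)]
    simp
    ring
  have hdeg2 : (X ^ 2 * f ^ 2 + 4 * C a * k * (f + X * k + k)).natDegree =
      2 * f.natDegree + 2 := by
    rw [← hXf]
    apply natDegree_add_eq_left_of_natDegree_lt
    rw [hXf]
    have : (4 * C a * k * (f + X * k + k)).natDegree ≤ f.natDegree + (f.natDegree + 1) := by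
      refine natDegree_mul_le.trans (add_le_add ?_ ?_)
      · rw [show (4 : K[X]) = C 4 from (map_ofNat C 4).symm, ← C_mul]
        exact (natDegree_C_mul_le _ _).trans hkle
      · refine natDegree_add_le_of_degree_le (natDegree_add_le_of_degree_le (by omega) ?_)
          (by omega)
        refine natDegree_mul_le.trans ?_
        rw [natDegree_X]
        omega
    omega
  have hf₁ : f₁ ≠ 0 := by
    rintro rfl
    rw [hB2] at hdeg2
    simp at hdeg2
  have hdeg : f₁.natDegree + f₀.natDegree = 2 * f.natDegree + 2 := by
    rw [hB2, natDegree_mul hf₀ hf₁] at hdeg2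
    omega
  refine ⟨f₁, k₁, ⟨hcop, ?_⟩, ?_, hdeg⟩
  · by_cases hk₁ : k₁ = 0
    · exact Or.inl hk₁
    right
    have hB1deg : (2 * ((f + X * k) * X * f + 2 * X * f * k - 2 * C a * k ^ 2)).natDegree ≤
        2 * f.natDegree + 1 := by
      have hXk : (X * k).natDegree ≤ f.natDegree := by
        rcases h.2 with rfl | h
        · simp
        · refine natDegree_mul_le.trans ?_
          rw [natDegree_X]
          omega
      rw [show (2 : K[X]) = C 2 from (map_ofNat C 2).symm]
      have e1 : ((f + X * k) * X * f).natDegree ≤ 2 * f.natDegree + 1 :=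
        (natDegree_mul_le_of_le (natDegree_mul_le_of_le (natDegree_add_le_of_degree_le
          le_rfl hXk) natDegree_X_le) le_rfl).trans (by omega)
      have e2 : (C 2 * X * f * k).natDegree ≤ 2 * f.natDegree + 1 := by
        rw [show C 2 * X * f * k = C 2 * (f * (X * k)) by ring]
        exact (natDegree_C_mul_le _ _).trans
          ((natDegree_mul_le_of_le le_rfl hXk).trans (by omega))
      have e3 : (C 2 * C a * k ^ 2).natDegree ≤ 2 * f.natDegree + 1 := by
        rw [← C_mul]
        exact (natDegree_C_mul_le _ _).trans
          ((natDegree_pow_le_of_le 2 hkle).trans (by omega))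
      exact (natDegree_C_mul_le _ _).trans ((natDegree_sub_le_of_le
        (natDegree_add_le_of_degree_le e1 e2) e3).trans (max_self _).le)
    have hfk : (f₁ * k₀).natDegree ≤ 2 * f.natDegree + 1 := by
      rcases h₀.2 with rfl | h'
      · simp
      · exact natDegree_mul_le.trans (by omega)
    have : (k₁ * f₀).natDegree ≤ 2 * f.natDegree + 1 := by
      rw [show k₁ * f₀ = 2 * ((f + X * k) * X * f + 2 * X * f * k - 2 * C a * k ^ 2) - f₁ * k₀ by
        rw [hB1]; ring]
      exact natDegree_sub_le_of_le hB1deg hfk |>.trans (by simp)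
    rw [natDegree_mul hk₁ hf₀] at this
    omega
  · unfold XCoordLink
    linear_combination k₁ ^ 2 * hB2 - f₁ * k₁ * hB1 + f₁ ^ 2 * hB0

theorem XCoordLink.natDegree_nonneg (h2 : (2 : K) ≠ 0) (a : K)
    (hg : IsCoprime (X ^ 3 + X ^ 2 - C a : K[X]) (3 * X ^ 2 + 2 * X)) {f₀ k₀ f₁ k₁ : K[X]}
    (h₀ : HasPoleAtInfinity f₀ k₀) (h₁ : HasPoleAtInfinity f₁ k₁) (hl : XCoordLink a f₀ k₀ f₁ k₁)
    (n : ℕ) :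
    0 ≤ (n : ℤ) ^ 2 - n + n * ((f₁.natDegree : ℤ) - f₀.natDegree) + f₀.natDegree := by
  have key : ∃ f k f' k' : K[X], HasPoleAtInfinity f k ∧ HasPoleAtInfinity f' k' ∧
      XCoordLink a f k f' k' ∧
      (f.natDegree : ℤ) = n ^ 2 - n + n * ((f₁.natDegree : ℤ) - f₀.natDegree) + f₀.natDegree ∧
      (f'.natDegree : ℤ) = (n + 1) ^ 2 - (n + 1) +
        (n + 1) * ((f₁.natDegree : ℤ) - f₀.natDegree) + f₀.natDegree := by
    induction n with
    | zero => exact ⟨f₀, k₀, f₁, k₁, h₀, h₁, hl, by simp, by simp⟩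
    | succ n ih =>
      obtain ⟨f, k, f', k', h, h', hl', hd, hd'⟩ := ih
      obtain ⟨f'', k'', h'', hl'', hd''⟩ := hl'.exists_next h2 a hg h h'
      refine ⟨f', k', f'', k'', h', h'', hl'', by push_cast; linarith, ?_⟩
      have : (f''.natDegree : ℤ) + f.natDegree = 2 * f'.natDegree + 2 := by exact_mod_cast hd''
      push_cast
      linear_combination this - hd + 2 * hd'
  obtain ⟨f, -, -, -, -, -, -, hd, -⟩ := key
  rw [← hd]
  positivity

theorem exists_isCoprime_of_ne_zero (p : K[X]) {q : K[X]} (hq : q ≠ 0) :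
    ∃ d p' q' : K[X], p = d * p' ∧ q = d * q' ∧ IsCoprime p' q' ∧
      ∀ e, e ∣ p → e ∣ q → e ∣ d := by
  classical
  let _ : GCDMonoid K[X] := EuclideanDomain.gcdMonoid K[X]
  exact ⟨gcd p q, p / gcd p q, q / gcd p q,
    (EuclideanDomain.mul_div_cancel' (gcd_ne_zero_of_right hq) (gcd_dvd_left p q)).symm,
    (EuclideanDomain.mul_div_cancel' (gcd_ne_zero_of_right hq) (gcd_dvd_right p q)).symm,
    isCoprime_div_gcd_div_gcd hq, fun e h1 h2 => dvd_gcd h1 h2⟩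

theorem biquadratic_eq_zero {R : Type*} [CommRing R] {a t x u g c n : R}
    (hg : g = x ^ 3 + x ^ 2 - a) (hc : c = t - x)
    (hn : n = t ^ 3 + t ^ 2 - a + g - (t + x + 1) * c ^ 2 - 2 * u)
    (hu : u ^ 2 = g * (t ^ 3 + t ^ 2 - a)) :
    (n - x * c ^ 2) ^ 2 * t ^ 2
      - 2 * ((n + x * c ^ 2) * x * n + 2 * x * n * c ^ 2 - 2 * a * (c ^ 2) ^ 2) * t
      + (x ^ 2 * n ^ 2 + 4 * a * c ^ 2 * (n + x * c ^ 2 + c ^ 2)) = 0 := by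
  subst hn hc hg
  linear_combination 4 * (t - x) ^ 2 * hu

theorem exists_xCoordLink_frobenius [Fintype K] [DecidableEq K] (hK : ringChar K ≠ 2) (a : K)
    {ε : ℤ} (hε : ε = 1 ∨ ε = -1) :
    ∃ f k : K[X], HasPoleAtInfinity f k ∧ XCoordLink a (X ^ Fintype.card K) 1 f k ∧
      f.natDegree +
        2 * (Finset.univ.filter fun x => quadraticChar K (x ^ 3 + x ^ 2 - a) = ε).card +
        (Finset.univ.filter fun x => quadraticChar K (x ^ 3 + x ^ 2 - a) = 0).card ≤
        2 * Fintype.card K + 1 := by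
  set q := Fintype.card K with hq
  have hodd : q % 2 = 1 := FiniteField.odd_card_of_char_ne_two hK
  have hq1 : 1 < q := Fintype.one_lt_card
  have hε2 : (ε : K) ^ 2 = 1 := by rcases hε with rfl | rfl <;> simp
  set g : K[X] := X ^ 3 + X ^ 2 - C a with hg
  set h : K[X] := g ^ (q / 2) with hh
  set c : K[X] := X ^ q - X with hc
  have heval : ∀ x, g.eval x = x ^ 3 + x ^ 2 - a := fun x => by simp [hg]
  have hgq : g * h ^ 2 = (X ^ q) ^ 3 + (X ^ q) ^ 2 - C a := by
    have h1 : g * h ^ 2 = g ^ q := by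
      rw [hh, ← pow_mul, ← pow_succ']
      congr 1
      omega
    rw [h1, hq, ← FiniteField.expand_card, hg]
    simp [← pow_mul]
  have hgdeg : g.natDegree = 3 := by rw [hg]; compute_degree!
  have hc0 : c ≠ 0 := FiniteField.X_pow_card_sub_X_ne_zero K hq1
  have hcdeg : c.natDegree = q := FiniteField.X_pow_card_sub_X_natDegree_eq K hq1
  set num : K[X] := g * (h - C (ε : K)) ^ 2 - (X ^ q + X + 1) * c ^ 2 with hnum
  have hεC : C (ε : K) ^ 2 = 1 := by rw [← C_pow, hε2, C_1]
  have hnum' : num = X ^ (2 * q + 1) + (X ^ (q + 2) + C 2 * X ^ (q + 1) - C (2 * a) -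
      C (2 * (ε : K)) * (g * h)) := by
    have e2 : (C (2 : K) : K[X]) = 2 := map_ofNat C 2
    rw [C_mul, C_mul, e2]
    linear_combination hgq + g * hεC
  have hnumdeg : num.natDegree = 2 * q + 1 := by
    have hgh : (g * h).natDegree ≤ 2 * q := by
      refine natDegree_mul_le.trans ?_
      rw [hh, hgdeg]
      have := natDegree_pow_le (p := g) (n := q / 2)
      rw [hgdeg] at this
      omega
    have hr : (X ^ (q + 2) + C 2 * X ^ (q + 1) - C (2 * a) -
        C (2 * (ε : K)) * (g * h)).natDegree ≤ 2 * q := by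
      have e1 : (X ^ (q + 2) : K[X]).natDegree ≤ 2 * q := by
        rw [natDegree_X_pow]
        omega
      have e2 : (C 2 * X ^ (q + 1) : K[X]).natDegree ≤ 2 * q := by
        refine (natDegree_C_mul_le _ _).trans ?_
        rw [natDegree_X_pow]
        omega
      have e3 : (C (2 * a)).natDegree ≤ 2 * q := by
        rw [natDegree_C]
        omega
      have e4 := (natDegree_C_mul_le (2 * (ε : K)) (g * h)).trans hgh
      exact (natDegree_sub_le_of_le ((natDegree_sub_le_of_le
        (natDegree_add_le_of_degree_le e1 e2) e3).trans (max_self _).le) e4).trans (max_self _).le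
    rw [hnum', natDegree_add_eq_left_of_natDegree_lt, natDegree_X_pow]
    rw [natDegree_X_pow]
    omega
  have hnum0 : num ≠ 0 := by rintro h0; simp [h0] at hnumdeg
  obtain ⟨d, f, k, hdf, hdk, hfk, hd⟩ := exists_isCoprime_of_ne_zero num (pow_ne_zero 2 hc0)
  have hd0 : d ≠ 0 := by rintro rfl; simp at hdf; exact hnum0 hdf
  have hf0 : f ≠ 0 := by rintro rfl; simp at hdf; exact hnum0 hdf
  have hk0 : k ≠ 0 := by rintro rfl; simp at hdk; exact hc0 hdk
  have hfdeg : d.natDegree + f.natDegree = 2 * q + 1 := by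
    rw [← natDegree_mul hd0 hf0, ← hdf, hnumdeg]
  have hkdeg : d.natDegree + k.natDegree = 2 * q := by
    rw [← natDegree_mul hd0 hk0, ← hdk, natDegree_pow, hcdeg]
  refine ⟨f, k, ⟨hfk, Or.inr (by omega)⟩, ?_, ?_⟩
  · have hlink : (num - X * c ^ 2) ^ 2 * (X ^ q) ^ 2
        - 2 * ((num + X * c ^ 2) * X * num + 2 * X * num * c ^ 2 - 2 * C a * (c ^ 2) ^ 2)
          * (X ^ q)
        + (X ^ 2 * num ^ 2 + 4 * C a * c ^ 2 * (num + X * c ^ 2 + c ^ 2)) = 0 := by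
      have hu : (C (ε : K) * (g * h)) ^ 2 = g * ((X ^ q) ^ 3 + (X ^ q) ^ 2 - C a) := by
        linear_combination g * hgq + (g * h) ^ 2 * hεC
      have hn : num = (X ^ q) ^ 3 + (X ^ q) ^ 2 - C a + g - (X ^ q + X + 1) * c ^ 2 -
          2 * (C (ε : K) * (g * h)) := by
        linear_combination hgq + g * hεC
      exact biquadratic_eq_zero hg hc hn hu
    unfold XCoordLink
    have : d ^ 2 ≠ 0 := pow_ne_zero 2 hd0
    apply (mul_eq_zero.1 (?_ : d ^ 2 * _ = 0)).resolve_left this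
    rw [hdf, hdk] at hlink
    linear_combination hlink
  · set s : Finset K := {x | quadraticChar K (x ^ 3 + x ^ 2 - a) = ε} with hs
    set t : Finset K := {x | quadraticChar K (x ^ 3 + x ^ 2 - a) = 0} with ht
    have hdvd : ∀ (r : Finset K) (p : K[X]), (∀ x ∈ r, p.eval x = 0) →
        ∏ x ∈ r, (X - C x) ∣ p := by
      intro r p hp
      refine Finset.prod_dvd_of_coprime
        (fun i _ j _ hij => pairwise_coprime_X_sub_C Function.injective_id hij) ?_
      exact fun x hx => dvd_iff_isRoot.2 (hp x hx)
    have hst : Disjoint s t := by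
      rw [Finset.disjoint_left]
      intro x hx hx'
      rw [hs, Finset.mem_filter] at hx
      rw [ht, Finset.mem_filter] at hx'
      rcases hε with rfl | rfl <;> simp [hx'.2] at hx
    have hcroot : ∀ x, c.eval x = 0 := fun x => by
      simp [hc, hq, FiniteField.pow_card]
    have hu : ∏ x ∈ s, (X - C x) ∣ h - C (ε : K) := by
      refine hdvd _ _ fun x hx => ?_
      rw [hs, Finset.mem_filter] at hx
      rw [eval_sub, hh, eval_pow, heval, eval_C, hq, ← quadraticChar_eq_pow_of_char_ne_two' hK,
        hx.2, sub_self]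
    have hv : ∏ x ∈ t, (X - C x) ∣ g := by
      refine hdvd _ _ fun x hx => ?_
      rw [ht, Finset.mem_filter] at hx
      rw [heval]
      exact quadraticChar_eq_zero_iff.1 hx.2
    have huv : (∏ x ∈ s, (X - C x)) * ∏ x ∈ t, (X - C x) ∣ c := by
      rw [← Finset.prod_union hst]
      exact hdvd _ _ fun x _ => hcroot x
    have hc2 : (∏ x ∈ s, (X - C x)) ^ 2 * ∏ x ∈ t, (X - C x) ∣ c ^ 2 := by
      refine dvd_trans ?_ (pow_dvd_pow_of_dvd huv 2)
      rw [mul_pow]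
      exact mul_dvd_mul_left _ (dvd_pow_self _ two_ne_zero)
    have hdd := hd _ (dvd_sub (by
      rw [mul_comm g]
      exact mul_dvd_mul (pow_dvd_pow_of_dvd hu 2) hv) (hc2.mul_left _)) hc2
    have hle := natDegree_le_of_dvd hdd hd0
    have hm : ∀ r : Finset K, (∏ x ∈ r, (X - C x)).Monic :=
      fun r => monic_prod_of_monic _ _ fun x _ => monic_X_sub_C x
    rw [Monic.natDegree_mul ((hm s).pow 2) (hm t), Monic.natDegree_pow (hm s),
      natDegree_finsetProd_X_sub_C_eq_card, natDegree_finsetProd_X_sub_C_eq_card] at hle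
    omega

theorem sq_le_of_forall_quadratic_nonneg {s q : ℤ} (hq : Odd q)
    (h : ∀ n : ℤ, 0 ≤ n ^ 2 - n * s + q) : s ^ 2 ≤ 4 * q := by
  obtain ⟨m, rfl | rfl⟩ := Int.even_or_odd' s
  · nlinarith [h m]
  · have h1 := h m
    by_contra! h2
    have h3 : q = m * (m + 1) := by nlinarith
    have h4 := Int.even_mul_succ_self m
    rw [← h3] at h4
    exact (Int.not_even_iff_odd.2 hq) h4

theorem cubicCharSum_sq_le [Fintype K] [DecidableEq K] [CharP K 3] {v : K} (hv : v ≠ 0) :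
    cubicCharSum K v ^ 2 ≤ 4 * Fintype.card K := by
  have h3 : (3 : K) = 0 := by exact_mod_cast CharP.cast_eq_zero K 3
  have hK : ringChar K ≠ 2 := by rw [ringChar.eq K 3]; norm_num
  have h2 : (2 : K) ≠ 0 := Ring.two_ne_zero hK
  set a := v ^ 3 with ha
  have ha0 : a ≠ 0 := pow_ne_zero 3 hv
  have hg : IsCoprime (X ^ 3 + X ^ 2 - C a : K[X]) (3 * X ^ 2 + 2 * X) := by
    have e3 : (3 : K[X]) = 0 := by
      rw [show (3 : K[X]) = C 3 from (map_ofNat C 3).symm, h3, C_0]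
    have ea : C a⁻¹ * C a = (1 : K[X]) := by rw [← C_mul, inv_mul_cancel₀ ha0, C_1]
    refine ⟨-C a⁻¹, C a⁻¹ * 2 * (X ^ 2 + X), ?_⟩
    linear_combination ea + (C a⁻¹ * (2 * X ^ 4 + 3 * X ^ 3 + X ^ 2 + 0)) * e3
  set q := Fintype.card K with hq
  set N : ℤ → ℕ := fun e =>
    (Finset.univ.filter fun x => quadraticChar K (x ^ 3 + x ^ 2 - a) = e).card with hN
  have hS : cubicCharSum K v = N 1 - N (-1) := by
    have h1 : cubicCharSum K v = ∑ x : K, quadraticChar K (x ^ 3 + x ^ 2 - a) := by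
      rw [cubicCharSum, ← Equiv.sum_comp (Equiv.subRight v)]
      refine Finset.sum_congr rfl fun x _ => ?_
      congr 1
      simp only [Equiv.subRight_apply, ha]
      linear_combination (-x ^ 2 * v + x * v ^ 2) * h3
    have h2 : ∀ y : K, quadraticChar K y = (if quadraticChar K y = 1 then 1 else 0) -
        (if quadraticChar K y = -1 then 1 else 0) := by
      intro y
      by_cases hy : y = 0
      · simp [hy]
      · rcases quadraticChar_dichotomy hy with h | h <;> simp [h]
    rw [h1, Finset.sum_congr rfl fun x _ => h2 _, Finset.sum_sub_distrib, Finset.sum_boole,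
      Finset.sum_boole]
  have hcard : N 1 + N (-1) + N 0 = q := by
    have h2 : ∀ y : K, (if quadraticChar K y = 1 then 1 else 0) +
        (if quadraticChar K y = -1 then 1 else 0) + (if quadraticChar K y = 0 then 1 else 0) =
        1 := by
      intro y
      by_cases hy : y = 0
      · simp [hy]
      · rcases quadraticChar_dichotomy hy with h | h <;> simp [h]
    simp only [hN, Finset.card_filter, ← Finset.sum_add_distrib, h2]
    simp [hq]
  have h0 : HasPoleAtInfinity (X ^ q : K[X]) 1 := by
    refine ⟨isCoprime_one_right, Or.inr ?_⟩
    rw [natDegree_one, natDegree_X_pow]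
    exact Fintype.card_pos
  have key : ∀ ε : ℤ, ε = 1 ∨ ε = -1 → ∀ n : ℕ,
      0 ≤ (n : ℤ) ^ 2 - n * (N ε - N (-ε)) + q := by
    intro ε hε n
    obtain ⟨f, k, hfk, hl, hdeg⟩ := exists_xCoordLink_frobenius hK a hε
    have hmain := hl.natDegree_nonneg h2 a hg h0 hfk n
    rw [natDegree_X_pow] at hmain
    have hsum : N ε + N (-ε) + N 0 = q := by
      rcases hε with rfl | rfl
      · exact hcard
      · rw [neg_neg, ← hcard]; ring
    have hdeg' : (f.natDegree : ℤ) - q ≤ 1 - (N ε - N (-ε)) := by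
      change f.natDegree + 2 * N ε + N 0 ≤ 2 * q + 1 at hdeg
      omega
    nlinarith [mul_le_mul_of_nonneg_left hdeg' (Int.natCast_nonneg n)]
  refine sq_le_of_forall_quadratic_nonneg
    (by
      rw [Int.odd_coe_nat, Nat.odd_iff]
      exact FiniteField.odd_card_of_char_ne_two hK) fun n => ?_
  rw [hS]
  obtain ⟨n, rfl | rfl⟩ := n.eq_nat_or_neg
  · exact key 1 (Or.inl rfl) n
  · have := key (-1) (Or.inr rfl) n
    rw [neg_neg] at this
    linarith

end Hasse

section CubicTheta

open Complex

/-- The norm form `m² + mn + n²` of the hexagonal lattice. -/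
def hexNorm (v : ℤ × ℤ) : ℤ := v.1 ^ 2 + v.1 * v.2 + v.2 ^ 2

/-- The theta series `∑ g(v) exp(2πiτ N(v))` over the hexagonal lattice with weight `g`. -/
noncomputable def hexTheta (g : ℤ × ℤ → ℂ) (τ : ℂ) : ℂ :=
  ∑' v, g v * cexp (2 * Real.pi * I * τ * hexNorm v)

/-- The primitive cube root of unity `exp(2πi/3)`. -/
noncomputable def cubeRoot : ℂ := cexp (2 * Real.pi * I / (3 : ℕ))

theorem cubeRoot_isPrimitiveRoot : IsPrimitiveRoot cubeRoot 3 :=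
  Complex.isPrimitiveRoot_exp 3 (by norm_num)

theorem cubeRoot_ne_zero : cubeRoot ≠ 0 := Complex.exp_ne_zero _

theorem one_add_cubeRoot_add_sq : 1 + cubeRoot + cubeRoot ^ 2 = 0 := by
  have := cubeRoot_isPrimitiveRoot.geom_sum_eq_zero (by norm_num)
  simpa [Finset.sum_range_succ] using this

theorem cubeRoot_zpow (s : ℤ) : cubeRoot ^ s = cubeRoot ^ (s % 3) := by
  conv_lhs => rw [← Int.mul_ediv_add_emod s 3]
  rw [zpow_add₀ cubeRoot_ne_zero, zpow_mul]
  have : cubeRoot ^ (3 : ℤ) = 1 := by exact_mod_cast cubeRoot_isPrimitiveRoot.pow_eq_one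
  rw [this, one_zpow, one_mul]

theorem norm_cubeRoot_zpow (s : ℤ) : ‖cubeRoot ^ s‖ = 1 := by
  rw [norm_zpow, cubeRoot_isPrimitiveRoot.norm'_eq_one (by norm_num), one_zpow]

theorem one_add_cubeRoot_zpow (s : ℤ) :
    1 + cubeRoot ^ s + cubeRoot ^ (-s) = if s % 3 = 0 then 3 else 0 := by
  rw [cubeRoot_zpow s, cubeRoot_zpow (-s)]
  have h1 := one_add_cubeRoot_add_sq
  rcases (by omega : s % 3 = 0 ∧ -s % 3 = 0 ∨ s % 3 = 1 ∧ -s % 3 = 2 ∨ s % 3 = 2 ∧ -s % 3 = 1)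
    with ⟨h, h'⟩ | ⟨h, h'⟩ | ⟨h, h'⟩ <;> rw [h, h'] <;> norm_num
  · exact_mod_cast h1
  · linear_combination h1

theorem one_add_cubeRoot_mul_zpow (s : ℤ) :
    1 + cubeRoot ^ 2 * cubeRoot ^ s + cubeRoot * cubeRoot ^ (-s) =
      if s % 3 = 1 then 3 else 0 := by
  have h := one_add_cubeRoot_zpow (s - 1)
  have e1 : cubeRoot ^ (s - 1) = cubeRoot ^ 2 * cubeRoot ^ s := by
    rw [sub_eq_add_neg, zpow_add₀ cubeRoot_ne_zero, mul_comm, cubeRoot_zpow (-1)]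
    norm_cast
  have e2 : cubeRoot ^ (-(s - 1)) = cubeRoot * cubeRoot ^ (-s) := by
    rw [show -(s - 1) = 1 + -s by ring, zpow_add₀ cubeRoot_ne_zero, zpow_one]
  rw [e1, e2] at h
  rw [h]
  congr 1
  exact propext (by omega)

theorem norm_hexTerm (τ : ℂ) (v : ℤ × ℤ) :
    ‖cexp (2 * Real.pi * I * τ * hexNorm v)‖ = Real.exp (-2 * Real.pi * τ.im * hexNorm v) := by
  rw [norm_exp]
  congr 1
  simp

theorem summable_norm_hexTerm {τ : ℂ} (hτ : 0 < τ.im) :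
    Summable fun v => ‖cexp (2 * Real.pi * I * τ * hexNorm v)‖ := by
  have h1 : Summable fun n : ℤ => Real.exp (-Real.pi * τ.im * n ^ 2) := by
    have := ((summable_jacobiTheta₂_term_iff 0 τ).2 hτ).norm
    refine this.congr fun n => ?_
    rw [norm_jacobiTheta₂_term]
    simp
    ring
  have h2 := h1.mul_of_nonneg h1 (fun n => (Real.exp_pos _).le) (fun n => (Real.exp_pos _).le)
  refine Summable.of_nonneg_of_le (fun v => norm_nonneg _) (fun v => ?_) h2
  rw [norm_hexTerm, ← Real.exp_add, Real.exp_le_exp]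
  have h3 : (0 : ℝ) ≤ 2 * (hexNorm v : ℝ) - v.1 ^ 2 - v.2 ^ 2 := by
    rw [hexNorm]
    push_cast
    nlinarith [sq_nonneg ((v.1 : ℝ) + v.2)]
  nlinarith [mul_nonneg (mul_pos Real.pi_pos hτ).le h3]

theorem summable_norm_hexTheta {τ : ℂ} (hτ : 0 < τ.im) {g : ℤ × ℤ → ℂ} (hg : ∀ v, ‖g v‖ ≤ 1) :
    Summable fun v => ‖g v * cexp (2 * Real.pi * I * τ * hexNorm v)‖ := by
  refine Summable.of_nonneg_of_le (fun v => norm_nonneg _) (fun v => ?_) (summable_norm_hexTerm hτ)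
  rw [norm_mul]
  exact mul_le_of_le_one_left (norm_nonneg _) (hg v)

theorem hexTheta_neg (g : ℤ × ℤ → ℂ) (τ : ℂ) : hexTheta (fun v => g (-v)) τ = hexTheta g τ := by
  rw [hexTheta, hexTheta, ← (Equiv.neg (ℤ × ℤ)).tsum_eq]
  refine tsum_congr fun v => ?_
  simp [hexNorm]

/-- The Borwein cubic theta function `a`. -/
noncomputable def thetaA (τ : ℂ) : ℂ := hexTheta (fun _ => 1) τ

/-- The Borwein cubic theta function `b`. -/
noncomputable def thetaB (τ : ℂ) : ℂ := hexTheta (fun v => cubeRoot ^ (v.1 - v.2)) τ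

/-- The Borwein cubic theta function `c`. -/
noncomputable def thetaC (τ : ℂ) : ℂ :=
  hexTheta (fun v => if (v.1 - v.2) % 3 = 1 then 1 else 0) (τ / 3)

theorem thetaB_eq_neg (τ : ℂ) : thetaB τ = hexTheta (fun v => cubeRoot ^ (-(v.1 - v.2))) τ := by
  rw [thetaB, ← hexTheta_neg]
  refine tsum_congr fun v => ?_
  have e : (-v).1 - (-v).2 = -(v.1 - v.2) := by
    rw [Prod.fst_neg, Prod.snd_neg]
    ring
  simp only [e]

theorem hexTheta_sublattice (τ : ℂ) :
    hexTheta (fun v => if (v.1 - v.2) % 3 = 0 then 1 else 0) τ = thetaA (3 * τ) := by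
  have hinj : Function.Injective fun v : ℤ × ℤ => (v.1 - v.2, v.1 + 2 * v.2) := by
    intro v w h
    simp only [Prod.mk.injEq] at h
    ext <;> omega
  rw [thetaA, hexTheta, hexTheta, ← hinj.tsum_eq]
  · refine tsum_congr fun v => ?_
    rw [if_pos (by omega)]
    congr 2
    simp only [hexNorm]
    push_cast
    ring
  · intro v hv
    rw [Function.mem_support] at hv
    by_cases h : (v.1 - v.2) % 3 = 0
    · refine ⟨(v.1 - (v.1 - v.2) / 3, -((v.1 - v.2) / 3)), ?_⟩
      ext
      · simp
      · simp only
        omega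
    · simp [h] at hv

theorem three_mul_thetaA_three_mul {τ : ℂ} (hτ : 0 < τ.im) :
    3 * thetaA (3 * τ) = thetaA τ + 2 * thetaB τ := by
  rw [two_mul, ← add_assoc]
  nth_rewrite 2 [thetaB_eq_neg]
  have h1 := (summable_norm_hexTheta hτ (g := fun _ => 1) (by simp)).of_norm
  have h2 := (summable_norm_hexTheta hτ (g := fun v => cubeRoot ^ (v.1 - v.2))
    (fun v => (norm_cubeRoot_zpow _).le)).of_norm
  have h3 := (summable_norm_hexTheta hτ (g := fun v => cubeRoot ^ (-(v.1 - v.2)))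
    (fun v => (norm_cubeRoot_zpow _).le)).of_norm
  rw [← hexTheta_sublattice, thetaA, thetaB, hexTheta, hexTheta, hexTheta, hexTheta,
    ← h1.tsum_add h2, ← (h1.add h2).tsum_add h3, ← tsum_mul_left]
  refine tsum_congr fun v => ?_
  rw [← add_mul, ← add_mul, one_add_cubeRoot_zpow]
  split_ifs <;> simp

theorem thetaA_div_three {τ : ℂ} (hτ : 0 < τ.im) :
    thetaA (τ / 3) = thetaA τ + 2 * thetaC τ := by
  have hτ3 : 0 < (τ / 3).im := by
    rw [show τ / 3 = τ / ((3 : ℝ) : ℂ) by norm_num, Complex.div_ofReal_im]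
    positivity
  have hle : ∀ r : ℤ, ∀ v : ℤ × ℤ, ‖(if (v.1 - v.2) % 3 = r then 1 else 0 : ℂ)‖ ≤ 1 := by
    intro r v
    split_ifs <;> simp
  have h0 := (summable_norm_hexTheta hτ3 (hle 0)).of_norm
  have h1 := (summable_norm_hexTheta hτ3 (hle 1)).of_norm
  have h2 := (summable_norm_hexTheta hτ3 (hle 2)).of_norm
  have h21 : thetaC τ = hexTheta (fun v => if (v.1 - v.2) % 3 = 2 then 1 else 0) (τ / 3) := by
    rw [thetaC, ← hexTheta_neg]
    refine tsum_congr fun v => ?_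
    have e : (-v).1 - (-v).2 = -(v.1 - v.2) := by
      rw [Prod.fst_neg, Prod.snd_neg]
      ring
    simp only [e, (by omega : -(v.1 - v.2) % 3 = 1 ↔ (v.1 - v.2) % 3 = 2)]
  rw [two_mul, ← add_assoc]
  nth_rewrite 2 [h21]
  conv_rhs => rw [show τ = 3 * (τ / 3) by ring, ← hexTheta_sublattice]
  rw [show 3 * (τ / 3) = τ by ring, thetaC, thetaA, hexTheta, hexTheta, hexTheta, hexTheta,
    ← h0.tsum_add h1, ← (h0.add h1).tsum_add h2]
  refine tsum_congr fun v => ?_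
  rw [← add_mul, ← add_mul]
  congr 1
  rcases (by omega : (v.1 - v.2) % 3 = 0 ∨ (v.1 - v.2) % 3 = 1 ∨ (v.1 - v.2) % 3 = 2)
    with h | h | h <;> simp [h]

theorem summable_norm_triple {F : ℤ × ℤ → ℂ} (hF : Summable fun v => ‖F v‖) :
    Summable fun p : (ℤ × ℤ) × (ℤ × ℤ) × ℤ × ℤ => ‖F p.1 * (F p.2.1 * F p.2.2)‖ :=
  Summable.mul_norm (f := F) (g := fun q : (ℤ × ℤ) × ℤ × ℤ => F q.1 * F q.2) hF
    (Summable.mul_norm (f := F) (g := F) hF hF)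

theorem tsum_pow_three {F : ℤ × ℤ → ℂ} (hF : Summable fun v => ‖F v‖) :
    (∑' v, F v) ^ 3 =
      ∑' p : (ℤ × ℤ) × (ℤ × ℤ) × ℤ × ℤ, F p.1 * (F p.2.1 * F p.2.2) := by
  rw [pow_succ', sq, tsum_mul_tsum_of_summable_norm hF hF,
    tsum_mul_tsum_of_summable_norm hF (hF.mul_norm hF)]

/-- The residue of the sum of three lattice vectors modulo the prime above `3`. -/
def tripleResidue (p : (ℤ × ℤ) × (ℤ × ℤ) × ℤ × ℤ) : ℤ :=
  (p.1.1 - p.1.2) + ((p.2.1.1 - p.2.1.2) + (p.2.2.1 - p.2.2.2))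

/-- The sum of the norms of three lattice vectors. -/
def tripleNorm (p : (ℤ × ℤ) × (ℤ × ℤ) × ℤ × ℤ) : ℤ :=
  hexNorm p.1 + (hexNorm p.2.1 + hexNorm p.2.2)

/-- Unnormalized discrete Fourier transform on triples of Eisenstein integers. -/
def tripleFourier (p : (ℤ × ℤ) × (ℤ × ℤ) × ℤ × ℤ) : (ℤ × ℤ) × (ℤ × ℤ) × ℤ × ℤ :=
  ((p.1.1 + p.2.1.1 + p.2.2.1, p.1.2 + p.2.1.2 + p.2.2.2),
    (p.1.1 - p.2.1.1 - p.2.1.2 + p.2.2.2, p.1.2 + p.2.1.1 - p.2.2.1 - p.2.2.2),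
    (p.1.1 + p.2.1.2 - p.2.2.1 - p.2.2.2, p.1.2 - p.2.1.1 - p.2.1.2 + p.2.2.1))

/-- Multiplication by a cube root of unity in the first of three lattice vectors. -/
def tripleRotate :
    ((ℤ × ℤ) × (ℤ × ℤ) × ℤ × ℤ) ≃ ((ℤ × ℤ) × (ℤ × ℤ) × ℤ × ℤ) where
  toFun p := ((-p.1.1 - p.1.2, p.1.1), p.2)
  invFun p := ((p.1.2, -p.1.1 - p.1.2), p.2)
  left_inv p := by ext <;> simp
  right_inv p := by
    ext <;> simp only
    ring

theorem tripleNorm_tripleFourier (p : (ℤ × ℤ) × (ℤ × ℤ) × ℤ × ℤ) :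
    tripleNorm (tripleFourier p) = 3 * tripleNorm p := by
  simp only [tripleNorm, tripleFourier, hexNorm]
  ring

theorem tripleNorm_tripleRotate (p : (ℤ × ℤ) × (ℤ × ℤ) × ℤ × ℤ) :
    tripleNorm (tripleRotate p) = tripleNorm p := by
  simp only [tripleNorm, tripleRotate, hexNorm, Equiv.coe_fn_mk]
  ring

theorem tripleFourier_injective : Function.Injective tripleFourier := by
  intro p p' h
  simp only [tripleFourier, Prod.mk.injEq] at h
  ext <;> omega

/-- All three lattice vectors have residue `1` modulo the prime above `3`. -/
def TripleShifted (p : (ℤ × ℤ) × (ℤ × ℤ) × ℤ × ℤ) : Prop :=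
  (p.1.1 - p.1.2) % 3 = 1 ∧ (p.2.1.1 - p.2.1.2) % 3 = 1 ∧ (p.2.2.1 - p.2.2.2) % 3 = 1

/-- The class modulo `3` of the sum of three lattice vectors of residue `1`. -/
def tripleClass (p : (ℤ × ℤ) × (ℤ × ℤ) × ℤ × ℤ) : ℤ := (p.1.1 + p.2.1.1 + p.2.2.1) % 3

theorem mem_range_tripleFourier {p : (ℤ × ℤ) × (ℤ × ℤ) × ℤ × ℤ} (h : TripleShifted p)
    (h0 : tripleClass p = 0) : p ∈ Set.range tripleFourier := by
  obtain ⟨⟨m₁, n₁⟩, ⟨m₂, n₂⟩, ⟨m₃, n₃⟩⟩ := p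
  simp only [TripleShifted, tripleClass] at h h0
  refine ⟨(((m₁ + m₂ + m₃) / 3, (n₁ + n₂ + n₃) / 3),
    ((m₁ + n₂ - m₃ - n₃) / 3, (n₁ - m₂ - n₂ + m₃) / 3),
    ((m₁ - m₂ - n₂ + n₃) / 3, (n₁ + m₂ - m₃ - n₃) / 3)), ?_⟩
  simp only [tripleFourier, Prod.mk.injEq]
  omega

theorem tripleFourier_shifted_iff (p : (ℤ × ℤ) × (ℤ × ℤ) × ℤ × ℤ) :
    TripleShifted (tripleFourier p) ∧ tripleClass (tripleFourier p) = 0 ↔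
      tripleResidue p % 3 = 1 := by
  simp only [TripleShifted, tripleFourier, tripleClass, tripleResidue]
  omega

theorem tripleRotate_shifted_iff (p : (ℤ × ℤ) × (ℤ × ℤ) × ℤ × ℤ) (r : ℤ) :
    TripleShifted (tripleRotate p) ∧ tripleClass (tripleRotate p) = (r + 1) % 3 ↔
      TripleShifted p ∧ tripleClass p = r % 3 := by
  simp only [TripleShifted, tripleRotate, tripleClass, Equiv.coe_fn_mk]
  omega

theorem prod_hexTerm (τ : ℂ) (p : (ℤ × ℤ) × (ℤ × ℤ) × ℤ × ℤ) :
    cexp (2 * Real.pi * I * τ * hexNorm p.1) * (cexp (2 * Real.pi * I * τ * hexNorm p.2.1) *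
      cexp (2 * Real.pi * I * τ * hexNorm p.2.2)) = cexp (2 * Real.pi * I * τ * tripleNorm p) := by
  rw [← Complex.exp_add, ← Complex.exp_add, tripleNorm]
  congr 1
  push_cast
  ring

theorem thetaA_pow_three_sub_thetaB_pow_three {τ : ℂ} (hτ : 0 < τ.im) :
    thetaA τ ^ 3 - thetaB τ ^ 3 = ∑' p : (ℤ × ℤ) × (ℤ × ℤ) × ℤ × ℤ,
      if tripleResidue p % 3 = 1 then 3 * cexp (2 * Real.pi * I * τ * tripleNorm p) else 0 := by
  have h1 := summable_norm_hexTheta hτ (g := fun _ => 1) (by simp)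
  have h2 := summable_norm_hexTheta hτ (g := fun v => cubeRoot ^ (v.1 - v.2))
    (fun v => (norm_cubeRoot_zpow _).le)
  have h3 := summable_norm_hexTheta hτ (g := fun v => cubeRoot ^ (-(v.1 - v.2)))
    (fun v => (norm_cubeRoot_zpow _).le)
  have e : thetaA τ ^ 3 - thetaB τ ^ 3 = hexTheta (fun _ => 1) τ ^ 3 +
      cubeRoot ^ 2 * hexTheta (fun v => cubeRoot ^ (v.1 - v.2)) τ ^ 3 +
      cubeRoot * hexTheta (fun v => cubeRoot ^ (-(v.1 - v.2))) τ ^ 3 := by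
    rw [← thetaB_eq_neg, ← thetaA, ← thetaB]
    linear_combination -thetaB τ ^ 3 * one_add_cubeRoot_add_sq
  rw [e, hexTheta, hexTheta, hexTheta, tsum_pow_three h1, tsum_pow_three h2, tsum_pow_three h3,
    ← tsum_mul_left, ← tsum_mul_left,
    ← (summable_norm_triple h1).of_norm.tsum_add ((summable_norm_triple h2).of_norm.mul_left _),
    ← ((summable_norm_triple h1).of_norm.add
      ((summable_norm_triple h2).of_norm.mul_left _)).tsum_add
      ((summable_norm_triple h3).of_norm.mul_left _)]
  refine tsum_congr fun p => ?_
  have hχ := one_add_cubeRoot_mul_zpow (tripleResidue p)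
  rw [tripleResidue, neg_add, neg_add, zpow_add₀ cubeRoot_ne_zero, zpow_add₀ cubeRoot_ne_zero,
    zpow_add₀ cubeRoot_ne_zero, zpow_add₀ cubeRoot_ne_zero] at hχ
  rw [show (if tripleResidue p % 3 = 1 then 3 * cexp (2 * Real.pi * I * τ * tripleNorm p) else 0) =
    (if tripleResidue p % 3 = 1 then 3 else 0) * cexp (2 * Real.pi * I * τ * tripleNorm p) by
      split_ifs <;> simp, tripleResidue, ← hχ, ← prod_hexTerm]
  ring

theorem thetaC_pow_three {τ : ℂ} (hτ : 0 < τ.im) :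
    thetaC τ ^ 3 = ∑' p : (ℤ × ℤ) × (ℤ × ℤ) × ℤ × ℤ,
      if tripleResidue p % 3 = 1 then 3 * cexp (2 * Real.pi * I * τ * tripleNorm p) else 0 := by
  classical
  have hτ3 : 0 < (τ / 3).im := by
    rw [show τ / 3 = τ / ((3 : ℝ) : ℂ) by norm_num, Complex.div_ofReal_im]
    positivity
  have h1 := summable_norm_hexTheta hτ3
    (g := fun v => if (v.1 - v.2) % 3 = 1 then 1 else 0) (fun v => by split_ifs <;> simp)
  set H : (ℤ × ℤ) × (ℤ × ℤ) × ℤ × ℤ → ℂ := fun p =>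
    if TripleShifted p then cexp (2 * Real.pi * I * (τ / 3) * tripleNorm p) else 0 with hH
  have hprod : ∀ p : (ℤ × ℤ) × (ℤ × ℤ) × ℤ × ℤ,
      ((if (p.1.1 - p.1.2) % 3 = 1 then 1 else 0) *
        cexp (2 * Real.pi * I * (τ / 3) * hexNorm p.1)) *
      (((if (p.2.1.1 - p.2.1.2) % 3 = 1 then 1 else 0) *
        cexp (2 * Real.pi * I * (τ / 3) * hexNorm p.2.1)) *
      ((if (p.2.2.1 - p.2.2.2) % 3 = 1 then 1 else 0) *
        cexp (2 * Real.pi * I * (τ / 3) * hexNorm p.2.2))) = H p := by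
    intro p
    rw [hH]
    simp only [TripleShifted, ← prod_hexTerm]
    split_ifs <;> simp_all
  have hHs : Summable fun p => ‖H p‖ := by
    simpa only [hprod] using summable_norm_triple h1
  set Hr : ℤ → (ℤ × ℤ) × (ℤ × ℤ) × ℤ × ℤ → ℂ := fun r p =>
    if TripleShifted p ∧ tripleClass p = r % 3 then
      cexp (2 * Real.pi * I * (τ / 3) * tripleNorm p) else 0 with hHr
  have hHrs : ∀ r, Summable (Hr r) := by
    intro r
    refine Summable.of_norm_bounded hHs fun p => ?_
    simp only [hH, hHr]
    by_cases h : TripleShifted p <;> by_cases h' : tripleClass p = r % 3 <;> simp [h, h']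
  have hrot : ∀ r, ∑' p, Hr (r + 1) p = ∑' p, Hr r p := by
    intro r
    rw [← tripleRotate.tsum_eq]
    refine tsum_congr fun p => ?_
    simp only [hHr, tripleRotate_shifted_iff, tripleNorm_tripleRotate]
  have hsum : ∑' p, H p = 3 * ∑' p, Hr 0 p := by
    have e : ∀ p, H p = Hr 0 p + Hr 1 p + Hr 2 p := by
      intro p
      simp only [hH, hHr]
      rcases (by unfold tripleClass; omega : tripleClass p = 0 ∨ tripleClass p = 1 ∨
        tripleClass p = 2) with h | h | h <;> simp [h]
    have h1 := hrot 0
    have h2 := hrot 1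
    rw [zero_add] at h1
    rw [one_add_one_eq_two] at h2
    rw [tsum_congr e, ((hHrs 0).add (hHrs 1)).tsum_add (hHrs 2), (hHrs 0).tsum_add (hHrs 1),
      h2, h1]
    ring
  rw [thetaC, hexTheta, tsum_pow_three h1, tsum_congr hprod, hsum, ← tsum_mul_left,
    ← tripleFourier_injective.tsum_eq]
  · refine tsum_congr fun p => ?_
    simp only [hHr]
    have := tripleFourier_shifted_iff p
    simp only [EuclideanDomain.zero_mod, this, tripleNorm_tripleFourier]
    split_ifs
    · congr 2
      push_cast
      ring
    · simp
  · intro p hp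
    rw [Function.mem_support] at hp
    by_cases h : TripleShifted p ∧ tripleClass p = 0
    · exact mem_range_tripleFourier h.1 h.2
    · simp [hHr, h] at hp

theorem thetaA_pow_three {τ : ℂ} (hτ : 0 < τ.im) :
    thetaA τ ^ 3 = thetaB τ ^ 3 + thetaC τ ^ 3 := by
  rw [thetaC_pow_three hτ, ← thetaA_pow_three_sub_thetaB_pow_three hτ]
  ring

theorem im_neg_one_div_pos {τ : ℂ} (hτ : 0 < τ.im) : 0 < (-1 / τ).im := by
  have hn : 0 < Complex.normSq τ := Complex.normSq_pos.2 (by rintro rfl; simp at hτ)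
  rw [neg_div, one_div, Complex.neg_im, Complex.inv_im]
  rw [neg_div, neg_neg]
  positivity

theorem im_real_mul_pos {τ : ℂ} (hτ : 0 < τ.im) {r : ℝ} (hr : 0 < r) : 0 < ((r : ℂ) * τ).im := by
  rw [Complex.im_ofReal_mul]
  positivity

/-- The automorphy constant `-i√3` of the Fricke involution. -/
noncomputable def frickeConst : ℂ := -I * Real.sqrt 3

theorem frickeConst_sq : frickeConst ^ 2 = -3 := by
  rw [frickeConst, mul_pow, neg_sq, I_sq, ← Complex.ofReal_pow, Real.sq_sqrt (by norm_num)]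
  norm_num

theorem cpow_half_mul_cpow_half {z : ℂ} (hz : z ≠ 0) :
    (2 * z) ^ (1 / 2 : ℂ) * (3 / 2 * z) ^ (1 / 2 : ℂ) = Real.sqrt 3 * z := by
  have h2 : (2 : ℂ) * z = ((2 : ℝ) : ℂ) * z := by norm_num
  have h3 : (3 / 2 : ℂ) * z = ((3 / 2 : ℝ) : ℂ) * z := by norm_num
  have hr : Real.sqrt 3 = Real.exp ((Real.log 2 + Real.log (3 / 2)) / 2) := by
    rw [← Real.log_mul (by norm_num) (by norm_num), Real.sqrt_eq_rpow,
      Real.rpow_def_of_pos (by norm_num)]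
    norm_num
    ring
  rw [cpow_def_of_ne_zero (by simp [hz]), cpow_def_of_ne_zero (by simp [hz]), h2, h3,
    log_ofReal_mul (by norm_num) hz, log_ofReal_mul (by norm_num) hz, ← Complex.exp_add, hr,
    Complex.ofReal_exp]
  conv_rhs => rw [← Complex.exp_log hz, ← Complex.exp_add]
  congr 1
  push_cast
  ring

/-- The intermediate double series obtained from `thetaA` by Poisson summation in one variable. -/
noncomputable def frickeTerm (τ : ℂ) (m k : ℤ) : ℂ :=
  cexp (3 * Real.pi * I * τ * m ^ 2 / 2 + Real.pi * I * k * m - Real.pi * I * k ^ 2 / (2 * τ))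

theorem summable_frickeTerm {τ : ℂ} (hτ : 0 < τ.im) :
    Summable (Function.uncurry (frickeTerm τ)) := by
  have h1 : 0 < (((3 / 2 : ℝ) : ℂ) * τ).im := im_real_mul_pos hτ (by norm_num)
  have h2 : 0 < (-1 / (((2 : ℝ) : ℂ) * τ)).im :=
    im_neg_one_div_pos (im_real_mul_pos hτ (by norm_num))
  have s1 := ((summable_jacobiTheta₂_term_iff 0 _).2 h1).norm
  have s2 := ((summable_jacobiTheta₂_term_iff 0 _).2 h2).norm
  refine Summable.of_norm_bounded (s1.mul_of_nonneg s2 (fun _ => norm_nonneg _)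
    (fun _ => norm_nonneg _)) fun p => le_of_eq ?_
  rw [← norm_mul, Function.uncurry, frickeTerm]
  have e : ‖cexp ((p.1 * p.2 : ℤ) * (Real.pi * I))‖ = 1 := by
    have := Complex.norm_exp_ofReal_mul_I ((p.1 * p.2 : ℤ) * Real.pi)
    rw [← this]
    congr 2
    push_cast
    ring
  rw [← one_mul ‖_ * _‖, ← e, ← norm_mul, jacobiTheta₂_term, jacobiTheta₂_term, ← Complex.exp_add,
    ← Complex.exp_add]
  have h0 : τ ≠ 0 := by rintro rfl; simp at hτ
  congr 2
  push_cast
  field_simp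
  ring

theorem thetaA_eq_tsum {τ : ℂ} (hτ : 0 < τ.im) :
    thetaA τ = ∑' m : ℤ, cexp (2 * Real.pi * I * τ * m ^ 2) * jacobiTheta₂ (m * τ) (2 * τ) := by
  rw [thetaA, hexTheta, (summable_norm_hexTheta hτ (g := fun _ => 1) (by simp)).of_norm.tsum_prod]
  refine tsum_congr fun m => ?_
  rw [jacobiTheta₂, ← tsum_mul_left]
  refine tsum_congr fun n => ?_
  rw [jacobiTheta₂_term, ← Complex.exp_add, one_mul, hexNorm]
  congr 1
  push_cast
  ring

theorem thetaA_fricke {τ : ℂ} (hτ : 0 < τ.im) :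
    thetaA (-1 / (3 * τ)) = frickeConst * τ * thetaA τ := by
  have h0 : τ ≠ 0 := by rintro rfl; simp at hτ
  have hσ : 0 < (-1 / (3 * τ)).im := by
    have := im_neg_one_div_pos (im_real_mul_pos hτ (r := 3) (by norm_num))
    exact_mod_cast this
  have comm : ∀ x c e t : ℂ, x * (c * e * t) = c * (x * e * t) := fun x c e t => by ring
  have e1 : ∀ m : ℤ, cexp (2 * Real.pi * I * τ * m ^ 2) * jacobiTheta₂ (m * τ) (2 * τ) =
      1 / (2 * (-I * τ)) ^ (1 / 2 : ℂ) * ∑' k, frickeTerm τ m k := by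
    intro m
    rw [jacobiTheta₂_functional_equation, show -I * (2 * τ) = 2 * (-I * τ) by ring, comm,
      jacobiTheta₂, ← tsum_mul_left, ← Complex.exp_add]
    congr 1
    refine tsum_congr fun k => ?_
    rw [jacobiTheta₂_term, ← Complex.exp_add, frickeTerm]
    congr 1
    field_simp
    ring
  have e2 : ∀ k : ℤ, ∑' m, frickeTerm τ m k = 1 / (3 / 2 * (-I * τ)) ^ (1 / 2 : ℂ) *
      (cexp (2 * Real.pi * I * (-1 / (3 * τ)) * k ^ 2) *
        jacobiTheta₂ (k * (-1 / (3 * τ))) (2 * (-1 / (3 * τ)))) := by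
    intro k
    have h : ∑' m, frickeTerm τ m k =
        cexp (-Real.pi * I * k ^ 2 / (2 * τ)) * jacobiTheta₂ (k / 2) (3 / 2 * τ) := by
      rw [jacobiTheta₂, ← tsum_mul_left]
      refine tsum_congr fun m => ?_
      rw [jacobiTheta₂_term, ← Complex.exp_add, frickeTerm]
      congr 1
      field_simp
      ring
    rw [h, jacobiTheta₂_functional_equation, show -I * (3 / 2 * τ) = 3 / 2 * (-I * τ) by ring, comm,
      ← Complex.exp_add, mul_assoc, ← jacobiTheta₂_neg_left (k * _)]
    congr 2
    · congr 1
      field_simp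
      ring
    · congr 1 <;> field_simp
  have key : thetaA τ = 1 / (2 * (-I * τ)) ^ (1 / 2 : ℂ) *
      (1 / (3 / 2 * (-I * τ)) ^ (1 / 2 : ℂ) * thetaA (-1 / (3 * τ))) := by
    rw [thetaA_eq_tsum hτ, thetaA_eq_tsum hσ, tsum_congr e1, tsum_mul_left,
      ← (summable_frickeTerm hτ).tsum_comm, tsum_congr e2, tsum_mul_left]
  have hz : -I * τ ≠ 0 := by simp [h0]
  have hc := cpow_half_mul_cpow_half hz
  have hs : (Real.sqrt 3 : ℂ) ≠ 0 := by
    rw [Complex.ofReal_ne_zero]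
    positivity
  rw [← mul_assoc, one_div_mul_one_div, hc] at key
  rw [key, frickeConst]
  field_simp

theorem thetaB_eq {τ : ℂ} (hτ : 0 < τ.im) : thetaB τ = (3 * thetaA (3 * τ) - thetaA τ) / 2 := by
  rw [three_mul_thetaA_three_mul hτ]
  ring

theorem thetaC_eq {τ : ℂ} (hτ : 0 < τ.im) : thetaC τ = (thetaA (τ / 3) - thetaA τ) / 2 := by
  rw [thetaA_div_three hτ]
  ring

theorem im_three_mul_pos {τ : ℂ} (hτ : 0 < τ.im) : 0 < (3 * τ).im := by
  exact_mod_cast im_real_mul_pos hτ (r := 3) (by norm_num)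

theorem im_div_three_pos {τ : ℂ} (hτ : 0 < τ.im) : 0 < (τ / 3).im := by
  have := im_real_mul_pos hτ (r := 3⁻¹) (by norm_num)
  rwa [Complex.ofReal_inv, Complex.ofReal_ofNat, mul_comm, ← div_eq_mul_inv] at this

theorem thetaB_div_three {τ : ℂ} (hτ : 0 < τ.im) : thetaB (τ / 3) = thetaA τ - thetaC τ := by
  rw [thetaB_eq (im_div_three_pos hτ), mul_div_cancel₀ _ three_ne_zero, thetaC_eq hτ]
  ring

theorem thetaB_fricke {τ : ℂ} (hτ : 0 < τ.im) :
    thetaB (-1 / (3 * τ)) = frickeConst * τ * thetaC τ := by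
  have h0 : τ ≠ 0 := by rintro rfl; simp at hτ
  have h := thetaA_fricke (im_div_three_pos hτ)
  rw [thetaB_eq (im_neg_one_div_pos (im_three_mul_pos hτ)), thetaA_fricke hτ, thetaC_eq hτ,
    show 3 * (-1 / (3 * τ)) = -1 / (3 * (τ / 3)) by field_simp, h]
  ring

theorem thetaC_fricke {τ : ℂ} (hτ : 0 < τ.im) :
    thetaC (-1 / (3 * τ)) = frickeConst * τ * thetaB τ := by
  have h := thetaA_fricke (im_three_mul_pos hτ)
  rw [thetaC_eq (im_neg_one_div_pos (im_three_mul_pos hτ)), thetaA_fricke hτ, thetaB_eq hτ,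
    show -1 / (3 * τ) / 3 = -1 / (3 * (3 * τ)) by rw [div_div, mul_comm (3 * τ)], h]
  ring

theorem hexTheta_add_int (g : ℤ × ℤ → ℂ) (τ : ℂ) (j : ℤ) :
    hexTheta g (τ + j) = hexTheta g τ := by
  refine tsum_congr fun v => ?_
  rw [show 2 * (Real.pi : ℂ) * I * (τ + j) * hexNorm v =
    2 * Real.pi * I * τ * hexNorm v + (j * hexNorm v : ℤ) * (2 * Real.pi * I) by push_cast; ring,
    Complex.exp_add, Complex.exp_int_mul_two_pi_mul_I, mul_one]

theorem thetaA_add_int (τ : ℂ) (j : ℤ) : thetaA (τ + j) = thetaA τ := hexTheta_add_int _ τ j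

theorem thetaB_add_int (τ : ℂ) (j : ℤ) : thetaB (τ + j) = thetaB τ := hexTheta_add_int _ τ j

theorem thetaC_add_int_pow_three {τ : ℂ} (hτ : 0 < τ.im) (j : ℤ) :
    thetaC (τ + j) ^ 3 = thetaC τ ^ 3 := by
  have h := thetaA_pow_three (τ := τ + j) (by simpa using hτ)
  rw [thetaA_add_int, thetaB_add_int, thetaA_pow_three hτ] at h
  exact (add_left_cancel h).symm

theorem frickeConst_mul (s : ℂ) (hs : s ≠ 0) :
    frickeConst * (-1 / (3 * s) + 1) * (frickeConst * s) = 1 - 3 * s := by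
  field_simp
  linear_combination (3 * s - 1) * frickeConst_sq

theorem theta_unipotent {s : ℂ} (hs : 0 < s.im) :
    thetaA (s / (1 - 3 * s)) = (1 - 3 * s) * thetaA s ∧
      thetaB (s / (1 - 3 * s)) ^ 3 = (1 - 3 * s) ^ 3 * thetaB s ^ 3 ∧
      thetaC (s / (1 - 3 * s)) ^ 3 = (1 - 3 * s) ^ 3 * thetaC s ^ 3 := by
  have h0 : s ≠ 0 := by rintro rfl; simp at hs
  have hσ := im_neg_one_div_pos (im_three_mul_pos hs)
  set σ := -1 / (3 * s) with hσ_def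
  have hσ' : 0 < (σ + (1 : ℤ)).im := by simpa using hσ
  have h1 : 1 - 3 * s ≠ 0 := by
    intro h
    have := congrArg Complex.im h
    simp at this
    exact hs.ne' this
  have e : s / (1 - 3 * s) = -1 / (3 * (σ + (1 : ℤ))) := by
    rw [hσ_def]
    have : 3 * s - 1 ≠ 0 := by rwa [← neg_ne_zero, neg_sub]
    have h2 : 3 * (-1 / (3 * s) + ((1 : ℤ) : ℂ)) = -(1 - 3 * s) / s := by
      push_cast
      field_simp
      ring
    rw [h2]
    field_simp
  have hk := frickeConst_mul s h0
  rw [← hσ_def] at hk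
  rw [e, thetaA_fricke hσ', thetaB_fricke hσ', thetaC_fricke hσ', thetaA_add_int, thetaB_add_int,
    mul_pow _ (thetaC _), thetaC_add_int_pow_three hσ, hσ_def, thetaA_fricke hs, thetaB_fricke hs,
    thetaC_fricke hs, ← hσ_def, ← hk]
  push_cast
  refine ⟨?_, ?_, ?_⟩ <;> ring

theorem hexNorm_pos {v : ℤ × ℤ} (hv : v ≠ 0) : 0 < hexNorm v := by
  by_contra! h
  rw [hexNorm] at h
  have h1 : v.1 ^ 2 ≤ 0 := by nlinarith [sq_nonneg (v.1 + 2 * v.2)]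
  have h2 : v.2 ^ 2 ≤ 0 := by nlinarith [sq_nonneg (2 * v.1 + v.2)]
  exact hv (Prod.ext (pow_eq_zero_iff two_ne_zero |>.1 (le_antisymm h1 (sq_nonneg _)))
    (pow_eq_zero_iff two_ne_zero |>.1 (le_antisymm h2 (sq_nonneg _))))

theorem tendsto_thetaA {τ : ℂ} (hτ : 0 < τ.im) :
    Filter.Tendsto (fun j : ℕ => thetaA (3 ^ j * τ)) Filter.atTop (nhds 1) := by
  have him : ∀ j : ℕ, (3 ^ j * τ).im = 3 ^ j * τ.im := by
    intro j
    have := Complex.im_ofReal_mul (3 ^ j) τ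
    exact_mod_cast this
  have h := tendsto_tsum_of_dominated_convergence (𝓕 := Filter.atTop) (β := ℤ × ℤ)
    (f := fun (j : ℕ) v => 1 * cexp (2 * Real.pi * I * (3 ^ j * τ) * hexNorm v))
    (g := fun v => if v = 0 then 1 else 0)
    (bound := fun v => ‖cexp (2 * Real.pi * I * τ * hexNorm v)‖) (summable_norm_hexTerm hτ) ?_ ?_
  · rwa [tsum_ite_eq] at h
  · intro v
    by_cases hv : v = 0
    · simp [hv, hexNorm]
    · rw [if_neg hv, tendsto_zero_iff_norm_tendsto_zero]
      have hpos : 0 < 2 * Real.pi * τ.im * hexNorm v := by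
        have : (0 : ℝ) < hexNorm v := by exact_mod_cast hexNorm_pos hv
        positivity
      have e : ∀ j : ℕ, ‖1 * cexp (2 * Real.pi * I * (3 ^ j * τ) * hexNorm v)‖ =
          Real.exp (-(3 ^ j * (2 * Real.pi * τ.im * hexNorm v))) := by
        intro j
        rw [one_mul, norm_hexTerm, him]
        congr 1
        ring
      simp_rw [e]
      exact Real.tendsto_exp_neg_atTop_nhds_zero.comp
        ((tendsto_pow_atTop_atTop_of_one_lt (by norm_num : (1 : ℝ) < 3)).atTop_mul_const hpos)
  · refine Filter.Eventually.of_forall fun j v => ?_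
    rw [one_mul, norm_hexTerm, norm_hexTerm, Real.exp_le_exp, him]
    have h1 : (0 : ℝ) ≤ hexNorm v := by
      by_cases hv : v = 0
      · simp [hv, hexNorm]
      · exact_mod_cast (hexNorm_pos hv).le
    have h2 : (1 : ℝ) ≤ 3 ^ j := one_le_pow₀ (by norm_num)
    have h3 : 0 ≤ Real.pi * τ.im * hexNorm v := by positivity
    nlinarith [mul_nonneg (sub_nonneg.2 h2) h3]

theorem not_theta_eq_zero {τ : ℂ} (hτ : 0 < τ.im) :
    ¬(thetaA τ = 0 ∧ thetaB τ = 0 ∧ thetaC τ = 0) := by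
  intro h
  have step : ∀ {σ : ℂ}, 0 < σ.im → thetaA σ = 0 ∧ thetaB σ = 0 ∧ thetaC σ = 0 →
      thetaA (3 * σ) = 0 ∧ thetaB (3 * σ) = 0 ∧ thetaC (3 * σ) = 0 := by
    rintro σ hσ ⟨hA, hB, hC⟩
    have hσ3 := im_three_mul_pos hσ
    have hA3 : thetaA (3 * σ) = 0 := by
      have := three_mul_thetaA_three_mul hσ
      rw [hA, hB] at this
      simpa using this
    have hC3 : thetaC (3 * σ) = 0 := by
      rw [thetaC_eq hσ3, mul_div_cancel_left₀ _ three_ne_zero, hA, hA3]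
      simp
    have hB3 := thetaA_pow_three hσ3
    rw [hA3, hC3] at hB3
    exact ⟨hA3, by simpa using hB3.symm, hC3⟩
  have all : ∀ j : ℕ, 0 < (3 ^ j * τ).im ∧
      (thetaA (3 ^ j * τ) = 0 ∧ thetaB (3 ^ j * τ) = 0 ∧ thetaC (3 ^ j * τ) = 0) := by
    intro j
    induction j with
    | zero => simpa using ⟨hτ, h⟩
    | succ j ih =>
      rw [pow_succ', mul_assoc]
      exact ⟨im_three_mul_pos ih.1, step ih.1 ih.2⟩
  have lim := tendsto_thetaA hτ
  simp only [(all _).2.1] at lim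
  exact zero_ne_one (tendsto_nhds_unique tendsto_const_nhds lim)

/-- Values of the cubic theta functions at a CM point, along the orbit of `τ ↦ τ / 3`. -/
theorem exists_cubic_theta_cycle {T : ℤ} {n : ℕ} (hn : 1 ≤ n) {π : ℂ} (him : π.im < 0)
    (hadd : π + starRingEnd ℂ π = T) (hmul : π * starRingEnd ℂ π = 3 ^ n) (hT : 3 ∣ T - 1) :
    ∃ a b c : ℕ → ℂ, (∀ i, a (i + 1) = a i + 2 * c i) ∧ (∀ i, b (i + 1) = a i - c i) ∧
      (∀ i, a i ^ 3 = b i ^ 3 + c i ^ 3) ∧ a n = π * a 0 ∧ b n ^ 3 = π ^ 3 * b 0 ^ 3 ∧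
      c n ^ 3 = π ^ 3 * c 0 ^ 3 ∧ ¬(a 0 = 0 ∧ b 0 = 0 ∧ c 0 = 0) := by
  obtain ⟨k, hk⟩ := hT
  obtain ⟨m, rfl⟩ : ∃ m, n = m + 1 := ⟨n - 1, by omega⟩
  set s : ℂ := (1 - π) / 3 with hs_def
  have hs : 0 < s.im := im_div_three_pos (by simpa using him)
  have hπ0 : π ≠ 0 := by rintro rfl; simp at him
  set j : ℤ := k - 3 ^ m with hj
  have hs' : 0 < (s + j).im := by simpa using hs
  have hpos : ∀ i : ℕ, 0 < ((s + j) / 3 ^ i).im := by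
    intro i
    induction i with
    | zero => simpa using hs
    | succ i ih =>
      rw [pow_succ, ← div_div]
      exact im_div_three_pos ih
  have hlast : (s + j) / 3 ^ (m + 1) = s / (1 - 3 * s) := by
    have e1 : 1 - 3 * s = π := by rw [hs_def]; ring
    have hk' : (T : ℂ) = 1 + 3 * k := by exact_mod_cast (by linarith : T = 1 + 3 * k)
    rw [e1, div_eq_div_iff (pow_ne_zero _ three_ne_zero) hπ0, ← hmul, hj, hs_def]
    push_cast
    have h3 : (3 : ℂ) * 3 ^ m = π * starRingEnd ℂ π := by rw [hmul, pow_succ']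
    rw [hk'] at hadd
    have e2 : (1 - π) / 3 + ((k : ℂ) - 3 ^ m) = (1 - π) * starRingEnd ℂ π / 3 := by
      linear_combination (-1 / 3 : ℂ) * h3 - hadd / 3
    rw [e2]
    ring
  obtain ⟨hA, hB, hC⟩ := theta_unipotent hs
  have e1 : 1 - 3 * s = π := by rw [hs_def]; ring
  refine ⟨fun i => thetaA ((s + j) / 3 ^ i), fun i => thetaB ((s + j) / 3 ^ i),
    fun i => thetaC ((s + j) / 3 ^ i), fun i => ?_, fun i => ?_, fun i => thetaA_pow_three (hpos i),
    ?_, ?_, ?_, ?_⟩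
  · simp only
    rw [pow_succ, ← div_div, thetaA_div_three (hpos i)]
  · simp only
    rw [pow_succ, ← div_div, thetaB_div_three (hpos i)]
  · simp only
    rw [hlast, hA, pow_zero, div_one, thetaA_add_int, e1]
  · simp only
    rw [hlast, hB, pow_zero, div_one, thetaB_add_int, e1]
  · simp only
    rw [hlast, hC, pow_zero, div_one, thetaC_add_int_pow_three hs, e1]
  · simpa only [pow_zero, div_one] using not_theta_eq_zero hs'

end CubicTheta

section CycleValuation

variable {K Γ : Type*} [Field K] [LinearOrderedCommGroupWithZero Γ] (v : Valuation K Γ)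

theorem Valuation.map_two_of_map_three_lt_one (h3 : v 3 < 1) : v 2 = 1 := by
  have h := v.map_sub_eq_of_lt_right (x := 3) (y := 1) (by rwa [v.map_one])
  rw [v.map_one] at h
  rw [← h]
  norm_num

theorem valuation_le_max_of_pow_three_eq {x y z : K} (h : x ^ 3 = y ^ 3 + z ^ 3) :
    v y ≤ max (v x) (v z) := by
  have h1 : v y ^ 3 ≤ max (v x) (v z) ^ 3 := by
    rw [← map_pow, show y ^ 3 = x ^ 3 - z ^ 3 by rw [h]; ring]
    refine (v.map_sub _ _).trans (max_le ?_ ?_) <;> rw [map_pow] <;> gcongr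
    · exact le_max_left _ _
    · exact le_max_right _ _
  exact le_of_pow_le_pow_left₀ three_ne_zero zero_le h1

theorem pow_mul_le_of_succ {t : Γ} {M : ℕ → Γ} (h : ∀ i, t * M i ≤ M (i + 1)) (i k : ℕ) :
    t ^ k * M i ≤ M (i + k) := by
  induction k with
  | zero => simp
  | succ k ih =>
    rw [pow_succ', mul_assoc, ← add_assoc]
    exact (mul_le_mul_right ih t).trans (h _)

theorem eq_pow_mul_of_cycle {t : Γ} (ht : t ≠ 0) {M : ℕ → Γ} {n : ℕ}
    (h : ∀ i, t * M i ≤ M (i + 1)) (hn : M n = t ^ n * M 0) {i : ℕ} (hi : i ≤ n) :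
    M i = t ^ i * M 0 := by
  refine le_antisymm ?_ (by simpa using pow_mul_le_of_succ h 0 i)
  have h1 := pow_mul_le_of_succ h i (n - i)
  rw [Nat.add_sub_cancel' hi, hn] at h1
  nth_rewrite 2 [← Nat.sub_add_cancel hi] at h1
  rw [pow_add, mul_assoc] at h1
  exact le_of_mul_le_mul_left h1 (zero_lt_iff.2 (pow_ne_zero _ ht))

theorem pow_three_eq_iff_valuation {x y z : K} (h : x ^ 3 = z ^ 3 * y ^ 3) : v x = v z * v y := by
  have := congrArg v h
  rw [map_mul, map_pow, map_pow, map_pow, ← mul_pow] at this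
  exact (pow_left_inj₀ zero_le zero_le three_ne_zero).1 this

theorem eq_one_of_pow_three_cycle {x : ℕ → Γ} {n : ℕ} (hn : 1 ≤ n)
    (h : ∀ i < n, x (i + 1) = x i ^ 3) (hx : x n = x 0) (h0 : x 0 ≠ 0) : ∀ i ≤ n, x i = 1 := by
  have hpow : ∀ i ≤ n, x i = x 0 ^ 3 ^ i := by
    intro i hi
    induction i with
    | zero => simp
    | succ i ih => rw [h i hi, ih (by omega), ← pow_mul, pow_succ]
  have h1 : x 0 ^ (3 ^ n - 1) = 1 := by
    refine mul_right_cancel₀ h0 ?_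
    rw [one_mul, ← pow_succ, Nat.sub_add_cancel (Nat.one_le_pow _ _ (by norm_num)),
      ← hpow n le_rfl, hx]
  have h2 : x 0 = 1 :=
    (pow_eq_one_iff_of_nonneg zero_le (Nat.sub_ne_zero_of_lt
      (Nat.one_lt_pow (by omega) (by norm_num)))).1 h1
  intro i hi
  rw [hpow i hi, h2, one_pow]

theorem valuation_cycle (h3 : v 3 < 1) (h30 : (3 : K) ≠ 0) {n : ℕ} (hn : 1 ≤ n) {π : K}
    (hπ : v π = v 3 ^ n) (hπ3 : π ≠ 3 ^ n) {a b c : ℕ → K} (ha : ∀ i, a (i + 1) = a i + 2 * c i)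
    (hb : ∀ i, b (i + 1) = a i - c i) (habc : ∀ i, a i ^ 3 = b i ^ 3 + c i ^ 3)
    (han : a n = π * a 0) (hbn : b n ^ 3 = π ^ 3 * b 0 ^ 3) (hcn : c n ^ 3 = π ^ 3 * c 0 ^ 3)
    (h0 : ¬(a 0 = 0 ∧ b 0 = 0 ∧ c 0 = 0)) : ∀ i ≤ n, a i ≠ 0 ∧ v (b i) = v 3 * v (a i) := by
  have hv2 := Valuation.map_two_of_map_three_lt_one v h3
  have ht0 : v 3 ≠ 0 := by simpa using h30
  set M : ℕ → Γ := fun i => max (v (a i)) (v (c i)) with hM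
  set N : ℕ → Γ := fun i => max (v (a i)) (v (b i)) with hN
  have hbM : ∀ i, v (b i) ≤ M i := fun i => valuation_le_max_of_pow_three_eq v (habc i)
  have hNM : ∀ i, N i ≤ M i := fun i => max_le (le_max_left _ _) (hbM i)
  have hMN : ∀ i, v 3 * M i ≤ N (i + 1) := by
    intro i
    rw [hM]
    simp only
    rw [mul_max, ← map_mul, ← map_mul, show 3 * a i = a (i + 1) + 2 * b (i + 1) by
      rw [ha, hb]; ring, show 3 * c i = a (i + 1) - b (i + 1) by rw [ha, hb]; ring]
    refine max_le ((v.map_add _ _).trans ?_) (v.map_sub _ _)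
    rw [map_mul, hv2, one_mul]
  have hcn' := pow_three_eq_iff_valuation v hcn
  have hMn : M n = v 3 ^ n * M 0 := by
    simp only [hM]
    rw [han, map_mul, hcn', mul_max, hπ]
  have hMi : ∀ i ≤ n, M i = v 3 ^ i * M 0 := fun i hi =>
    eq_pow_mul_of_cycle ht0 (fun i => (hMN i).trans (hNM _)) hMn hi
  have hM0 : M 0 ≠ 0 := by
    intro h
    have h1 : v (a 0) = 0 := le_antisymm (h ▸ le_max_left _ _) zero_le
    have h2 : v (c 0) = 0 := le_antisymm (h ▸ le_max_right _ _) zero_le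
    rw [map_eq_zero] at h1 h2
    have h3 := habc 0
    rw [h1, h2] at h3
    exact h0 ⟨h1, by simpa using h3.symm, h2⟩
  have hMpos : ∀ i ≤ n, M i ≠ 0 := fun i hi => by
    rw [hMi i hi]
    exact mul_ne_zero (pow_ne_zero _ ht0) hM0
  have hstep : ∀ i < n, M (i + 1) = v 3 * M i := fun i hi => by
    rw [hMi _ hi, hMi _ hi.le, pow_succ', mul_assoc]
  have haM' : ∀ i < n, v (a i) = M i := by
    intro i hi
    refine le_antisymm (le_max_left _ _) (not_lt.1 fun h => ?_)
    have hc : v (c i) = M i := by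
      rcases max_choice (v (a i)) (v (c i)) with h' | h'
      · exact absurd h'.symm h.ne
      · exact h'.symm
    have h2 : v (a (i + 1)) = M i := by
      rw [ha, Valuation.map_add_eq_of_lt_right] <;> rw [map_mul, hv2, one_mul, hc]
      exact h
    have h3' : v (a (i + 1)) ≤ M (i + 1) := le_max_left _ _
    rw [h2, hstep i hi] at h3'
    exact absurd h3' (not_le.2 (mul_lt_of_lt_one_left (zero_lt_iff.2 (hMpos i hi.le)) h3))
  have haM : ∀ i ≤ n, v (a i) = M i := by
    intro i hi
    rcases hi.lt_or_eq with h | rfl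
    · exact haM' i h
    · rw [han, map_mul, hMn, hπ, haM' 0 (by omega)]
  have ha0 : ∀ i ≤ n, a i ≠ 0 := fun i hi h => hMpos i hi (by rw [← haM i hi, h, map_zero])
  set w : ℕ → K := fun i => b i / (3 * a i) with hw
  have hbw : ∀ i ≤ n, b i = 3 * a i * w i := fun i hi =>
    (mul_div_cancel₀ _ (mul_ne_zero h30 (ha0 i hi))).symm
  have hrel : ∀ i < n, (3 * w i) ^ 3 * (3 * a i / a (i + 1)) ^ 3 =
      9 * (3 * w (i + 1)) * (1 + 3 * w (i + 1) + (3 * w (i + 1)) ^ 2) := by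
    intro i hi
    have e1 : 3 * a i = a (i + 1) * (1 + 6 * w (i + 1)) := by
      linear_combination -ha i - 2 * hb i + 2 * hbw (i + 1) hi
    have e2 : 3 * c i = a (i + 1) * (1 - 3 * w (i + 1)) := by
      linear_combination -ha i + hb i - hbw (i + 1) hi
    have e3 := habc i
    rw [hbw i hi.le] at e3
    have hne := ha0 (i + 1) hi
    rw [← mul_pow, mul_div_assoc', div_pow, div_eq_iff (pow_ne_zero _ hne)]
    have e4 : (3 * w i * (3 * a i)) ^ 3 = (3 * a i) ^ 3 * 1 - (3 * c i) ^ 3 := by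
      linear_combination -27 * e3
    rw [e4, e1, e2]
    ring
  have hunit : ∀ i < n, v (3 * a i / a (i + 1)) = 1 := by
    intro i hi
    rw [map_div₀, map_mul, haM i hi.le, haM _ hi, hstep i hi]
    exact div_self (mul_ne_zero ht0 (hMpos i hi.le))
  have hle : ∀ i ≤ n, v (3 * w i) ≤ 1 := by
    intro i hi
    rw [show 3 * w i = b i / a i by simp only [hw]; field_simp, map_div₀, haM i hi]
    exact div_le_one_of_le₀ (hbM i) zero_le
  have hquad : ∀ x : K, v x ≤ 1 → v (1 + x + x ^ 2) ≤ 1 := fun x hx =>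
    v.map_add_le (v.map_add_le v.map_one.le hx) (by rw [map_pow]; exact pow_le_one₀ zero_le hx)
  have h9 : v 9 < 1 := by
    rw [show (9 : K) = 3 * 3 by norm_num, map_mul]
    exact mul_lt_one_of_nonneg_of_lt_one_left zero_le h3 h3.le
  have hlt' : ∀ i < n, v (3 * w i) < 1 := by
    intro i hi
    have h := congrArg v (hrel i hi)
    rw [map_mul, map_pow v (_ / _), hunit i hi, one_pow, mul_one, map_pow, map_mul v (9 * _),
      map_mul v 9] at h
    rw [← pow_lt_one_iff_of_nonneg zero_le three_ne_zero, h, mul_assoc]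
    exact mul_lt_one_of_nonneg_of_lt_one_left zero_le h9
      (mul_le_one' (hle _ hi) (hquad _ (hle _ hi)))
  have hw3 : w n ^ 3 = w 0 ^ 3 := by
    simp only [hw]
    have hπ0 : π ≠ 0 := by
      rintro rfl
      exact ha0 n le_rfl (by rw [han, zero_mul])
    rw [div_pow, div_pow, hbn, han]
    field_simp
  have hwn : v (w n) = v (w 0) := by
    have := pow_three_eq_iff_valuation v (x := w n) (z := 1) (y := w 0) (by rw [hw3]; ring)
    simpa using this
  have hlt : ∀ i ≤ n, v (3 * w i) < 1 := by
    intro i hi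
    rcases hi.lt_or_eq with h | rfl
    · exact hlt' i h
    · rw [map_mul, hwn, ← map_mul]
      exact hlt' 0 (by omega)
  have hcube : ∀ i < n, v (w (i + 1)) = v (w i) ^ 3 := by
    intro i hi
    have h := congrArg v (hrel i hi)
    have h1 : v (1 + 3 * w (i + 1) + (3 * w (i + 1)) ^ 2) = 1 := by
      rw [add_assoc]
      refine (v.map_add_eq_of_lt_left ?_).trans v.map_one
      rw [v.map_one]
      refine v.map_add_lt (hlt _ hi) ?_
      rw [map_pow]
      exact pow_lt_one₀ zero_le (hlt _ hi) two_ne_zero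
    rw [map_mul, map_pow v (_ / _), hunit i hi, one_pow, mul_one, map_pow, map_mul v (9 * _), h1,
      mul_one, ← mul_assoc, show (9 * 3 : K) = 3 ^ 3 by norm_num, map_mul, map_mul, mul_pow,
      ← map_pow] at h
    exact (mul_left_cancel₀ (by simpa using h30) h).symm
  have hw0 : v (w 0) ≠ 0 := by
    intro h
    have hz : ∀ i ≤ n, w i = 0 := by
      intro i hi
      induction i with
      | zero => simpa using h
      | succ i ih =>
        have := hcube i hi
        rw [ih (by omega)] at this
        simpa using this
    have hai : ∀ i ≤ n, a i = 3 ^ i * a 0 := by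
      intro i hi
      induction i with
      | zero => simp
      | succ i ih =>
        rw [pow_succ', mul_assoc, ← ih (by omega)]
        have := hbw (i + 1) hi
        rw [hz _ hi] at this
        linear_combination ha i + 2 * hb i - 2 * this
    exact hπ3 (mul_right_cancel₀ (ha0 0 (by omega)) (han ▸ hai n le_rfl))
  intro i hi
  refine ⟨ha0 i hi, ?_⟩
  have := eq_one_of_pow_three_cycle hn (x := fun i => v (w i)) hcube hwn hw0 i hi
  rw [hbw i hi, map_mul, this, mul_one, map_mul]

end CycleValuation

section CycleInteger

open Complex

theorem isIntegral_of_quadratic {z : ℂ} {s p : ℤ} (h : z ^ 2 - s * z + p = 0) : IsIntegral ℤ z := by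
  refine ⟨Polynomial.X ^ 2 - Polynomial.C s * Polynomial.X + Polynomial.C p, ?_, ?_⟩
  · monicity!
  · rw [Polynomial.eval₂_add, Polynomial.eval₂_sub, Polynomial.eval₂_mul, Polynomial.eval₂_X_pow,
      Polynomial.eval₂_X, Polynomial.eval₂_C, Polynomial.eval₂_C]
    exact h

theorem dvd_of_isIntegral_div {x y : ℤ} (hy : y ≠ 0) (h : IsIntegral ℤ ((x : ℂ) / y)) : y ∣ x := by
  have h1 : IsIntegral ℤ ((x : ℚ) / y) := by
    rw [← isIntegral_algebraMap_iff (algebraMap ℚ ℂ).injective]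
    simpa using h
  obtain ⟨z, hz⟩ := IsIntegrallyClosed.isIntegral_iff.1 h1
  refine ⟨z, ?_⟩
  have hy' : (y : ℚ) ≠ 0 := by exact_mod_cast hy
  rw [eq_div_iff hy'] at hz
  have : (x : ℚ) = y * z := by
    rw [← hz]
    simp [mul_comm]
  exact_mod_cast this

theorem exists_valuationSubring_of_conj {T : ℤ} {n : ℕ} (hn : 1 ≤ n) {π : ℂ}
    (hadd : π + starRingEnd ℂ π = T) (hmul : π * starRingEnd ℂ π = 3 ^ n) (hT : 3 ∣ T - 1) :
    ∃ O : ValuationSubring ℂ, O.valuation 3 < 1 ∧ O.valuation π = O.valuation 3 ^ n := by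
  have hπ0 : π ≠ 0 := by
    rintro rfl
    rw [zero_mul] at hmul
    exact pow_ne_zero n three_ne_zero hmul.symm
  have hint : IsIntegral ℤ π := by
    refine isIntegral_of_quadratic (s := T) (p := 3 ^ n) ?_
    push_cast
    linear_combination π * hadd - hmul
  have hint' : IsIntegral ℤ (starRingEnd ℂ π) := by
    have := hint.map (starRingEnd ℂ).toIntAlgHom
    simpa using this
  set A := (integralClosure ℤ ℂ).toSubring with hA
  set I : Ideal A := Ideal.span {⟨π, hint⟩} with hI
  have hItop : I ≠ ⊤ := by
    intro h
    rw [hI, Ideal.span_singleton_eq_top, isUnit_iff_exists_inv] at h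
    obtain ⟨⟨y, hy⟩, hxy⟩ := h
    have hxy' : π * y = 1 := congrArg Subtype.val hxy
    have hy1 : IsIntegral ℤ y := hy
    have hy2 : IsIntegral ℤ (starRingEnd ℂ y) := by
      have := hy1.map (starRingEnd ℂ).toIntAlgHom
      simpa using this
    have hsum := hy1.add hy2
    have e : y + starRingEnd ℂ y = ((T : ℤ) : ℂ) / ((3 ^ n : ℤ) : ℂ) := by
      have hy3 : y = π⁻¹ := eq_inv_of_mul_eq_one_right hxy'
      have hc : starRingEnd ℂ π ≠ 0 := by simpa using hπ0
      rw [hy3, map_inv₀]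
      push_cast
      rw [← hadd, ← hmul]
      field_simp
      ring
    rw [e] at hsum
    have h3 : (3 : ℤ) ∣ T :=
      (dvd_pow_self 3 (by omega : n ≠ 0)).trans (dvd_of_isIntegral_div (by positivity) hsum)
    omega
  obtain ⟨O, hAO, hsub⟩ := I.image_subset_nonunits_valuationSubring hItop
  have hπv : O.valuation π < 1 := by
    have : π ∈ O.nonunits := hsub ⟨⟨π, hint⟩, Ideal.mem_span_singleton_self _, rfl⟩
    exact this
  have hle : O.valuation (starRingEnd ℂ π) ≤ 1 := (O.valuation_le_one_iff _).2 (hAO hint')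
  have hprod := congrArg O.valuation hmul
  rw [map_mul, map_pow] at hprod
  have h3 : O.valuation 3 < 1 := by
    rw [← pow_lt_one_iff_of_nonneg zero_le (by omega : n ≠ 0), ← hprod]
    exact mul_lt_one_of_nonneg_of_lt_one_left zero_le hπv hle
  refine ⟨O, h3, ?_⟩
  have hc : O.valuation (starRingEnd ℂ π) = 1 := by
    obtain ⟨k, hk⟩ := hT
    have hk' : (T : ℂ) = 1 + 3 * k := by exact_mod_cast (by linarith : T = 1 + 3 * k)
    have e : starRingEnd ℂ π = 1 + (3 * k - π) := by linear_combination hadd + hk'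
    have hkO : O.valuation (k : ℂ) ≤ 1 := (O.valuation_le_one_iff _).2 (intCast_mem O k)
    rw [e, Valuation.map_add_eq_of_lt_left, map_one]
    rw [map_one]
    refine (O.valuation.map_sub _ _).trans_lt (max_lt ?_ hπv)
    rw [map_mul]
    exact mul_lt_one_of_nonneg_of_lt_one_left zero_le h3 hkO
  rw [← hprod, hc, mul_one]

/-- A cycle of `3`-isogenies with integral parameters, whose composite multiplies the invariant
differential by `π`. -/
theorem exists_integral_cycle {T : ℤ} {n : ℕ} (hn : 1 ≤ n) {π : ℂ} (him : π.im < 0)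
    (hadd : π + starRingEnd ℂ π = T) (hmul : π * starRingEnd ℂ π = 3 ^ n) (hT : 3 ∣ T - 1) :
    ∃ (O : ValuationSubring ℂ) (w μ : ℕ → O), (3 : O) ∈ IsLocalRing.maximalIdeal O ∧
      (∀ i ≤ n, IsUnit (w i)) ∧
      (∀ i < n, w i ^ 3 * (1 + 6 * w (i + 1)) ^ 3 =
        w (i + 1) * (1 + 3 * w (i + 1) + 9 * w (i + 1) ^ 2)) ∧
      (∀ i < n, μ i * (1 + 6 * w (i + 1)) = 3) ∧
      ((∏ i ∈ Finset.range n, μ i : O) : ℂ) = π ∧ w n ^ 3 = w 0 ^ 3 := by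
  obtain ⟨O, h3, hπ⟩ := exists_valuationSubring_of_conj hn hadd hmul hT
  obtain ⟨a, b, c, ha, hb, habc, han, hbn, hcn, h0⟩ := exists_cubic_theta_cycle hn him hadd hmul hT
  have hπ3 : π ≠ 3 ^ n := by
    rintro rfl
    have : ((3 : ℂ) ^ n).im = 0 := by
      have := Complex.ofReal_im ((3 : ℝ) ^ n)
      exact_mod_cast this
    exact him.ne this
  have h := valuation_cycle O.valuation h3 three_ne_zero hn hπ hπ3 ha hb habc han hbn hcn h0
  have ha0 : ∀ i ≤ n, a i ≠ 0 := fun i hi => (h i hi).1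
  have hv3 : O.valuation 3 ≠ 0 := by simp
  have hw : ∀ i ≤ n, O.valuation (b i / (3 * a i)) = 1 := by
    intro i hi
    have : O.valuation (a i) ≠ 0 := by simpa using ha0 i hi
    rw [map_div₀, map_mul, (h i hi).2]
    exact div_self (mul_ne_zero hv3 this)
  have hO : ∀ i ≤ n, b i / (3 * a i) ∈ O := fun i hi =>
    O.mem_of_valuation_le_one _ (hw i hi).le
  have hN : ∀ i < n, 1 + 6 * (b (i + 1) / (3 * a (i + 1))) = 3 * a i / a (i + 1) := by
    intro i hi
    have h1 := ha0 (i + 1) hi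
    field_simp
    linear_combination 3 * ha i + 6 * hb i
  have hNu : ∀ i < n, O.valuation (3 * a i / a (i + 1)) = 1 := by
    intro i hi
    rw [← hN i hi, Valuation.map_add_eq_of_lt_left, map_one]
    rw [map_mul, hw _ hi, mul_one, map_one, show (6 : ℂ) = 3 * 2 by norm_num, map_mul]
    exact mul_lt_one_of_nonneg_of_lt_one_left zero_le h3
      ((O.valuation_le_one_iff _).2 (ofNat_mem O 2))
  have hμ : ∀ i < n, a (i + 1) / a i ∈ O := by
    intro i hi
    refine O.mem_of_valuation_le_one _ ?_
    rw [show a (i + 1) / a i = 3 / (3 * a i / a (i + 1)) by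
      have := ha0 i hi.le; have := ha0 _ hi; field_simp, map_div₀, hNu i hi, div_one]
    exact h3.le
  obtain ⟨w, hw'⟩ : ∃ w : ℕ → O, ∀ i ≤ n, (w i : ℂ) = b i / (3 * a i) := by
    classical
    exact ⟨fun i => if hi : i ≤ n then ⟨_, hO i hi⟩ else 0, fun i hi => by simp [hi]⟩
  obtain ⟨μ, hμ'⟩ : ∃ μ : ℕ → O, ∀ i < n, (μ i : ℂ) = a (i + 1) / a i := by
    classical
    exact ⟨fun i => if hi : i < n then ⟨_, hμ i hi⟩ else 0, fun i hi => by simp [hi]⟩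
  have e3 : ((3 : O) : ℂ) = 3 := map_ofNat O.subtype 3
  have e6 : ((6 : O) : ℂ) = 6 := map_ofNat O.subtype 6
  have e9 : ((9 : O) : ℂ) = 9 := map_ofNat O.subtype 9
  refine ⟨O, w, μ, ?_, ?_, ?_, ?_, ?_, ?_⟩
  · exact (O.valuation_lt_one_iff 3).2 h3
  · intro i hi
    rw [ValuationSubring.valuation_eq_one_iff, hw' i hi]
    exact hw i hi
  · intro i hi
    apply Subtype.ext
    push_cast
    have h1 := ha0 i hi.le
    have h2 := ha0 (i + 1) hi
    rw [e3, e6, e9, hw' i hi.le, hw' (i + 1) hi, hN i hi]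
    field_simp
    rw [ha, hb]
    linear_combination -27 * habc i
  · intro i hi
    apply Subtype.ext
    push_cast
    have h1 := ha0 i hi.le
    have h2 := ha0 (i + 1) hi
    rw [e3, e6, hμ' i hi, hw' (i + 1) hi, hN i hi]
    field_simp
  · have hprod : ∀ m ≤ n, ((∏ i ∈ Finset.range m, μ i : O) : ℂ) = a m / a 0 := by
      intro m hm
      induction m with
      | zero => simp [ha0 0 (Nat.zero_le n)]
      | succ m ih =>
        have h1 := ha0 m (by omega)
        rw [Finset.prod_range_succ]
        push_cast
        push_cast at ih
        rw [ih (by omega), hμ' m hm]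
        field_simp
    rw [hprod n le_rfl, han]
    exact mul_div_cancel_right₀ _ (ha0 0 (Nat.zero_le n))
  · apply Subtype.ext
    push_cast
    rw [hw' n le_rfl, hw' 0 (Nat.zero_le n)]
    have hπ0 : π ≠ 0 := by
      rintro rfl
      exact ha0 n le_rfl (by rw [han, zero_mul])
    rw [div_pow, div_pow, hbn, han]
    field_simp

end CycleInteger

section Isogeny

open Polynomial

variable {R : Type*} [CommRing R]

/-- The cubic `4x³ + (x + v)²`, whose reduction modulo `3` defines the Kloosterman curve. -/
noncomputable def kloostermanCubic (v : R) : R[X] := 4 * X ^ 3 + (X + C v) ^ 2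

/-- Numerator of the `x`-coordinate of the `3`-isogeny with parameter `w`, applied to `P / L²`. -/
noncomputable def isogenyNum (w : R) (P L : R[X]) : R[X] :=
  C ((1 + 6 * w) ^ 6) * P ^ 3 + C ((1 + 6 * w) ^ 4 * (3 * w + 9 * w ^ 2)) * (P ^ 2 * L ^ 2) +
    C (3 * w ^ 2 * (1 + 3 * w + 9 * w ^ 2) * (1 + 6 * w) ^ 2) * (P * L ^ 4)

/-- Square root of the denominator of the `x`-coordinate of the `3`-isogeny with parameter `w`. -/
noncomputable def isogenyDen (w : R) (P L : R[X]) : R[X] :=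
  C (3 * (1 + 6 * w) ^ 2) * (P * L) + C (1 + 3 * w + 9 * w ^ 2) * L ^ 3

/-- Numerator of the factor by which the `3`-isogeny with parameter `w` scales `y`. -/
noncomputable def isogenyScale (w : R) (P L : R[X]) : R[X] :=
  C ((1 + 6 * w) ^ 3) * (C ((1 + 6 * w) ^ 6) * P ^ 3 +
    C ((1 + 6 * w) ^ 4 * (1 + 3 * w + 9 * w ^ 2)) * (P ^ 2 * L ^ 2) +
    C ((1 + 6 * w) ^ 2 * (1 + 3 * w + 9 * w ^ 2) * (2 * w + 3 * w ^ 2)) * (P * L ^ 4) +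
    C (w ^ 2 * (1 + 3 * w + 9 * w ^ 2) ^ 2) * L ^ 6)

theorem isogeny_curve {v w : R}
    (h : v * (1 + 6 * w) ^ 3 = w * (1 + 3 * w + 9 * w ^ 2)) (P L : R[X]) :
    4 * isogenyNum w P L ^ 3 + (isogenyNum w P L + C (w ^ 3) * isogenyDen w P L ^ 2) ^ 2 *
      isogenyDen w P L ^ 2 =
      (4 * P ^ 3 + (P + C v * L ^ 2) ^ 2 * L ^ 2) * isogenyScale w P L ^ 2 := by
  have h' := congrArg (C (R := R)) h
  simp only [isogenyNum, isogenyDen, isogenyScale, map_mul, map_add, map_pow, map_one,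
    map_ofNat] at h' ⊢
  generalize (C v : R[X]) = c at h' ⊢
  generalize (C w : R[X]) = u at h' ⊢
  linear_combination (-((1 + 6 * u) ^ 6 * P ^ 3 +
    (1 + 6 * u) ^ 4 * (1 + 3 * u + 9 * u ^ 2) * (P ^ 2 * L ^ 2) +
    (1 + 6 * u) ^ 2 * (1 + 3 * u + 9 * u ^ 2) * (2 * u + 3 * u ^ 2) * (P * L ^ 4) +
    u ^ 2 * (1 + 3 * u + 9 * u ^ 2) ^ 2 * L ^ 6) ^ 2 * L ^ 4 *
    (2 * (1 + 6 * u) ^ 3 * P + (u * (1 + 3 * u + 9 * u ^ 2) + c * (1 + 6 * u) ^ 3) * L ^ 2)) * h'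

theorem isogeny_differential {μ w : R} (h : μ * (1 + 6 * w) = 3) (P L : R[X]) :
    derivative (isogenyNum w P L) * isogenyDen w P L -
      2 * isogenyNum w P L * derivative (isogenyDen w P L) =
      C μ * isogenyScale w P L * (derivative P * L - 2 * P * derivative L) := by
  have h' := congrArg (C (R := R)) h
  simp only [map_mul, map_add, map_one, map_ofNat] at h'
  simp only [isogenyNum, isogenyDen, isogenyScale, derivative_mul,
    derivative_pow, map_mul, map_add, map_pow, map_one, map_ofNat, derivative_C, derivative_one,
    derivative_ofNat, Nat.cast_ofNat]
  generalize (C w : R[X]) = u at h' ⊢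
  generalize (C μ : R[X]) = m at h' ⊢
  push_cast
  linear_combination (-((1 + 6 * u) ^ 2 * ((1 + 6 * u) ^ 6 * P ^ 3 +
    (1 + 6 * u) ^ 4 * (1 + 3 * u + 9 * u ^ 2) * (P ^ 2 * L ^ 2) +
    (1 + 6 * u) ^ 2 * (1 + 3 * u + 9 * u ^ 2) * (2 * u + 3 * u ^ 2) * (P * L ^ 4) +
    u ^ 2 * (1 + 3 * u + 9 * u ^ 2) ^ 2 * L ^ 6)) *
    (derivative P * L - 2 * P * derivative L)) * h'

theorem natDegree_isogenyNum_le {P L : R[X]} {m e : ℕ} (w : R) (hme : 2 * e + 1 = m)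
    (hP : P.natDegree ≤ m) (hL : L.natDegree ≤ e) : (isogenyNum w P L).natDegree ≤ 3 * m := by
  unfold isogenyNum
  refine natDegree_add_le_of_degree_le (natDegree_add_le_of_degree_le ?_ ?_) ?_ <;>
    refine (natDegree_C_mul_le _ _).trans ?_
  · exact natDegree_pow_le_of_le 3 hP
  · exact (natDegree_mul_le_of_le (natDegree_pow_le_of_le 2 hP)
      (natDegree_pow_le_of_le 2 hL)).trans (by omega)
  · exact (natDegree_mul_le_of_le hP (natDegree_pow_le_of_le 4 hL)).trans (by omega)

theorem coeff_isogenyNum {P L : R[X]} {m e : ℕ} (w : R) (hme : 2 * e + 1 = m)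
    (hP : P.natDegree ≤ m) (hL : L.natDegree ≤ e) :
    (isogenyNum w P L).coeff (3 * m) = (1 + 6 * w) ^ 6 * P.coeff m ^ 3 := by
  unfold isogenyNum
  rw [coeff_add, coeff_add, coeff_C_mul, coeff_C_mul, coeff_C_mul, coeff_pow_of_natDegree_le hP,
    coeff_eq_zero_of_natDegree_lt (p := P ^ 2 * L ^ 2),
    coeff_eq_zero_of_natDegree_lt (p := P * L ^ 4), mul_zero, mul_zero, add_zero, add_zero]
  · exact (natDegree_mul_le_of_le hP (natDegree_pow_le_of_le 4 hL)).trans_lt (by omega)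
  · exact (natDegree_mul_le_of_le (natDegree_pow_le_of_le 2 hP)
      (natDegree_pow_le_of_le 2 hL)).trans_lt (by omega)

theorem natDegree_isogenyDen_le {P L : R[X]} {m e : ℕ} (w : R) (hme : 2 * e + 1 = m)
    (hP : P.natDegree ≤ m) (hL : L.natDegree ≤ e) : (isogenyDen w P L).natDegree ≤ m + e := by
  unfold isogenyDen
  refine natDegree_add_le_of_degree_le ?_ ?_ <;>
    refine (natDegree_C_mul_le _ _).trans ?_
  · exact natDegree_mul_le_of_le hP hL
  · exact (natDegree_pow_le_of_le 3 hL).trans (by omega)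

theorem coeff_isogenyDen {P L : R[X]} {m e : ℕ} (w : R) (hme : 2 * e + 1 = m)
    (hP : P.natDegree ≤ m) (hL : L.natDegree ≤ e) :
    (isogenyDen w P L).coeff (m + e) = 3 * (1 + 6 * w) ^ 2 * (P.coeff m * L.coeff e) := by
  unfold isogenyDen
  rw [coeff_add, coeff_C_mul, coeff_C_mul, coeff_mul_add_eq_of_natDegree_le hP hL,
    coeff_eq_zero_of_natDegree_lt (p := L ^ 3), mul_zero, add_zero]
  exact (natDegree_pow_le_of_le 3 hL).trans_lt (by omega)

/-- Composing the first `i` of a chain of `3`-isogenies lifting the Frobenius map. -/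
theorem exists_isogeny_chain {k : Type*} [Field k] [CharP k 3] (red : R →+* k) {n : ℕ}
    {w μ : ℕ → R}
    (hrel : ∀ i < n, w i ^ 3 * (1 + 6 * w (i + 1)) ^ 3 =
        w (i + 1) * (1 + 3 * w (i + 1) + 9 * w (i + 1) ^ 2))
    (hμ : ∀ i < n, μ i * (1 + 6 * w (i + 1)) = 3) {i : ℕ} (hi : i ≤ n) :
    red (w i) = red (w 0) ^ 3 ^ i ∧ ∃ (P L H : R[X]) (e : ℕ), 2 * e + 1 = 3 ^ i ∧
      P.map red = X ^ 3 ^ i ∧ L.map red = 1 ∧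
      H.map red = ((kloostermanCubic (w 0 ^ 3)).map red) ^ e ∧
      P.natDegree ≤ 3 ^ i ∧ L.natDegree ≤ e ∧
      P.coeff (3 ^ i) * (∏ j ∈ Finset.range i, μ j) ^ 2 = L.coeff e ^ 2 ∧
      4 * P ^ 3 + (P + C (w i ^ 3) * L ^ 2) ^ 2 * L ^ 2 = kloostermanCubic (w 0 ^ 3) * H ^ 2 ∧
      derivative P * L - 2 * P * derivative L = C (∏ j ∈ Finset.range i, μ j) * H := by
  have h3 : (3 : k) = 0 := CharP.ofNat_eq_zero k 3
  induction i with
  | zero =>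
    refine ⟨by simp, X, 1, 1, 0, by simp, by simp, by simp, by simp, by simp [natDegree_X_le],
      by simp, by simp, ?_, by simp⟩
    simp [kloostermanCubic]
  | succ i ih =>
    obtain ⟨hw, P, L, H, e, he, hPr, hLr, hHr, hP, hL, hlead, hcurve, hdiff⟩ := ih (by omega)
    have hwr : red (w (i + 1)) = red (w 0) ^ 3 ^ (i + 1) := by
      have := congrArg red (hrel i hi)
      simp only [map_mul, map_add, map_pow, map_one, map_ofNat] at this
      rw [pow_succ, pow_mul, ← hw]
      linear_combination -this + (2 * red (w i) ^ 3 * red (w (i + 1)) *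
        (3 + 18 * red (w (i + 1)) + 36 * red (w (i + 1)) ^ 2) - red (w (i + 1)) ^ 2 -
        3 * red (w (i + 1)) ^ 3) * h3
    have h3' : (3 : k[X]) = 0 := CharP.ofNat_eq_zero k[X] 3
    have h6' : (6 : k[X]) = 0 := by linear_combination 2 * h3'
    have h9' : (9 : k[X]) = 0 := by linear_combination 3 * h3'
    have h4' : (4 : k[X]) = 1 := by linear_combination h3'
    have hpow : 3 ^ (i + 1) = 3 * 3 ^ i := pow_succ' 3 i
    refine ⟨hwr, isogenyNum (w (i + 1)) P L, isogenyDen (w (i + 1)) P L,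
      H * isogenyScale (w (i + 1)) P L, 3 ^ i + e, by omega, ?_, ?_, ?_, ?_, ?_, ?_, ?_, ?_⟩
    · simp only [isogenyNum, Polynomial.map_add, Polynomial.map_mul, Polynomial.map_pow, map_C, hPr,
        hLr, map_mul, map_add, map_pow, map_one, map_ofNat,
        Polynomial.map_one, Polynomial.map_ofNat, h3', h6', h9']
      rw [hpow]; ring
    · simp only [isogenyDen, Polynomial.map_add, Polynomial.map_mul, Polynomial.map_pow, map_C, hPr,
        hLr, map_mul, map_add, map_pow, map_one, map_ofNat,
        Polynomial.map_one, Polynomial.map_ofNat, h3', h6', h9']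
      ring
    · simp only [isogenyScale, kloostermanCubic, Polynomial.map_add, Polynomial.map_mul,
        Polynomial.map_pow, map_C, map_X, hPr, hHr, hLr, map_mul, map_add, map_pow, map_one,
        map_ofNat, Polynomial.map_one, Polynomial.map_ofNat, h3', h6', h9', hwr, h4']
      have hfrob : (X ^ 3 + (X + C (red (w 0)) ^ 3) ^ 2) ^ 3 ^ i =
          (X ^ 3 ^ i) ^ 3 + (X ^ 3 ^ i + C (red (w 0)) ^ 3 ^ (i + 1)) ^ 2 := by
        have : ExpChar k[X] 3 := .prime Nat.prime_three
        rw [add_pow_expChar_pow, pow_right_comm _ 2, add_pow_expChar_pow, pow_right_comm X,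
          ← pow_mul (C _), hpow]
      rw [one_mul, pow_add _ (3 ^ i), hfrob]
      ring
    · rw [hpow]; exact natDegree_isogenyNum_le _ he hP hL
    · exact natDegree_isogenyDen_le _ he hP hL
    · rw [hpow, coeff_isogenyNum _ he hP hL, coeff_isogenyDen _ he hP hL,
        Finset.prod_range_succ]
      linear_combination 9 * (1 + 6 * w (i + 1)) ^ 4 * P.coeff (3 ^ i) ^ 2 * hlead +
        (1 + 6 * w (i + 1)) ^ 4 * P.coeff (3 ^ i) ^ 3 * (∏ j ∈ Finset.range i, μ j) ^ 2 *
        (μ i * (1 + 6 * w (i + 1)) + 3) * hμ i hi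
    · rw [isogeny_curve (hrel i hi), hcurve]; ring
    · rw [isogeny_differential (hμ i hi), hdiff, Finset.prod_range_succ, C_mul]; ring

end Isogeny

section FixedPoints

open Polynomial

theorem splits_of_isIntegrallyClosed {R : Type*} [CommRing R] [IsDomain R] [IsIntegrallyClosed R]
    (K : Type*) [Field K] [IsAlgClosed K] [Algebra R K] [IsFractionRing R K] {f : R[X]}
    (hf : f.Monic) : f.Splits := by
  have hinj := IsFractionRing.injective R K
  have hroot : ∀ x ∈ (f.map (algebraMap R K)).roots, ∃ y, algebraMap R K y = x := by
    intro x hx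
    refine IsIntegrallyClosed.algebraMap_eq_of_integral ⟨f, hf, ?_⟩
    rw [eval₂_eq_eval_map]
    exact (mem_roots'.1 hx).2
  choose! y hy using hroot
  rw [splits_iff_exists_multiset]
  refine ⟨(f.map (algebraMap R K)).roots.map y, map_injective _ hinj ?_⟩
  have hsplit := (IsAlgClosed.splits (f.map (algebraMap R K))).eq_prod_roots
  rw [(hf.map _).leadingCoeff, C_1, one_mul] at hsplit
  rw [hf.leadingCoeff, C_1, one_mul, Polynomial.map_multiset_prod, Multiset.map_map,
    Multiset.map_map]
  conv_lhs => rw [hsplit]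
  congr 1
  refine Multiset.map_congr rfl fun x hx => ?_
  simp [hy x hx]

/-- A polynomial over a local ring which lifts `X - X ^ q` has its roots indexed by the field with
`q` elements. -/
theorem exists_roots_lifting_finiteField {R : Type*} [CommRing R] [IsDomain R] [IsLocalRing R]
    [IsIntegrallyClosed R] (K : Type*) [Field K] [IsAlgClosed K] [Algebra R K] [IsFractionRing R K]
    (p : ℕ) [Fact p.Prime] [CharP (IsLocalRing.ResidueField R) p]
    (F : Type*) [Field F] [Fintype F] [CharP F p] {D : R[X]}
    (hdeg : D.natDegree ≤ Fintype.card F)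
    (hD : D.map (IsLocalRing.residue R) = X - X ^ Fintype.card F) :
    ∃ (ι : F →+* IsLocalRing.ResidueField R) (r : F → R),
      (∀ a, IsLocalRing.residue R (r a) = ι a) ∧
      D = C (D.coeff (Fintype.card F)) * ∏ a, (X - C (r a)) := by
  set q := Fintype.card F with hq
  have hq1 : 1 < q := Fintype.one_lt_card
  have hcoeff : IsLocalRing.residue R (D.coeff q) = -1 := by
    rw [← coeff_map, hD, coeff_sub, coeff_X_pow_self, coeff_X_of_ne_one hq1.ne', zero_sub]
  have hunit : IsUnit (D.coeff q) := by
    rw [← IsLocalRing.residue_ne_zero_iff_isUnit, hcoeff]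
    exact neg_ne_zero.2 one_ne_zero
  obtain ⟨u, hu⟩ := hunit
  have hmonic : (C (↑u⁻¹ : R) * D).Monic := by
    refine monic_of_natDegree_le_of_coeff_eq_one q ((natDegree_C_mul_le _ _).trans hdeg) ?_
    rw [coeff_C_mul, ← hu, Units.inv_mul]
  obtain ⟨s, hs⟩ := splits_iff_exists_multiset.1 (splits_of_isIntegrallyClosed K hmonic)
  rw [hmonic.leadingCoeff, C_1, one_mul] at hs
  have hDs : D = C (D.coeff q) * (s.map fun x => X - C x).prod := by
    rw [← hs, ← mul_assoc, ← C_mul, ← hu, Units.mul_inv, C_1, one_mul]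
  set k := IsLocalRing.ResidueField R
  have hk : (X ^ q - X : k[X]) = ((s.map (IsLocalRing.residue R)).map fun x => X - C x).prod := by
    have := congrArg (map (IsLocalRing.residue R)) hDs
    rw [hD, Polynomial.map_mul, map_C, hcoeff, Polynomial.map_multiset_prod, Multiset.map_map]
      at this
    rw [Multiset.map_map]
    simp only [Function.comp_def, Polynomial.map_sub, map_X, map_C, C_neg, C_1] at this ⊢
    linear_combination -this
  let _ : Algebra (ZMod p) F := ZMod.algebra F p
  let _ : Algebra (ZMod p) k := ZMod.algebra k p
  let ι : F →+* k := (IsSplittingField.lift F (X ^ q - X : (ZMod p)[X]) (by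
    rw [Polynomial.map_sub, Polynomial.map_pow, map_X, hk]
    exact splits_iff_exists_multiset.2 ⟨_, by
      rw [(monic_multiset_prod_of_monic _ _ fun x _ => monic_X_sub_C x).leadingCoeff, C_1,
        one_mul]⟩) : F →ₐ[ZMod p] k)
  have hroots : s.map (IsLocalRing.residue R) = Finset.univ.val.map ι := by
    rw [← roots_multiset_prod_X_sub_C (s.map (IsLocalRing.residue R)), ← hk,
      ← FiniteField.roots_X_pow_card_sub_X F, ← Splits.roots_map, Polynomial.map_sub,
      Polynomial.map_pow, map_X]
    rw [splits_iff_card_roots, FiniteField.roots_X_pow_card_sub_X,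
      FiniteField.X_pow_card_sub_X_natDegree_eq F hq1]
    rfl
  have hlift : ∀ a, ∃ x ∈ s, IsLocalRing.residue R x = ι a := fun a => by
    have : ι a ∈ s.map (IsLocalRing.residue R) := by
      rw [hroots]; exact Multiset.mem_map_of_mem _ (Finset.mem_univ a)
    exact Multiset.mem_map.1 this
  choose r hrs hr using hlift
  refine ⟨ι, r, hr, ?_⟩
  have hrinj : Function.Injective r := fun a b hab => ι.injective (by rw [← hr, ← hr, hab])
  have hrs' : Finset.univ.val.map r = s := by
    refine Multiset.eq_of_le_of_card_le ((Multiset.le_iff_subset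
      (Finset.univ.nodup.map hrinj)).2 fun x hx => ?_) ?_
    · obtain ⟨a, -, rfl⟩ := Multiset.mem_map.1 hx
      exact hrs a
    · rw [← Multiset.card_map (IsLocalRing.residue R), hroots, Multiset.card_map,
        Multiset.card_map]
  conv_lhs => rw [hDs, ← hrs', Multiset.map_map]
  rfl

theorem sum_eval_div_derivative_eval {K ι : Type*} [Field K] [Fintype ι] {r : ι → K}
    (hr : Function.Injective r) {u : K} (f : K[X]) (hf : f.natDegree < Fintype.card ι) :
    ∑ i, f.eval (r i) / (derivative (C u * ∏ j, (X - C (r j)))).eval (r i) =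
      f.coeff (Fintype.card ι - 1) / u := by
  classical
  have hdeg : f.degree < (Finset.univ : Finset ι).card :=
    degree_le_natDegree.trans_lt (by exact_mod_cast hf)
  rw [← Finset.card_univ, Lagrange.coeff_eq_sum hr.injOn hdeg, Finset.sum_div]
  refine Finset.sum_congr rfl fun i hi => ?_
  have := Lagrange.eval_nodal_derivative_eval_node_eq (v := r) hi
  rw [Lagrange.nodal, Lagrange.eval_nodal] at this
  rw [derivative_C_mul, eval_C_mul, this, div_div, mul_comm u]

/-- The logarithmic derivative at a fixed point of the composed isogeny. -/
theorem eval_derivative_fixedPoint {R : Type*} [CommRing R] [IsDomain R] [IsLocalRing R]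
    {P L H : R[X]} {v ϖ x : R} {χ : ℤ} (h2 : IsLocalRing.residue R 2 ≠ 0)
    (hcurve : 4 * P ^ 3 + (P + C v * L ^ 2) ^ 2 * L ^ 2 = kloostermanCubic v * H ^ 2)
    (hdiff : derivative P * L - 2 * P * derivative L = C ϖ * H)
    (hx : x * L.eval x ^ 2 = P.eval x) (hL : IsLocalRing.residue R (L.eval x) = 1)
    (hH : IsLocalRing.residue R (H.eval x) = χ)
    (hχ : χ ^ 2 = 1 ∨ χ = 0)
    (hg : χ ^ 2 = 1 → IsLocalRing.residue R ((kloostermanCubic v).eval x) ≠ 0)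
    (hg' : χ = 0 → (derivative (kloostermanCubic v)).eval x ≠ 0) :
    ∃ z : ℕ, L.eval x ^ 2 * (1 - ϖ ^ 2) =
      (derivative (X * L ^ 2 - P)).eval x * (1 + ϖ * χ - ϖ ^ 2 * z) := by
  have hL0 : L.eval x ≠ 0 := by rintro h; simp [h] at hL
  have hD : L.eval x * (derivative (X * L ^ 2 - P)).eval x = L.eval x ^ 3 - ϖ * H.eval x := by
    have := congrArg (eval x) hdiff
    simp only [derivative_mul, derivative_pow, derivative_sub, derivative_X, eval_sub, eval_mul,
      eval_add, eval_pow, eval_X, eval_C, eval_ofNat, eval_one, Nat.cast_ofNat, map_ofNat]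
      at this ⊢
    linear_combination -this + 2 * (derivative L).eval x * hx
  have hgeval : ∀ y, (kloostermanCubic v).eval y = 4 * y ^ 3 + (y + v) ^ 2 := by
    simp [kloostermanCubic]
  have hgd : (derivative (kloostermanCubic v)).eval x = 12 * x ^ 2 + 2 * (x + v) := by
    simp only [kloostermanCubic, derivative_add, derivative_mul, derivative_pow, derivative_X,
      derivative_C, derivative_ofNat, eval_add, eval_mul, eval_pow, eval_X, eval_C, eval_ofNat,
      eval_one, eval_zero, Nat.cast_ofNat, map_ofNat]
    ring
  have hc : L.eval x ^ 6 * (kloostermanCubic v).eval x =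
      (kloostermanCubic v).eval x * H.eval x ^ 2 := by
    have := congrArg (eval x) hcurve
    simp only [eval_add, eval_mul, eval_pow, eval_C, eval_ofNat, ← hx] at this
    rw [← this, hgeval]
    ring
  rcases hχ with hχ | hχ
  · replace hg := hg hχ
    have hH2 : H.eval x ^ 2 = L.eval x ^ 6 := by
      refine mul_left_cancel₀ (a := (kloostermanCubic v).eval x) ?_ (by linear_combination -hc)
      rintro h; simp [h] at hg
    have hχR : (χ : R) ^ 2 = 1 := by exact_mod_cast congrArg (Int.cast (R := R)) hχ
    have hHL : H.eval x = χ * L.eval x ^ 3 := by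
      have : (H.eval x - χ * L.eval x ^ 3) * (H.eval x + χ * L.eval x ^ 3) = 0 := by
        linear_combination hH2 - L.eval x ^ 6 * hχR
      refine sub_eq_zero.1 ((mul_eq_zero.1 this).resolve_right fun h => ?_)
      have := congrArg (IsLocalRing.residue R) h
      rw [map_add, map_mul, map_pow, hL, hH, map_intCast, map_zero] at this
      have hχk : (χ : IsLocalRing.ResidueField R) ^ 2 = 1 := by
        exact_mod_cast congrArg (Int.cast (R := IsLocalRing.ResidueField R)) hχ
      rw [map_ofNat] at h2
      refine h2 ?_
      linear_combination χ * this - 2 * hχk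
    refine ⟨0, mul_left_cancel₀ hL0 ?_⟩
    rw [← mul_assoc, ← mul_assoc, hD, hHL]
    push_cast
    linear_combination L.eval x ^ 3 * ϖ ^ 2 * hχR
  · have hHr : IsLocalRing.residue R (H.eval x) = 0 := by rw [hH, hχ, Int.cast_zero]
    have hg0 : (kloostermanCubic v).eval x = 0 := by
      have : (kloostermanCubic v).eval x * (L.eval x ^ 6 - H.eval x ^ 2) = 0 := by
        linear_combination hc
      refine (mul_eq_zero.1 this).resolve_right fun h => ?_
      simpa [hL, hHr] using congrArg (IsLocalRing.residue R) h
    have hHH : H.eval x * (H.eval x - ϖ * L.eval x ^ 3) = 0 := by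
      have h := congrArg (fun p => eval x (derivative p)) hcurve
      have h' := congrArg (eval x) hdiff
      rw [derivative_mul] at h
      simp only [derivative_mul, derivative_pow, derivative_add, derivative_C, eval_sub, eval_mul,
        eval_add, eval_pow, eval_C, eval_ofNat, eval_zero, Nat.cast_ofNat, map_ofNat,
        derivative_ofNat, ← hx, hgd, hg0] at h h'
      rw [hgeval] at hg0
      have : L.eval x * (12 * x ^ 2 + 2 * (x + v)) *
          (H.eval x * (H.eval x - ϖ * L.eval x ^ 3)) = 0 := by
        linear_combination -L.eval x * h + L.eval x ^ 4 * (12 * x ^ 2 + 2 * (x + v)) * h' +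
          6 * L.eval x ^ 6 * (derivative L).eval x * hg0
      refine (mul_eq_zero.1 this).resolve_left (mul_ne_zero hL0 ?_)
      rw [← hgd]
      exact hg' hχ
    subst hχ
    rcases mul_eq_zero.1 hHH with h | h
    · refine ⟨1, mul_left_cancel₀ hL0 ?_⟩
      rw [← mul_assoc, ← mul_assoc, hD, h]
      push_cast
      ring
    · refine ⟨0, mul_left_cancel₀ hL0 ?_⟩
      rw [← mul_assoc, ← mul_assoc, hD, sub_eq_zero.1 h]
      push_cast
      ring

theorem exists_cubicCharSum_eq_neg (F : Type*) [Field F] [Fintype F] [DecidableEq F] [CharP F 3]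
    {n : ℕ} (hn : 1 ≤ n) (hF : Fintype.card F = 3 ^ n) {T : ℤ} {π : ℂ} (him : π.im < 0)
    (hadd : π + starRingEnd ℂ π = T) (hmul : π * starRingEnd ℂ π = 3 ^ n) (hT : 3 ∣ T - 1) :
    ∃ v : F, v ≠ 0 ∧ cubicCharSum F v = -T := by
  obtain ⟨O, w, μ, h3, hw, hrel, hμ, hprod, hcyc⟩ := exists_integral_cycle hn him hadd hmul hT
  have hred3 : IsLocalRing.residue O 3 = 0 := (IsLocalRing.residue_eq_zero_iff _).2 h3
  have hchar : CharP (IsLocalRing.ResidueField O) 3 := ringChar.of_eq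
    (CharP.ringChar_of_prime_eq_zero Nat.prime_three (by
      rw [← map_natCast (IsLocalRing.residue O)]; exact_mod_cast hred3))
  have hk3 : (3 : IsLocalRing.ResidueField O) = 0 := CharP.ofNat_eq_zero _ 3
  have : Fact (Nat.Prime 3) := ⟨Nat.prime_three⟩
  obtain ⟨hwr, P, L, H, e, he, hPr, hLr, hHr, hP, hL, hlead, hcurve, hdiff⟩ :=
    exists_isogeny_chain (IsLocalRing.residue O) hrel hμ le_rfl
  rw [hcyc] at hcurve
  set ϖ : O := ∏ j ∈ Finset.range n, μ j with hϖ
  have hq : 1 < 3 ^ n := Nat.one_lt_pow (by omega) (by norm_num)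
  have hdeg : (X * L ^ 2 - P).natDegree ≤ Fintype.card F := by
    rw [hF]
    refine (natDegree_sub_le _ _).trans (max_le ?_ hP)
    exact (natDegree_mul_le_of_le natDegree_X_le (natDegree_pow_le_of_le 2 hL)).trans (by omega)
  have hDr : (X * L ^ 2 - P).map (IsLocalRing.residue O) = X - X ^ Fintype.card F := by
    simp [hLr, hPr, hF]
  obtain ⟨ι, r, hr, hD⟩ := exists_roots_lifting_finiteField ℂ 3 F hdeg hDr
  have hL2 : (L ^ 2).coeff (3 ^ n - 1) = L.coeff e ^ 2 := by
    rw [← coeff_pow_of_natDegree_le hL, show 3 ^ n - 1 = 2 * e by omega]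
  have hu : (X * L ^ 2 - P).coeff (Fintype.card F) = P.coeff (3 ^ n) * (ϖ ^ 2 - 1) := by
    rw [hF, coeff_sub, ← Nat.sub_add_cancel hq.le, coeff_X_mul, Nat.sub_add_cancel hq.le, hL2,
      ← hlead]
    ring
  have hp : P.coeff (3 ^ n) ≠ 0 := by
    intro h
    simpa [h] using congrArg (fun p => p.coeff (3 ^ n)) hPr
  have hu0 : IsLocalRing.residue O ((X * L ^ 2 - P).coeff (Fintype.card F)) ≠ 0 := by
    rw [← coeff_map, hDr, coeff_sub, coeff_X_pow_self, coeff_X_of_ne_one (by omega)]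
    simp
  rw [hu] at hD hu0
  have hroot : ∀ a, r a * (L.eval (r a)) ^ 2 = P.eval (r a) := by
    intro a
    have := congrArg (eval (r a)) hD
    rw [eval_mul, eval_prod, Finset.prod_eq_zero (Finset.mem_univ a) (by simp), mul_zero] at this
    simpa [sub_eq_zero] using this
  obtain ⟨v, hv⟩ : ∃ v, ι v = IsLocalRing.residue O (w 0 ^ 3) := by
    have := congrArg (fun p => (p.map (IsLocalRing.residue O)).eval
      (IsLocalRing.residue O (w 0 ^ 3))) hD
    simp only [hDr, Polynomial.map_mul, map_C, Polynomial.map_prod, Polynomial.map_sub, map_X,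
      eval_sub, eval_X, eval_pow, eval_mul, eval_C, eval_prod, hr] at this
    rw [hF, map_pow, pow_right_comm, ← hwr, ← map_pow, ← map_pow, hcyc, sub_self, eq_comm,
      mul_eq_zero, or_iff_right hu0, Finset.prod_eq_zero_iff] at this
    obtain ⟨v, -, hv⟩ := this
    exact ⟨v, (sub_eq_zero.1 hv).symm⟩
  have hv0 : v ≠ 0 := by
    rintro rfl
    rw [map_zero, map_pow, eq_comm, pow_eq_zero_iff (by norm_num)] at hv
    exact (IsLocalRing.residue_ne_zero_iff_isUnit _).2 (hw 0 (by omega)) hv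
  have hgr : ∀ a, IsLocalRing.residue O ((kloostermanCubic (w 0 ^ 3)).eval (r a)) =
      ι (a ^ 3 + (a + v) ^ 2) := by
    intro a
    simp only [kloostermanCubic, eval_add, eval_mul, eval_pow, eval_X, eval_C, eval_ofNat]
    generalize w 0 ^ 3 = V at hv
    simp only [map_add, map_mul, map_pow, map_ofNat, hr, hv]
    linear_combination ι a ^ 3 * hk3
  have hgd : ∀ a, IsLocalRing.residue O ((derivative (kloostermanCubic (w 0 ^ 3))).eval (r a)) =
      -ι (a + v) := by
    intro a
    generalize w 0 ^ 3 = V at hv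
    simp only [kloostermanCubic, derivative_mul, derivative_pow, derivative_X,
      derivative_C, derivative_ofNat, eval_add, eval_mul, eval_pow, eval_X, eval_C, eval_ofNat,
      eval_one, eval_zero, Nat.cast_ofNat, map_ofNat, map_add, map_mul, map_pow, map_one, map_zero,
      hr, hv]
    linear_combination (4 * ι a ^ 2 + ι a + IsLocalRing.residue O V) * hk3
  have heval : ∀ (p : O[X]) a, IsLocalRing.residue O (p.eval (r a)) =
      (p.map (IsLocalRing.residue O)).eval (ι a) := by
    intro p a
    rw [← hr, eval_map, eval₂_at_apply]
  have hterm : ∀ a, ∃ z : ℕ, L.eval (r a) ^ 2 * (1 - ϖ ^ 2) =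
      (derivative (X * L ^ 2 - P)).eval (r a) *
        (1 + ϖ * (quadraticChar F (a ^ 3 + (a + v) ^ 2) : ℤ) - ϖ ^ 2 * z) := by
    intro a
    have hchar2 : ringChar F ≠ 2 := by rw [ringChar.eq F 3]; norm_num
    refine eval_derivative_fixedPoint ?_ hcurve hdiff (hroot a) ?_ ?_ ?_ ?_ ?_
    · rw [map_ofNat]
      intro h
      exact one_ne_zero (α := IsLocalRing.ResidueField O) (by linear_combination hk3 - h)
    · rw [heval, hLr, eval_one]
    · rw [heval, hHr, eval_pow, ← heval, hgr, ← map_pow, ← map_intCast ι,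
        quadraticChar_eq_pow_of_char_ne_two' hchar2, hF, show 3 ^ n / 2 = e by omega]
    · by_cases h : a ^ 3 + (a + v) ^ 2 = 0
      · exact .inr (quadraticChar_eq_zero_iff.2 h)
      · exact .inl (quadraticChar_sq_one h)
    · rintro h
      rw [hgr, _root_.map_ne_zero, ne_eq, ← quadraticChar_eq_zero_iff]
      intro h0
      simp [h0] at h
    · intro h h0
      have h1 := hgd a
      rw [h0, map_zero, eq_comm, neg_eq_zero, map_eq_zero] at h1
      rw [quadraticChar_eq_zero_iff, h1] at h
      have ha : a = 0 := by simpa using h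
      exact hv0 (by simpa [ha] using h1)
  choose z hz using hterm
  have hinj : Function.Injective fun a => algebraMap O ℂ (r a) := fun a b hab => by
    have := IsFractionRing.injective O ℂ hab
    exact ι.injective (by rw [← hr, ← hr, this])
  have hπ : algebraMap O ℂ ϖ = π := hprod
  have hsum := sum_eval_div_derivative_eval hinj
    (u := algebraMap O ℂ (P.coeff (3 ^ n) * (ϖ ^ 2 - 1)))
    ((L ^ 2).map (algebraMap O ℂ)) (by
      rw [hF]
      exact (natDegree_map_le.trans (natDegree_pow_le_of_le 2 hL)).trans_lt (by omega))
  have hπ1 : π ^ 2 - 1 ≠ 0 := by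
    rw [← hπ, ← map_pow, ← map_one (algebraMap O ℂ), ← map_sub]
    intro h
    rw [map_eq_zero_iff _ (IsFractionRing.injective O ℂ)] at h
    rw [h, mul_zero, map_zero] at hu0
    exact hu0 rfl
  have hπ2 : 1 - π ^ 2 ≠ 0 := by rw [← neg_sub]; exact neg_ne_zero.2 hπ1
  have hD' : C (algebraMap O ℂ (P.coeff (3 ^ n) * (ϖ ^ 2 - 1))) *
      ∏ a, (X - C (algebraMap O ℂ (r a))) = (X * L ^ 2 - P).map (algebraMap O ℂ) := by
    rw [hD]
    simp [Polynomial.map_prod]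
  rw [hD', coeff_map, hF, hL2, ← hlead, map_mul, map_mul, map_sub, map_pow, map_one, hπ,
    mul_div_mul_left _ _ (by rwa [ne_eq, map_eq_zero_iff _ (IsFractionRing.injective O ℂ)])] at hsum
  have hval : ∀ a, ((L ^ 2).map (algebraMap O ℂ)).eval (algebraMap O ℂ (r a)) /
      (derivative ((X * L ^ 2 - P).map (algebraMap O ℂ))).eval (algebraMap O ℂ (r a)) =
      (1 + π * (quadraticChar F (a ^ 3 + (a + v) ^ 2) : ℤ) - π ^ 2 * z a) / (1 - π ^ 2) := by
    intro a
    rw [derivative_map, eval_map, eval_map, eval₂_at_apply, eval₂_at_apply]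
    have h1 := hz a
    generalize derivative (X * L ^ 2 - P) = E at h1 ⊢
    replace h1 := congrArg (algebraMap O ℂ) h1
    simp only [map_mul, map_sub, map_add, map_one, map_pow, map_intCast, map_natCast, hπ] at h1
    have hLa : algebraMap O ℂ (L.eval (r a)) ≠ 0 := by
      rw [ne_eq, map_eq_zero_iff _ (IsFractionRing.injective O ℂ)]
      intro h
      simpa [h, hLr] using heval L a
    have hne := h1 ▸ mul_ne_zero (pow_ne_zero 2 hLa) hπ2
    rw [div_eq_div_iff (left_ne_zero_of_mul hne) hπ2, eval_pow, map_pow, h1, mul_comm]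
  simp only [hval] at hsum
  rw [← Finset.sum_div, Finset.sum_sub_distrib, Finset.sum_add_distrib, ← Finset.mul_sum,
    ← Finset.mul_sum, Finset.sum_const, Finset.card_univ, hF, ← Int.cast_sum,
    ← Nat.cast_sum] at hsum
  generalize ∑ a, z a = m at hsum
  change (_ + π * (cubicCharSum F v : ℂ) - π ^ 2 * (m : ℂ)) / _ = _ at hsum
  rw [← neg_sub 1 (π ^ 2), div_neg, ← neg_div, div_left_inj' hπ2, nsmul_one] at hsum
  push_cast at hsum
  have hπ0 : π ≠ 0 := by rintro rfl; simp at him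
  have hS : (cubicCharSum F v : ℂ) + T = π * m := by
    refine mul_left_cancel₀ hπ0 ?_
    linear_combination hsum + hmul + π * hadd.symm
  have hm : π.im * m = 0 := by simpa using (congrArg Complex.im hS).symm
  rw [mul_eq_zero, or_iff_right him.ne] at hm
  refine ⟨v, hv0, eq_neg_of_add_eq_zero_left ?_⟩
  rw [Nat.cast_eq_zero.1 hm, Nat.cast_zero, mul_zero] at hS
  exact_mod_cast hS

end FixedPoints

/-- Katz-Livné: in characteristic `3`, the Weil spectrum of `d = q − 2` is exactly
the set of integers divisible by `3` in the interval `[1 − 2√q, 1 + 2√q]`. -/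
theorem weilSpectrum_kloosterman_char_three (F : Type*) [Field F] [Fintype F] [CharP F 3] :
    {w : ℂ | ∃ a : F, a ≠ 0 ∧ weilSum F 3 (Fintype.card F - 2) a = w} =
      {w : ℂ | ∃ t : ℤ, w = (t : ℂ) ∧ (3 : ℤ) ∣ t ∧
        1 - 2 * Real.sqrt (Fintype.card F) ≤ (t : ℝ) ∧
        (t : ℝ) ≤ 1 + 2 * Real.sqrt (Fintype.card F)} := by
  classical
  obtain ⟨n, -, hF⟩ := FiniteField.card F 3
  have hq0 : (0 : ℝ) ≤ Fintype.card F := Nat.cast_nonneg _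
  have hbound : ∀ S : ℤ, S ^ 2 ≤ 4 * Fintype.card F ↔
      -(2 * Real.sqrt (Fintype.card F)) ≤ (S : ℝ) ∧ (S : ℝ) ≤ 2 * Real.sqrt (Fintype.card F) := by
    intro S
    rw [← abs_le, ← abs_of_nonneg (mul_nonneg zero_le_two (Real.sqrt_nonneg (Fintype.card F))),
      ← sq_le_sq, mul_pow, Real.sq_sqrt hq0, ← Int.cast_le (R := ℝ)]
    norm_num
  ext x
  constructor
  · rintro ⟨a, ha, rfl⟩
    have hS := (hbound _).1 (cubicCharSum_sq_le (neg_ne_zero.2 ha))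
    refine ⟨1 + cubicCharSum F (-a), ?_, three_dvd_one_add_cubicCharSum _, ?_, ?_⟩
    · rw [weilSum_eq_one_add_cubicCharSum]
      push_cast
      rfl
    · push_cast
      linarith [hS.1]
    · push_cast
      linarith [hS.2]
  · rintro ⟨t, rfl, ht, h1, h2⟩
    have hT : (1 - t) ^ 2 ≤ 4 * (Fintype.card F : ℤ) :=
      (hbound _).2 (by push_cast; constructor <;> linarith)
    have hn : 1 ≤ (n : ℕ) := n.pos
    have hTne : (1 - t) ^ 2 ≠ 4 * (Fintype.card F : ℤ) := by
      intro h
      have h3 : (3 : ℤ) ∣ (1 - t) ^ 2 := by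
        rw [h, hF]
        push_cast
        exact (dvd_pow_self 3 n.ne_zero).mul_left 4
      have := Int.prime_three.dvd_of_dvd_pow h3
      omega
    have hpos : (0 : ℝ) < 4 * Fintype.card F - (1 - t) ^ 2 := by
      rw [sub_pos]
      exact_mod_cast lt_of_le_of_ne hT hTne
    obtain ⟨v, hv, hS⟩ := exists_cubicCharSum_eq_neg F hn hF (T := 1 - t)
      (π := ⟨(1 - t) / 2, -(Real.sqrt (4 * Fintype.card F - (1 - t) ^ 2) / 2)⟩)
      (by simpa using hpos)
      (by
        refine Complex.ext ?_ ?_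
        · simp
        · simp)
      (by
        have := Real.mul_self_sqrt hpos.le
        have hcard : (Fintype.card F : ℝ) = 3 ^ (n : ℕ) := by rw [hF]; push_cast; rfl
        rw [Complex.mul_conj, Complex.normSq_mk, show (3 : ℂ) ^ (n : ℕ) = ((3 ^ (n : ℕ) : ℝ) : ℂ) by
          push_cast; rfl, ← hcard]
        congr 1
        linear_combination this / 4)
      (by omega)
    refine ⟨-v, neg_ne_zero.2 hv, ?_⟩
    rw [weilSum_eq_one_add_cubicCharSum, neg_neg, hS]
    push_cast
    ring
end

section
/- Let F be a finite field of characteristic p and order q, and let d be an invertible exponent over F. Then the Weil spectrum {W_{F,d}(a) : a ∈ F, a ≠ 0} has at least three distinct elements if and only if d is nondegenerate over F. -/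
open scoped BigOperators

/-- An algebraic integer that is a root of the rational polynomial `X² + bX + c` is a rational
integer, or else `b` is. -/
theorem IsIntegral.mem_int_or_of_quadratic {x : ℂ} (hx : IsIntegral ℤ x) {b c : ℚ}
    (h : x ^ 2 + b * x + c = 0) : (∃ n : ℤ, x = n) ∨ ∃ n : ℤ, b = n := by
  have hmap : minpoly ℚ x = (minpoly ℤ x).map (algebraMap ℤ ℚ) :=
    minpoly.isIntegrallyClosed_eq_field_fractions' ℚ hx
  have hxQ : IsIntegral ℚ x := hx.tower_top
  set P : Polynomial ℚ := Polynomial.C 1 * Polynomial.X ^ 2 + Polynomial.C b * Polynomial.X +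
    Polynomial.C c with hP
  have hdeg : P.natDegree = 2 := Polynomial.natDegree_quadratic one_ne_zero
  have hmonic : P.Monic := by
    rw [Polynomial.Monic, Polynomial.leadingCoeff_quadratic one_ne_zero]
  have hroot : Polynomial.aeval x P = 0 := by
    simpa [hP] using h
  have hdvd : minpoly ℚ x ∣ P := minpoly.dvd ℚ x hroot
  have hle : (minpoly ℚ x).natDegree ≤ 2 :=
    hdeg ▸ Polynomial.natDegree_le_of_dvd hdvd hmonic.ne_zero
  have hpos := minpoly.natDegree_pos hxQ
  obtain h1 | h2 : (minpoly ℚ x).natDegree = 1 ∨ (minpoly ℚ x).natDegree = 2 := by omega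
  · left
    rw [hmap, Polynomial.natDegree_map_eq_of_injective (algebraMap ℤ ℚ).injective_int,
      minpoly.natDegree_eq_one_iff] at h1
    obtain ⟨n, hn⟩ := h1
    exact ⟨n, by simpa using hn.symm⟩
  · right
    have heq : minpoly ℚ x = P :=
      (Polynomial.eq_of_monic_of_dvd_of_natDegree_le (minpoly.monic hxQ) hmonic hdvd
        (by omega)).symm
    refine ⟨(minpoly ℤ x).coeff 1, ?_⟩
    have hc := congrArg (fun f => Polynomial.coeff f 1) (hmap.symm.trans heq)
    simpa [hP, Polynomial.coeff_X, Polynomial.coeff_C] using hc.symm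

/-- An algebraic integer which is rational is a rational integer. -/
theorem IsIntegral.exists_int_of_rat {x : ℂ} (hx : IsIntegral ℤ x) {r : ℚ} (h : x = r) :
    ∃ n : ℤ, x = n := by
  subst h
  have : IsIntegral ℤ r := by
    rwa [← isIntegral_algebraMap_iff (algebraMap ℚ ℂ).injective]
  obtain ⟨n, rfl⟩ := IsIntegrallyClosed.isIntegral_iff.mp this
  exact ⟨n, by simp⟩

/-- Two integers, taken `M` and `N` times in total `q - 1` times, whose power moments are `q` and
`q²`: one of them is `q`. -/
theorem eq_or_eq_of_moments_int {q : ℕ} (hq : IsPrimePow q) (h3 : 3 ≤ q) {A B : ℤ} {M N : ℕ}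
    (hM : 0 < M) (hN : 0 < N) (hcard : M + N + 1 = q) (h1 : M * A + N * B = q)
    (h2 : M * A ^ 2 + N * B ^ 2 = (q : ℤ) ^ 2) : A = q ∨ B = q := by
  wlog hAB : B ≤ A generalizing A B M N
  · exact (this hN hM (by omega) (by linarith) (by linarith) (by omega)).symm
  left
  have hq0 : (3 : ℤ) ≤ q := by exact_mod_cast h3
  have hM' : (1 : ℤ) ≤ M := by exact_mod_cast hM
  have hN' : (1 : ℤ) ≤ N := by exact_mod_cast hN
  have hcard' : (M : ℤ) + N + 1 = q := by exact_mod_cast hcard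
  have hA2 : A ^ 2 ≤ (q : ℤ) ^ 2 := by nlinarith [sq_nonneg A, sq_nonneg B]
  have hB2 : B ^ 2 ≤ (q : ℤ) ^ 2 := by nlinarith [sq_nonneg A, sq_nonneg B]
  obtain ⟨hA₁, hA₂⟩ := abs_le_of_sq_le_sq' hA2 (by omega)
  obtain ⟨hB₁, hB₂⟩ := abs_le_of_sq_le_sq' hB2 (by omega)
  have hkey : (q : ℤ) ^ 2 - (A + B) * q + A * B * (q - 1) = 0 := by
    rw [← hcard'] at h1 h2 ⊢
    linear_combination (A + B) * h1 - h2
  obtain ⟨m, hm⟩ : (q : ℤ) ∣ A * B := ⟨q - (A + B) + A * B, by linear_combination -hkey⟩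
  have hsum : A + B = q + m * (q - 1) := by
    refine mul_right_cancel₀ (b := (q : ℤ)) (by omega) ?_
    rw [hm] at hkey
    linear_combination -hkey
  have hApos : 0 < A := by
    by_contra hA
    nlinarith
  rcases lt_trichotomy m 0 with hneg | rfl | hpos
  · obtain hm3 | rfl | rfl : m ≤ -3 ∨ m = -2 ∨ m = -1 := by omega
    · nlinarith
    · exfalso
      have : (A - 2) * (A + q) = 0 := by
        have hB : B = 2 - q - A := by linarith
        rw [hB] at hm
        linear_combination -hm
      rcases mul_eq_zero.mp this with h | h
      · have hB : B = -q := by linarith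
        have hA : A = 2 := by linarith
        rw [hA, hB] at h2
        nlinarith [sq_nonneg (q : ℤ)]
      · omega
    · have hB : B = 1 - A := by linarith
      rw [hB] at hm
      obtain ⟨a, rfl⟩ : ∃ a : ℕ, A = a + 1 := ⟨(A - 1).toNat, by omega⟩
      have hdvd : q ∣ (a + 1) * a := ⟨1, by zify; linear_combination -hm⟩
      have ha : 0 < a := by
        rcases Nat.eq_zero_or_pos a with rfl | h
        · norm_num at hm; omega
        · exact h
      rcases (Nat.Coprime.isPrimePow_dvd_mul (by simp) hq).mp hdvd with h | h
      · have := Nat.le_of_dvd (by omega) h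
        omega
      · have := Nat.le_of_dvd ha h
        omega
  · have hB : B = 0 := by
      rcases mul_eq_zero.mp (show A * B = 0 by linarith) with h | h
      · omega
      · exact h
    linarith
  · nlinarith

/-- Two algebraic integers, taken `M` and `N` times in total `q - 1` times, whose power moments are
`q` and `q²`: one of them is `q`. -/
theorem eq_or_eq_of_moments {q : ℕ} (hq : IsPrimePow q) (h4 : 4 ≤ q) {A B : ℂ}
    (hA : IsIntegral ℤ A) (hB : IsIntegral ℤ B) {M N : ℕ} (hM : 0 < M) (hN : 0 < N)
    (hcard : M + N + 1 = q) (h1 : M * A + N * B = q) (h2 : M * A ^ 2 + N * B ^ 2 = (q : ℂ) ^ 2) :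
    A = q ∨ B = q := by
  have hM0 : (M : ℂ) ≠ 0 := by exact_mod_cast hM.ne'
  have hN0 : (N : ℂ) ≠ 0 := by exact_mod_cast hN.ne'
  have hMN : (M + N : ℂ) ≠ 0 := by exact_mod_cast (by omega : M + N ≠ 0)
  have hquad : A ^ 2 + ((-(2 * q / (M + N)) : ℚ) : ℂ) * A +
      ((q ^ 2 * (1 - N) / (M * (M + N)) : ℚ) : ℂ) = 0 := by
    have : M * (M + N) * A ^ 2 - 2 * q * M * A + q ^ 2 * (1 - N) = (0 : ℂ) := by
      linear_combination N * h2 - (q - M * A + N * B) * h1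
    push_cast
    field_simp
    linear_combination this
  have hAint : ∃ n : ℤ, A = n := by
    rcases hA.mem_int_or_of_quadratic hquad with h | ⟨n, hn⟩
    · exact h
    exfalso
    have hMNQ : (M + N : ℚ) ≠ 0 := by exact_mod_cast (by omega : M + N ≠ 0)
    have hn' : ((M + N : ℕ) : ℤ) * (-n) = 2 * q := by
      rw [neg_eq_iff_eq_neg, div_eq_iff hMNQ] at hn
      have : (M + N : ℚ) * (-n) = 2 * q := by linear_combination -hn
      exact_mod_cast this
    have hdvd : M + N ∣ 2 * (M + N) + 2 := by
      rw [show 2 * (M + N) + 2 = 2 * q by omega]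
      exact Int.natCast_dvd_natCast.mp ⟨-n, by push_cast; exact_mod_cast hn'.symm⟩
    have := Nat.le_of_dvd two_pos ((Nat.dvd_add_right (dvd_mul_left _ _)).mp hdvd)
    omega
  obtain ⟨a, rfl⟩ := hAint
  obtain ⟨b, rfl⟩ : ∃ n : ℤ, B = n :=
    hB.exists_int_of_rat (r := (q - M * a) / N) (by
      push_cast
      field_simp
      linear_combination h1)
  have := eq_or_eq_of_moments_int hq (by omega) hM hN hcard (A := a) (B := b)
    (by exact_mod_cast h1) (by exact_mod_cast h2)
  exact_mod_cast this

section WeilSum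

variable (F : Type*) [Field F] [Fintype F] (p : ℕ) [Fact p.Prime] [CharP F p]

/-- `canonicalPsi` as a bundled additive character. -/
noncomputable def canonicalAddChar : AddChar F ℂ :=
  letI : Algebra (ZMod p) F := ZMod.algebra F p
  (ZMod.stdAddChar (N := p)).compAddMonoidHom (Algebra.trace (ZMod p) F).toAddMonoidHom

theorem canonicalAddChar_apply (x : F) : canonicalAddChar F p x = canonicalPsi F p x := by
  let : Algebra (ZMod p) F := ZMod.algebra F p
  change ZMod.stdAddChar (Algebra.trace (ZMod p) F x) = _
  rw [ZMod.stdAddChar_apply, ZMod.toCircle_apply]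
  rfl

theorem weilSum_eq_sum_canonicalAddChar (d : ℕ) (a : F) :
    weilSum F p d a = ∑ x : F, canonicalAddChar F p (x ^ d - a * x) := by
  simp only [weilSum, canonicalAddChar_apply]

theorem isPrimitive_canonicalAddChar : (canonicalAddChar F p).IsPrimitive := by
  let : Algebra (ZMod p) F := ZMod.algebra F p
  intro a ha h
  apply ha
  refine (traceForm_nondegenerate (ZMod p) F).1 a fun b => ZMod.injective_stdAddChar ?_
  rw [AddChar.map_zero_eq_one, Algebra.traceForm_apply]
  exact DFunLike.congr_fun h b

/-- Where the canonical character is `1` the trace, a sum of Frobenius powers, vanishes. -/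
theorem exists_card_eq_pow_and_canonicalAddChar_eq_one_imp :
    ∃ n : ℕ, Fintype.card F = p ^ n ∧
      ∀ x : F, canonicalAddChar F p x = 1 → ∑ i ∈ Finset.range n, x ^ p ^ i = 0 := by
  let : Algebra (ZMod p) F := ZMod.algebra F p
  refine ⟨Module.finrank (ZMod p) F, ?_, fun x hx => ?_⟩
  · rw [Module.card_eq_pow_finrank (K := ZMod p), ZMod.card]
  · have h0 : Algebra.trace (ZMod p) F x = 0 :=
      ZMod.injective_stdAddChar (by rw [AddChar.map_zero_eq_one]; exact hx)
    have := FiniteField.algebraMap_trace_eq_sum_pow (ZMod p) F x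
    rw [h0, map_zero, Nat.card_zmod] at this
    exact this.symm

variable {F}

theorem isIntegral_weilSum (d : ℕ) (a : F) : IsIntegral ℤ (weilSum F p d a) := by
  rw [weilSum_eq_sum_canonicalAddChar]
  refine IsIntegral.sum _ fun x _ => IsIntegral.of_pow (Fact.out : p.Prime).pos ?_
  rw [← AddChar.map_nsmul_eq_pow, nsmul_eq_mul, CharP.cast_eq_zero, zero_mul, AddChar.map_zero_eq_one]
  exact isIntegral_one

/-- If a Weil sum attains the trivial bound, all of its terms are `1`. -/
theorem canonicalAddChar_eq_one_of_weilSum_eq_card {d : ℕ} {a : F}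
    (h : weilSum F p d a = Fintype.card F) (x : F) :
    canonicalAddChar F p (x ^ d - a * x) = 1 := by
  set f : F → ℂ := fun x => canonicalAddChar F p (x ^ d - a * x)
  have hnorm : ∀ x, ‖f x‖ = 1 := fun x => AddChar.norm_apply _ _
  have hle : ∀ x, (f x).re ≤ 1 := fun x => hnorm x ▸ Complex.re_le_norm _
  have hsum : ∑ x, (1 - (f x).re) = 0 := by
    rw [weilSum_eq_sum_canonicalAddChar] at h
    have := congrArg Complex.re h
    rw [Complex.re_sum, Complex.natCast_re] at this
    rw [Finset.sum_sub_distrib, this]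
    simp
  have hre : (f x).re = 1 := by
    have := (Finset.sum_eq_zero_iff_of_nonneg fun x _ => sub_nonneg.mpr (hle x)).mp hsum x
      (Finset.mem_univ x)
    linarith
  have hne : (f x).re = ‖f x‖ := by rw [hre, hnorm]
  rw [Complex.re_eq_norm] at hne
  refine Complex.ext hre ?_
  simpa using (Complex.nonneg_iff.mp hne).2.symm

/-- If a Weil sum at a nonzero point attains the trivial bound, the exponent is degenerate. -/
theorem exists_modEq_pow_of_weilSum_eq_card {d : ℕ} {a : F} (ha : a ≠ 0)
    (h : weilSum F p d a = Fintype.card F) : ∃ k : ℕ, d ≡ p ^ k [MOD Fintype.card F - 1] := by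
  classical
  obtain ⟨n, hn, htr⟩ := exists_card_eq_pow_and_canonicalAddChar_eq_one_imp F p
  have hp : p.Prime := Fact.out
  set q := Fintype.card F with hq
  have hq2 : 2 ≤ q := Fintype.one_lt_card
  have hn0 : 0 < n := by
    rcases Nat.eq_zero_or_pos n with rfl | h
    · simp at hn; omega
    · exact h
  have hpt : ∀ u : F, ∑ i ∈ Finset.range n, u ^ (d * p ^ i + (q - 2)) =
      ∑ i ∈ Finset.range n, a ^ p ^ i * u ^ (p ^ i + (q - 2)) := fun u => by
    have h0 := htr _ (canonicalAddChar_eq_one_of_weilSum_eq_card p h u)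
    simp only [sub_pow_char_pow, Finset.sum_sub_distrib, sub_eq_zero] at h0
    have := congrArg (· * u ^ (q - 2)) h0
    simpa only [Finset.sum_mul, mul_pow, mul_assoc, ← pow_add, ← pow_mul] using this
  have hsum := Finset.sum_congr (rfl : (Finset.univ : Finset Fˣ) = _) fun u _ => hpt u
  rw [Finset.sum_comm, Finset.sum_comm (s := Finset.univ)] at hsum
  simp only [← Finset.mul_sum, FiniteField.sum_pow_units, ← hq] at hsum
  have hright : ∀ i ∈ Finset.range n, (q - 1 ∣ p ^ i + (q - 2)) → i = 0 := fun i hi hdvd => by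
    have hlt : p ^ i < q := hn ▸ Nat.pow_lt_pow_right hp.one_lt (Finset.mem_range.mp hi)
    have hpos : 0 < p ^ i := pow_pos hp.pos i
    rw [show p ^ i + (q - 2) = (p ^ i - 1) + (q - 1) by omega, Nat.dvd_add_self_right] at hdvd
    have h1 : p ^ i - 1 = 0 := Nat.eq_zero_of_dvd_of_lt hdvd (by omega)
    exact (Nat.pow_eq_one.mp (by omega)).resolve_left hp.one_lt.ne'
  rw [Finset.sum_eq_single_of_mem (f := fun i => a ^ p ^ i * _) 0 (Finset.mem_range.mpr hn0)
    fun i hi hi0 => by rw [if_neg fun hd => hi0 (hright i hi hd), mul_zero], if_pos (by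
      rw [pow_zero, show 1 + (q - 2) = q - 1 by omega])] at hsum
  obtain ⟨i, hi, hdvd⟩ : ∃ i ∈ Finset.range n, q - 1 ∣ d * p ^ i + (q - 2) := by
    by_contra! hno
    rw [Finset.sum_eq_zero fun i hi => if_neg (hno i hi)] at hsum
    exact ha (by simpa using hsum.symm)
  refine ⟨n - i, ?_⟩
  have hone : d * p ^ i ≡ 1 [MOD q - 1] := by
    refine Nat.ModEq.add_right_cancel' (q - 2) ?_
    rw [show 1 + (q - 2) = q - 1 by omega]
    exact (Nat.modEq_zero_iff_dvd.mpr hdvd).trans (Nat.modEq_zero_iff_dvd.mpr dvd_rfl).symm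
  have hqone : q ≡ 1 [MOD q - 1] :=
    ((Nat.modEq_iff_dvd' (by omega)).mpr dvd_rfl).symm
  have hpn : p ^ i * p ^ (n - i) = q := by
    rw [← pow_add, hn, Nat.add_sub_cancel' (Finset.mem_range.mp hi).le]
  calc d = d * 1 := (mul_one d).symm
    _ ≡ d * q [MOD q - 1] := (hqone.mul_left d).symm
    _ = d * p ^ i * p ^ (n - i) := by rw [← hpn, mul_assoc]
    _ ≡ 1 * p ^ (n - i) [MOD q - 1] := hone.mul_right _
    _ = p ^ (n - i) := one_mul _

/-- For a degenerate exponent the Weil sums only take the values `q` and `0`. -/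
theorem weilSum_eq_card_or_eq_zero {d : ℕ} (hd : 0 < d) {k : ℕ}
    (hk : d ≡ p ^ k [MOD Fintype.card F - 1]) (a : F) :
    weilSum F p d a = Fintype.card F ∨ weilSum F p d a = 0 := by
  classical
  have hpow : ∀ x : F, x ^ d = x ^ p ^ k := fun x => by
    rcases eq_or_ne x 0 with rfl | hx
    · rw [zero_pow hd.ne', zero_pow (pow_pos (Fact.out : p.Prime).pos k).ne']
    · exact pow_eq_pow_of_modEq hk (FiniteField.pow_card_sub_one_eq_one x hx)
  have : weilSum F p d a = ∑ x : F, (canonicalAddChar F p).compAddMonoidHom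
      ((iterateFrobenius F p k).toAddMonoidHom - AddMonoidHom.mulLeft a) x := by
    rw [weilSum_eq_sum_canonicalAddChar]
    exact Finset.sum_congr rfl fun x _ => by rw [hpow]; rfl
  rw [this, AddChar.sum_eq_ite]
  split_ifs <;> simp

theorem pow_bijective_of_gcd {d : ℕ} (hd : 0 < d) (hgcd : Nat.gcd d (Fintype.card F - 1) = 1) :
    Function.Bijective fun x : F => x ^ d := by
  rw [← Finite.injective_iff_bijective]
  intro x y hxy
  dsimp only at hxy
  rcases eq_or_ne x 0 with rfl | hx
  · rw [zero_pow hd.ne'] at hxy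
    exact (pow_eq_zero_iff hd.ne' |>.mp hxy.symm).symm
  have hy : y ≠ 0 := by
    rintro rfl
    rw [zero_pow hd.ne'] at hxy
    exact hx (pow_eq_zero_iff hd.ne' |>.mp hxy)
  have h1 : (x / y) ^ d = 1 := by rw [div_pow, hxy, div_self (pow_ne_zero d hy)]
  have h2 := FiniteField.pow_card_sub_one_eq_one (x / y) (div_ne_zero hx hy)
  have h3 := pow_gcd_eq_one.mpr ⟨h1, h2⟩
  rw [hgcd, pow_one] at h3
  exact (div_eq_one_iff_eq hy).mp h3

theorem weilSum_zero {d : ℕ} (hd : 0 < d) (hgcd : Nat.gcd d (Fintype.card F - 1) = 1) :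
    weilSum F p d 0 = 0 := by
  classical
  rw [weilSum_eq_sum_canonicalAddChar]
  simp only [zero_mul, sub_zero]
  rw [(pow_bijective_of_gcd hd hgcd).sum_comp (fun x => canonicalAddChar F p x)]
  simpa using AddChar.sum_mulShift (1 : F) (isPrimitive_canonicalAddChar F p)

theorem sum_weilSum {d : ℕ} (hd : 0 < d) : ∑ a : F, weilSum F p d a = Fintype.card F := by
  classical
  simp only [weilSum_eq_sum_canonicalAddChar]
  rw [Finset.sum_comm]
  have : ∀ x a : F, canonicalAddChar F p (x ^ d - a * x) =
      canonicalAddChar F p (x ^ d) * canonicalAddChar F p (a * -x) := fun x a => by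
    rw [← AddChar.map_add_eq_mul]; ring_nf
  simp only [this, ← Finset.mul_sum,
    AddChar.sum_mulShift _ (isPrimitive_canonicalAddChar F p), neg_eq_zero]
  simp [hd.ne']

theorem neg_pow_add_pow_eq_zero {d : ℕ} (hgcd : Nat.gcd d (Fintype.card F - 1) = 1) (x : F) :
    (-x) ^ d + x ^ d = 0 := by
  rcases Nat.even_or_odd d with hd | hd
  · have h2 : ringChar F = 2 := by
      by_contra h2
      have hodd := FiniteField.odd_card_of_char_ne_two h2
      have : 2 ∣ Nat.gcd d (Fintype.card F - 1) :=
        Nat.dvd_gcd hd.two_dvd (by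
          obtain ⟨m, hm⟩ : Odd (Fintype.card F) := Nat.odd_iff.mpr hodd
          exact ⟨m, by omega⟩)
      omega
    have : CharP F 2 := ringChar.of_eq h2
    rw [hd.neg_pow, CharTwo.add_self_eq_zero]
  · rw [hd.neg_pow, neg_add_cancel]

theorem sum_weilSum_sq {d : ℕ} (hgcd : Nat.gcd d (Fintype.card F - 1) = 1) :
    ∑ a : F, weilSum F p d a ^ 2 = (Fintype.card F : ℂ) ^ 2 := by
  classical
  have key : ∀ a x y : F, canonicalAddChar F p (x ^ d - a * x) *
      canonicalAddChar F p (y ^ d - a * y) =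
      canonicalAddChar F p (x ^ d + y ^ d) * canonicalAddChar F p (a * -(x + y)) := fun a x y => by
    rw [← AddChar.map_add_eq_mul, ← AddChar.map_add_eq_mul]; ring_nf
  calc ∑ a : F, weilSum F p d a ^ 2
      = ∑ a : F, ∑ x : F, ∑ y : F, canonicalAddChar F p (x ^ d + y ^ d) *
          canonicalAddChar F p (a * -(x + y)) := by
        simp only [weilSum_eq_sum_canonicalAddChar, sq, Finset.sum_mul_sum, key]
    _ = ∑ y : F, ∑ x : F, ∑ a : F, canonicalAddChar F p (x ^ d + y ^ d) *
          canonicalAddChar F p (a * -(x + y)) := by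
        rw [Finset.sum_comm_cycle]
        exact Finset.sum_congr rfl fun _ _ => Finset.sum_comm
    _ = ∑ y : F, (Fintype.card F : ℂ) := by
        refine Finset.sum_congr rfl fun y _ => ?_
        simp only [← Finset.mul_sum,
          AddChar.sum_mulShift _ (isPrimitive_canonicalAddChar F p), neg_eq_zero]
        rw [Finset.sum_eq_single (-y)]
        · simp [neg_pow_add_pow_eq_zero hgcd]
        · intro x _ hx
          simp [add_eq_zero_iff_eq_neg, hx]
        · simp
    _ = (Fintype.card F : ℂ) ^ 2 := by simp [sq]

end WeilSum

/-- Helleseth: the Weil spectrum has at least three values iff `d` is nondegenerate over `F`. -/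
theorem three_le_ncard_weilSpectrum_iff (F : Type*) [Field F] [Fintype F]
    (p : ℕ) [Fact p.Prime] [CharP F p] (d : ℕ) (hd : 0 < d)
    (hgcd : Nat.gcd d (Fintype.card F - 1) = 1) :
    3 ≤ Set.ncard {w : ℂ | ∃ a : F, a ≠ 0 ∧ weilSum F p d a = w} ↔
      ¬ ∃ k : ℕ, d ≡ p ^ k [MOD Fintype.card F - 1] := by
  classical
  refine ⟨?_, fun hnd => ?_⟩
  · rintro h3 ⟨k, hk⟩
    have hsub : {w : ℂ | ∃ a : F, a ≠ 0 ∧ weilSum F p d a = w} ⊆ {(Fintype.card F : ℂ), 0} := by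
      rintro w ⟨a, -, rfl⟩
      exact weilSum_eq_card_or_eq_zero p hd hk a
    have := (Set.ncard_le_ncard hsub).trans (Set.ncard_insert_le _ _)
    rw [Set.ncard_singleton] at this
    omega
  · set S := {w : ℂ | ∃ a : F, a ≠ 0 ∧ weilSum F p d a = w}
    by_contra hlt
    have hSfin : S.Finite := (Set.finite_range (weilSum F p d)).subset (by
      rintro w ⟨a, -, rfl⟩
      exact ⟨a, rfl⟩)
    have hne : ∀ a : F, a ≠ 0 → weilSum F p d a ≠ Fintype.card F := fun a ha h =>
      hnd (exists_modEq_pow_of_weilSum_eq_card p ha h)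
    have h2 : 2 ≤ Fintype.card F := Fintype.one_lt_card
    have h4 : 4 ≤ Fintype.card F := by
      by_contra h4
      obtain h | h : Fintype.card F = 2 ∨ Fintype.card F = 3 := by omega
      · exact hnd ⟨0, by rw [h]; exact Nat.modEq_one⟩
      · refine hnd ⟨0, ?_⟩
        rw [h] at hgcd ⊢
        rw [pow_zero]
        exact Nat.odd_iff.mp (Nat.coprime_two_right.mp hgcd)
    set U : Finset F := Finset.univ.erase 0 with hU
    have hUcard : U.card + 1 = Fintype.card F := by
      rw [hU, Finset.card_erase_of_mem (Finset.mem_univ _), Finset.card_univ]; omega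
    have hmem : ∀ a ∈ U, weilSum F p d a ∈ S := fun a ha => ⟨a, Finset.ne_of_mem_erase ha, rfl⟩
    have hs1 : ∑ a ∈ U, weilSum F p d a = Fintype.card F := by
      rw [← sum_weilSum p hd, hU, Finset.sum_erase _ (weilSum_zero p hd hgcd)]
    have hs2 : ∑ a ∈ U, weilSum F p d a ^ 2 = (Fintype.card F : ℂ) ^ 2 := by
      rw [← sum_weilSum_sq p hgcd, hU, Finset.sum_erase _ (by simp [weilSum_zero p hd hgcd])]
    -- The nonzero points split into two nonempty parts with constant Weil sums.
    obtain ⟨T, hT, a, ha, b, hb, hTa, hTb⟩ : ∃ T ⊆ U, ∃ a ∈ T, ∃ b ∈ U \ T,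
        (∀ x ∈ T, weilSum F p d x = weilSum F p d a) ∧
        ∀ x ∈ U \ T, weilSum F p d x = weilSum F p d b := by
      have h1U : (1 : F) ∈ U := by simp [hU]
      by_cases hconst : ∀ x ∈ U, weilSum F p d x = weilSum F p d 1
      · obtain ⟨b, hb, hb1⟩ := Finset.exists_mem_ne (s := U) (by omega) 1
        refine ⟨{1}, by simpa using h1U, 1, by simp, b, by simp [hb, hb1], by simp, fun x hx => ?_⟩
        rw [hconst x (Finset.mem_sdiff.mp hx).1, hconst b hb]
      · push Not at hconst
        obtain ⟨b, hb, hb1⟩ := hconst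
        refine ⟨U.filter fun x => weilSum F p d x = weilSum F p d 1, Finset.filter_subset _ _,
          1, by simp [h1U], b, by simp [hb, hb1], by simp, fun x hx => ?_⟩
        simp only [Finset.mem_sdiff, Finset.mem_filter, not_and] at hx
        by_contra hxb
        exact hlt ((Set.two_lt_ncard_iff hSfin).mpr ⟨_, _, _, hmem x hx.1, hmem b hb, hmem 1 h1U,
          hxb, hx.2 hx.1, hb1⟩)
    rw [← Finset.sum_sdiff hT, Finset.sum_congr rfl hTa, Finset.sum_congr rfl hTb] at hs1
    rw [← Finset.sum_sdiff hT, Finset.sum_congr rfl fun x hx => congrArg (· ^ 2) (hTa x hx),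
      Finset.sum_congr rfl fun x hx => congrArg (· ^ 2) (hTb x hx)] at hs2
    simp only [Finset.sum_const, nsmul_eq_mul] at hs1 hs2
    have hcard := Finset.card_sdiff_add_card_eq_card hT
    rcases eq_or_eq_of_moments (FiniteField.isPrimePow_card F) h4 (isIntegral_weilSum p d b)
      (isIntegral_weilSum p d a) (Finset.card_pos.mpr ⟨b, hb⟩) (Finset.card_pos.mpr ⟨a, ha⟩)
      (by omega) hs1 hs2 with h | h
    · exact hne b (Finset.ne_of_mem_erase (Finset.mem_sdiff.mp hb).1) h
    · exact hne a (Finset.ne_of_mem_erase (hT ha)) h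
end

section
/- Let F be a finite field of characteristic p and order q, and let d be an invertible exponent over F such that the Weil spectrum {W_{F,d}(a) : a ∈ F, a ≠ 0} has exactly three distinct elements. Then d ≡ 1 (mod p−1) and W_{F,d}(a) ∈ ℤ for every a ∈ F. -/
open scoped BigOperators

/-- The Weil sum `∑ x, ψ (x ^ d - a * x)` for an additive character with values in any field. -/
def addCharWeilSum {F K : Type*} [Field F] [Fintype F] [Field K] (ψ : AddChar F K) (d : ℕ)
    (a : F) : K :=
  ∑ x : F, ψ (x ^ d - a * x)

theorem pow_bijective_of_coprime_card_sub_one {F : Type*} [Field F] [Fintype F] {d : ℕ}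
    (hd : 0 < d) (h : Nat.gcd d (Fintype.card F - 1) = 1) :
    Function.Bijective fun x : F => x ^ d := by
  refine Finite.injective_iff_bijective.mp fun x y (hxy : x ^ d = y ^ d) => ?_
  rcases eq_or_ne y 0 with rfl | hy
  · rw [zero_pow hd.ne'] at hxy
    exact pow_eq_zero_iff hd.ne' |>.mp hxy
  · have hx : x ≠ 0 := by
      rintro rfl
      rw [zero_pow hd.ne'] at hxy
      exact hy (pow_eq_zero_iff hd.ne' |>.mp hxy.symm)
    have h1 : (x / y) ^ d = 1 := by
      rw [div_pow, hxy, div_self (pow_ne_zero _ hy)]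
    have h2 : (x / y) ^ (Fintype.card F - 1) = 1 :=
      FiniteField.pow_card_sub_one_eq_one _ (div_ne_zero hx hy)
    have h3 : orderOf (x / y) ∣ 1 :=
      h ▸ Nat.dvd_gcd (orderOf_dvd_of_pow_eq_one h1) (orderOf_dvd_of_pow_eq_one h2)
    rw [Nat.dvd_one, orderOf_eq_one_iff, div_eq_one_iff_eq hy] at h3
    exact h3

theorem neg_one_pow_of_coprime_card_sub_one {F : Type*} [Field F] [Fintype F] {d : ℕ}
    (h : Nat.gcd d (Fintype.card F - 1) = 1) : (-1 : F) ^ d = -1 := by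
  rcases Nat.even_or_odd d with he | ho
  · have h2 : Fintype.card F % 2 = 0 := by
      by_contra hq
      have : 2 ∣ Nat.gcd d (Fintype.card F - 1) :=
        Nat.dvd_gcd he.two_dvd (by omega)
      omega
    have := FiniteField.even_card_iff_char_two.mpr h2
    have : CharP F 2 := this ▸ ringChar.charP F
    rw [CharTwo.neg_eq, one_pow]
  · exact ho.neg_one_pow

section AddCharWeilSum

variable {F K : Type*} [Field F] [Fintype F] [Field K] {ψ : AddChar F K} {d : ℕ}

theorem addCharWeilSum_zero (hψ : ψ.IsPrimitive) (hd : Function.Bijective fun x : F => x ^ d) :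
    addCharWeilSum ψ d 0 = 0 := by
  classical
  have h1 : ∑ x : F, ψ (x ^ d) = ∑ x : F, ψ x :=
    Fintype.sum_bijective _ hd _ _ fun _ => rfl
  have h2 := AddChar.sum_mulShift (1 : F) hψ
  simp only [mul_one, one_ne_zero, if_false] at h2
  simp only [addCharWeilSum, zero_mul, sub_zero]
  rw [h1, h2, Nat.cast_zero]

theorem sum_addCharWeilSum (hψ : ψ.IsPrimitive) (hd : 0 < d) :
    ∑ a, addCharWeilSum ψ d a = Fintype.card F := by
  classical
  simp only [addCharWeilSum]
  rw [Finset.sum_comm]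
  have : ∀ x : F, ∑ a : F, ψ (x ^ d - a * x) = if x = 0 then (Fintype.card F : K) else 0 := by
    intro x
    have h := AddChar.sum_mulShift (-x) hψ
    simp only [neg_eq_zero] at h
    simp only [sub_eq_add_neg, ψ.map_add_eq_mul, ← mul_neg, ← Finset.mul_sum, h]
    split_ifs with hx
    · simp [hx, hd.ne']
    · simp
  simp [this]

theorem sum_addCharWeilSum_mul (hψ : ψ.IsPrimitive)
    (hd : Function.Bijective fun x : F => x ^ d) (hneg : (-1 : F) ^ d = -1) [DecidableEq F] (c : F) :
    ∑ a, addCharWeilSum ψ d a * addCharWeilSum ψ d (c * a) =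
      if c = 1 then (Fintype.card F : K) ^ 2 else 0 := by
  have key : ∀ y x : F, ∑ a : F, ψ (x ^ d - a * x) * ψ (y ^ d - c * a * y) =
      if x = -(c * y) then (Fintype.card F : K) * ψ (y ^ d * (1 - c ^ d)) else 0 := by
    intro y x
    have h := AddChar.sum_mulShift (-(x + c * y)) hψ
    have h1 : ∀ a, ψ (x ^ d - a * x) * ψ (y ^ d - c * a * y) =
        ψ (x ^ d + y ^ d) * ψ (a * -(x + c * y)) := by
      intro a
      rw [← ψ.map_add_eq_mul, ← ψ.map_add_eq_mul]
      ring_nf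
    simp only [h1, ← Finset.mul_sum, h]
    simp only [neg_eq_zero, ← eq_neg_iff_add_eq_zero]
    split_ifs with hx
    · rw [mul_comm, hx, ← neg_one_mul, mul_pow, mul_pow, hneg]
      ring_nf
    · simp
  have h2 : ∀ a, addCharWeilSum ψ d a * addCharWeilSum ψ d (c * a) =
      ∑ y : F, ∑ x : F, ψ (x ^ d - a * x) * ψ (y ^ d - c * a * y) := by
    intro a
    rw [addCharWeilSum, addCharWeilSum, Finset.sum_mul_sum, Finset.sum_comm]
  have h3 : ∑ y : F, ψ (y ^ d * (1 - c ^ d)) = ∑ z : F, ψ (z * (1 - c ^ d)) :=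
    Fintype.sum_bijective _ hd _ _ fun _ => rfl
  have h4 : 1 - c ^ d = 0 ↔ c = 1 := by
    rw [sub_eq_zero]
    constructor
    · intro h
      exact (hd.1 (by simpa using h)).symm
    · rintro rfl
      simp
  simp only [h2]
  rw [Finset.sum_comm]
  have h5 : ∀ y : F, ∑ a : F, ∑ x : F, ψ (x ^ d - a * x) * ψ (y ^ d - c * a * y) =
      (Fintype.card F : K) * ψ (y ^ d * (1 - c ^ d)) := by
    intro y
    rw [Finset.sum_comm]
    simp [key]
  simp only [h5]
  rw [← Finset.mul_sum, h3, AddChar.sum_mulShift _ hψ]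
  simp only [h4]
  split_ifs
  · ring
  · simp

/-- A field automorphism acting on the values of `ψ` by scaling the argument permutes the values
of the Weil sum by scaling the argument. -/
theorem exists_map_addCharWeilSum_eq (hd : Function.Bijective fun x : F => x ^ d)
    (σ : K →+* K) {j : F} (hj : j ≠ 0) (hσ : ∀ x, σ (ψ x) = ψ (j * x)) :
    ∃ c : F, c ≠ 0 ∧ (c = 1 → j ^ d = j) ∧
      ∀ a, σ (addCharWeilSum ψ d a) = addCharWeilSum ψ d (c * a) := by
  obtain ⟨e, he⟩ := hd.2 j
  dsimp only at he
  have hd0 : d ≠ 0 := by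
    rintro rfl
    have := @hd.1 0 1 (by simp)
    exact zero_ne_one this
  have he0 : e ≠ 0 := by
    rintro rfl
    exact hj (by rw [← he, zero_pow hd0])
  refine ⟨j / e, div_ne_zero hj he0, fun h => ?_, fun a => ?_⟩
  · rw [div_eq_one_iff_eq he0] at h
    rw [← h] at he
    exact he
  · simp only [addCharWeilSum, map_sum, hσ]
    refine Fintype.sum_equiv (Equiv.mulLeft₀ e he0) _ _ fun x => ?_
    rw [Equiv.mulLeft₀_apply, mul_pow, he]
    field_simp

end AddCharWeilSum

theorem false_of_quadratic_spectrum {p n M N : ℕ} (hp : p.Prime) (hM : 0 < M) (hN : N ≠ 1)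
    {A t : ℤ} (hcard : M + 2 * N + 1 = p ^ n) (hdvd : N ∣ (p ^ n) ^ 2)
    (h1 : M * A + N * t = (p ^ n : ℤ)) (h2 : 2 * M * A ^ 2 + N * t ^ 2 = (p ^ n : ℤ) ^ 2) :
    False := by
  have hp' : Prime (p : ℤ) := Nat.prime_iff_prime_int.mp hp
  have hp0 : (p : ℤ) ≠ 0 := hp'.ne_zero
  have hq0 : (0 : ℤ) < (p : ℤ) ^ n := by have := hp.pos; positivity
  obtain ⟨k, -, hNk⟩ : ∃ k ≤ n * 2, N = p ^ k := by
    rwa [← Nat.dvd_prime_pow hp, pow_mul]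
  have hk : k ≠ 0 := by rintro rfl; exact hN hNk
  have hNk' : (N : ℤ) = (p : ℤ) ^ k := by exact_mod_cast hNk
  have hpN : (p : ℤ) ∣ N := hNk' ▸ dvd_pow_self _ hk
  have hn0 : n ≠ 0 := by rintro rfl; simp at hcard; omega
  have hcard' : (M : ℤ) + 2 * N + 1 = (p : ℤ) ^ n := by exact_mod_cast hcard
  have hpM : ¬ (p : ℤ) ∣ M := by
    intro h
    have h3 : (p : ℤ) ∣ 1 := by
      have := (dvd_pow_self (p : ℤ) hn0).sub (dvd_add h (dvd_mul_of_dvd_right hpN 2))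
      rwa [← hcard', add_sub_cancel_left] at this
    exact hp'.not_isUnit (isUnit_of_dvd_one h3)
  have hqNt : (p : ℤ) ^ n ∣ N * t := by
    rcases eq_or_ne t 0 with rfl | ht
    · simp
    obtain ⟨s, hts, hs⟩ := (Int.finiteMultiplicity_iff (a := p) (b := t)).mpr
      ⟨by simpa using hp.ne_one, ht⟩ |>.exists_eq_pow_mul_and_not_dvd
    set v := multiplicity (p : ℤ) t
    have hNt : N * t = (p : ℤ) ^ (k + v) * s := by rw [hts, hNk', pow_add]; ring
    rw [hNt]
    refine dvd_mul_of_dvd_left (pow_dvd_pow _ ?_) _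
    by_contra! hlt
    have h3 : (p : ℤ) ^ (k + v) ∣ M * A := by
      rw [eq_sub_of_add_eq h1]
      exact (pow_dvd_pow _ hlt.le).sub (hNt ▸ dvd_mul_right _ _)
    have h4 : (p : ℤ) ^ (k + 2 * v + 1) ∣ (M * A) ^ 2 :=
      (pow_dvd_pow _ (by omega : k + 2 * v + 1 ≤ (k + v) * 2)).trans
        (pow_mul (p : ℤ) (k + v) 2 ▸ pow_dvd_pow_of_dvd h3 2)
    have h5 : (p : ℤ) ^ (k + 2 * v + 1) ∣ ((p : ℤ) ^ n) ^ 2 := by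
      rw [← pow_mul]; exact pow_dvd_pow _ (by omega)
    have h6 : (p : ℤ) ^ (k + 2 * v) * p ∣ (p : ℤ) ^ (k + 2 * v) * (M * s ^ 2) := by
      have h7 : (p : ℤ) ^ (k + 2 * v) * (M * s ^ 2) =
          M * ((p : ℤ) ^ n) ^ 2 - 2 * (M * A) ^ 2 := by
        rw [← h2, hNk', hts]; ring
      rw [h7, ← pow_succ]
      exact (dvd_mul_of_dvd_right h5 _).sub (dvd_mul_of_dvd_right h4 _)
    rcases hp'.dvd_or_dvd ((mul_dvd_mul_iff_left (pow_ne_zero _ hp0)).mp h6) with h | h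
    · exact hpM h
    · exact hs (hp'.dvd_of_dvd_pow h)
  have hqA : (p : ℤ) ^ n ∣ A := by
    have h3 : (p : ℤ) ^ n ∣ M * A := by
      rw [eq_sub_of_add_eq h1]; exact (dvd_refl _).sub hqNt
    exact hp'.pow_dvd_of_dvd_mul_left n hpM h3
  obtain ⟨r, rfl⟩ := hqA
  have hM' : (1 : ℤ) ≤ M := by exact_mod_cast hM
  have hr : r = 0 := by
    by_contra hr
    have hr1 : 1 ≤ r ^ 2 := by have := sq_pos_of_ne_zero hr; omega
    have h3 : (2 * M * r ^ 2 - 1) * ((p : ℤ) ^ n) ^ 2 ≤ 0 := by nlinarith [sq_nonneg t]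
    have h4 : 0 < 2 * M * r ^ 2 - 1 := by nlinarith
    have := mul_pos h4 (pow_pos hq0 2)
    omega
  subst hr
  have h3 : t = (p : ℤ) ^ n := by
    apply mul_left_cancel₀ hq0.ne'
    linear_combination h2 - t * h1
  rw [h3] at h1
  have h4 : (N : ℤ) = 1 := by
    apply mul_right_cancel₀ hq0.ne'
    linear_combination h1
  exact hN (by exact_mod_cast h4)

/-- An injective self-map of a three-element set fixes it pointwise, or is a transposition, or is a
three-cycle. -/
theorem Finset.exists_cycle_type_of_card_eq_three {α : Type*} [DecidableEq α] {s : Finset α}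
    (hs : s.card = 3) {f : α → α} (hf : Function.Injective f) (hfs : ∀ x ∈ s, f x ∈ s) :
    (∀ x ∈ s, f x = x) ∨ ∃ x y z, x ≠ y ∧ x ≠ z ∧ y ≠ z ∧ s = {x, y, z} ∧
      (f x = x ∧ f y = z ∧ f z = y ∨ f x = y ∧ f y = z ∧ f z = x) := by
  obtain ⟨x, y, z, hxy, hxz, hyz, rfl⟩ := Finset.card_eq_three.mp hs
  have hx := hfs x (by simp)
  have hy := hfs y (by simp)
  have hz := hfs z (by simp)
  have ixy := hf.ne hxy
  have ixz := hf.ne hxz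
  have iyz := hf.ne hyz
  simp only [Finset.mem_insert, Finset.mem_singleton] at hx hy hz
  rcases hx with hx | hx | hx <;> rcases hy with hy | hy | hy <;>
    rcases hz with hz | hz | hz <;> first | (exfalso; simp_all; done) | skip
  · left; simp [hx, hy, hz]
  · exact .inr ⟨x, y, z, hxy, hxz, hyz, rfl, .inl ⟨hx, hy, hz⟩⟩
  · exact .inr ⟨z, x, y, hxz.symm, hyz.symm, hxy, by grind, .inl ⟨hz, hx, hy⟩⟩
  · exact .inr ⟨x, y, z, hxy, hxz, hyz, rfl, .inr ⟨hx, hy, hz⟩⟩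
  · exact .inr ⟨x, z, y, hxz, hxy, hyz.symm, by grind, .inr ⟨hx, hz, hy⟩⟩
  · exact .inr ⟨y, x, z, hxy.symm, hyz, hxz, by grind, .inl ⟨hy, hx, hz⟩⟩

theorem isIntegral_addCharWeilSum {F K : Type*} [Field F] [Fintype F] [Field K] (ψ : AddChar F K)
    (d : ℕ) (a : F) : IsIntegral ℤ (addCharWeilSum ψ d a) := by
  refine IsIntegral.sum _ fun x _ => ?_
  refine IsIntegral.of_pow Fintype.card_pos (n := Fintype.card F) ?_
  rw [← AddChar.map_nsmul_eq_pow, card_nsmul_eq_zero, AddChar.map_zero_eq_one]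
  exact isIntegral_one

theorem map_addCharWeilSum_eq_of_three_valued {F K : Type*} [Field F] [Fintype F] [DecidableEq F]
    [Field K] [CharZero K] [DecidableEq K] {p : ℕ} (hp : p.Prime) [CharP F p] {ψ : AddChar F K}
    (hψ : ψ.IsPrimitive) {d : ℕ} (hd : 0 < d) (hgcd : Nat.gcd d (Fintype.card F - 1) = 1)
    (σ : K →+* K) {j : F} (hj : j ≠ 0) (hj2 : p = 2 → j = 1) (hσ : ∀ x, σ (ψ x) = ψ (j * x))
    (hint : ∀ w : K, IsIntegral ℤ w → σ w = w → ∃ m : ℤ, w = m)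
    (h3 : ((Finset.univ.erase (0 : F)).image (addCharWeilSum ψ d)).card = 3) :
    j ^ d = j ∧ ∀ a, σ (addCharWeilSum ψ d a) = addCharWeilSum ψ d a := by
  have hbij : Function.Bijective fun x : F => x ^ d := pow_bijective_of_coprime_card_sub_one hd hgcd
  have hneg := neg_one_pow_of_coprime_card_sub_one (F := F) hgcd
  obtain ⟨c, hc0, hcj, hc⟩ := exists_map_addCharWeilSum_eq (ψ := ψ) hbij σ hj hσ
  have hWint := isIntegral_addCharWeilSum ψ d
  have hW0 := addCharWeilSum_zero hψ hbij
  have hS1 := sum_addCharWeilSum hψ hd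
  have hS2 := sum_addCharWeilSum_mul hψ hbij hneg 1
  have hS3 := sum_addCharWeilSum_mul hψ hbij hneg c
  simp only [← hc, one_mul, if_true] at hS2 hS3
  set W := addCharWeilSum ψ d
  have hq0 : (Fintype.card F : K) ≠ 0 := Nat.cast_ne_zero.mpr Fintype.card_ne_zero
  set Z := Finset.univ.erase (0 : F)
  set N : K → ℕ := fun w => (Z.filter fun a => W a = w).card
  have hNσ : ∀ w, N (σ w) = N w := by
    intro w
    refine (Finset.card_equiv (Equiv.mulLeft₀ c hc0) fun a => ?_).symm
    simp [Z, hc0, ← hc, σ.injective.eq_iff]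
  have hsum : ∀ g : K → K, ∑ a ∈ Z, g (W a) = ∑ w ∈ Z.image W, N w * g w := by
    intro g
    rw [Finset.sum_comp]
    simp only [nsmul_eq_mul, N]
  have hZ : ∀ g : F → K, g 0 = 0 → ∑ a, g a = ∑ a ∈ Z, g a := fun g hg =>
    (Finset.sum_erase _ hg).symm
  have hN0 : ∀ w ∈ Z.image W, 0 < N w := by
    intro w hw
    obtain ⟨a, ha, haw⟩ := Finset.mem_image.mp hw
    exact Finset.card_pos.mpr ⟨a, Finset.mem_filter.mpr ⟨ha, haw⟩⟩
  have hcard : ∑ w ∈ Z.image W, N w + 1 = Fintype.card F := by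
    rw [← Finset.card_eq_sum_card_image]
    exact Finset.card_erase_add_one (Finset.mem_univ _)
  rw [hZ _ hW0, hsum fun w => w] at hS1
  rw [hZ _ (by simp [hW0]), hsum fun w => w * w] at hS2
  have hfix : (∀ a, σ (W a) = W a) → j ^ d = j := by
    intro h
    apply hcj
    by_contra hc1
    simp only [h, hc1, if_false] at hS3
    rw [hZ _ (by simp [hW0]), hsum fun w => w * w, hS2] at hS3
    exact hq0 (pow_eq_zero_iff two_ne_zero |>.mp hS3)
  rw [hZ _ (by simp [hW0]), hsum fun w => w * σ w] at hS3
  have hmaps : ∀ w ∈ Z.image W, σ w ∈ Z.image W := by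
    intro w hw
    obtain ⟨a, ha, rfl⟩ := Finset.mem_image.mp hw
    rw [hc]
    exact Finset.mem_image_of_mem _ (by simpa [Z, hc0] using ha)
  have hSint : ∀ w ∈ Z.image W, IsIntegral ℤ w := by
    intro w hw
    obtain ⟨a, -, rfl⟩ := Finset.mem_image.mp hw
    exact hWint a
  obtain ⟨n, -, hqn⟩ := FiniteField.card F p
  rcases Finset.exists_cycle_type_of_card_eq_three h3 σ.injective hmaps with
    h | ⟨A, B, C, hAB, hAC, hBC, hS, h⟩
  · have hall : ∀ a, σ (W a) = W a := by
      intro a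
      rcases eq_or_ne a 0 with rfl | ha
      · rw [hW0, map_zero]
      · exact h _ (Finset.mem_image_of_mem _ (by simpa [Z] using ha))
    exact ⟨hfix hall, hall⟩
  exfalso
  have hsum3 : ∀ {R : Type _} [AddCommMonoid R] (g : K → R),
      ∑ w ∈ Z.image W, g w = g A + (g B + g C) := by
    intro R _ g
    rw [hS, Finset.sum_insert (by simp [hAB, hAC]), Finset.sum_pair hBC]
  have hA : A ∈ Z.image W := by simp [hS]
  have hB : B ∈ Z.image W := by simp [hS]
  have hC : C ∈ Z.image W := by simp [hS]
  have hc1 : c ≠ 1 := by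
    rintro rfl
    obtain ⟨b, -, hb⟩ := Finset.mem_image.mp hB
    have hσB : σ B = B := by rw [← hb, hc, one_mul]
    rcases h with ⟨-, h, -⟩ | ⟨-, h, -⟩ <;> exact hBC (hσB.symm.trans h)
  simp only [hc1, if_false] at hS3
  have hcard' : N A + (N B + N C) + 1 = Fintype.card F := by rw [← hcard, hS,
    Finset.sum_insert (by simp [hAB, hAC]), Finset.sum_pair hBC]
  rw [hsum3] at hS1 hS2 hS3
  rcases h with ⟨hσA, hσB, hσC⟩ | ⟨hσA, hσB, hσC⟩
  · have hNC : N C = N B := hσB ▸ hNσ B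
    rw [hNC] at hS1 hS2 hS3 hcard'
    rw [hσA, hσB, hσC] at hS3
    obtain ⟨A', hA'⟩ := hint A (hSint A hA) hσA
    obtain ⟨t, ht⟩ := hint (B + C) ((hSint B hB).add (hSint C hC)) (by
      rw [map_add, hσB, hσC, add_comm])
    obtain ⟨D, hD⟩ := hint ((B - C) ^ 2) (((hSint B hB).sub (hSint C hC)).pow 2) (by
      rw [map_pow, map_sub, hσB, hσC]; ring)
    refine false_of_quadratic_spectrum (A := A') (t := t) (N := N B) (n := n) hp (hN0 A hA) ?_
      (by rw [← hqn, ← hcard']; ring) ?_ ?_ ?_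
    · intro hN1
      have hsq : (B - C) ^ 2 = (Fintype.card F : K) ^ 2 := by
        rw [hN1] at hS2 hS3
        push_cast at hS2 hS3
        linear_combination hS2 - hS3
      have hσBC : σ (B - C) = B - C := by
        rcases sq_eq_sq_iff_eq_or_eq_neg.mp hsq with h | h <;> rw [h] <;> simp
      rw [map_sub, hσB, hσC] at hσBC
      have h2 : (2 : K) * (B - C) = 0 := by linear_combination -hσBC
      simp [sub_eq_zero, hBC] at h2
    · rw [← hqn, ← Int.natCast_dvd_natCast]
      refine ⟨D, ?_⟩
      have : ((Fintype.card F : K)) ^ 2 = N B * D := by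
        rw [← hD]
        linear_combination hS3 - hS2
      exact_mod_cast this
    · have : (N A : K) * A' + N B * t = Fintype.card F := by
        rw [← ht, ← hA']
        linear_combination hS1
      rw [hqn] at this
      exact_mod_cast this
    · have : 2 * (N A : K) * A' ^ 2 + N B * t ^ 2 = (Fintype.card F : K) ^ 2 := by
        rw [← ht, ← hA']
        linear_combination hS2 + hS3
      rw [hqn] at this
      exact_mod_cast this
  · have hNB : N B = N A := hσA ▸ hNσ A
    have hNC : N C = N A := by rw [← hNB, ← hNσ B, hσB]
    rw [hNB, hNC] at hS1 hcard'
    obtain ⟨s, hs⟩ := hint (A + B + C) (((hSint A hA).add (hSint B hB)).add (hSint C hC)) (by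
      rw [map_add, map_add, hσA, hσB, hσC]; ring)
    have hdvd : N A ∣ Fintype.card F := by
      rw [← Int.natCast_dvd_natCast]
      refine ⟨s, ?_⟩
      have : (Fintype.card F : K) = N A * s := by
        rw [← hs]
        linear_combination -hS1
      exact_mod_cast this
    have hNA1 : N A = 1 := by
      rw [← Nat.dvd_one]
      rw [← hcard', ← add_assoc] at hdvd
      exact (Nat.dvd_add_right ⟨3, by ring⟩).mp hdvd
    have hp2 : p = 2 := by
      have h4 : p ∣ 2 ^ 2 := by
        rw [hNA1] at hcard'
        rw [show 2 ^ 2 = Fintype.card F from hcard', hqn]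
        exact dvd_pow_self _ n.pos.ne'
      exact (Nat.prime_dvd_prime_iff_eq hp Nat.prime_two).mp (hp.dvd_of_dvd_pow h4)
    have hσB' : σ B = B := by
      obtain ⟨b, -, rfl⟩ := Finset.mem_image.mp hB
      simp only [W, addCharWeilSum, map_sum, hσ, hj2 hp2, one_mul]
    exact hBC (hσB'.symm.trans hσB)

theorem exists_int_eq_of_isIntegral_of_generator_fixes (p : ℕ) [Fact p.Prime] {K : Type*} [Field K]
    [CharZero K] [Algebra ℚ K] [IsCyclotomicExtension {p} ℚ K] {σ : K ≃ₐ[ℚ] K}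
    (hσ : ∀ τ : K ≃ₐ[ℚ] K, τ ∈ Subgroup.zpowers σ) {w : K} (hw : IsIntegral ℤ w) (h : σ w = w) :
    ∃ m : ℤ, w = m := by
  have := IsCyclotomicExtension.isGalois {p} ℚ K
  have := IsCyclotomicExtension.finiteDimensional {p} ℚ K
  have hbot : w ∈ (⊥ : IntermediateField ℚ K) := by
    rw [IsGalois.mem_bot_iff_fixed]
    intro τ
    have hle : Subgroup.zpowers σ ≤ MulAction.stabilizer (K ≃ₐ[ℚ] K) w := by
      rw [Subgroup.zpowers_le]
      exact h
    exact hle (hσ τ)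
  obtain ⟨r, rfl⟩ := IntermediateField.mem_bot.mp hbot
  have hr : IsIntegral ℤ r :=
    (isIntegral_algebraMap_iff (algebraMap ℚ K).injective).mp hw
  obtain ⟨m, rfl⟩ := IsIntegrallyClosed.isIntegral_iff.mp hr
  exact ⟨m, by simp⟩

/-- There is a generator of the Galois group of the `p`-th cyclotomic field raising `p`-th roots of
unity to a power which is a primitive root modulo `p`. -/
theorem exists_generator_aut_cyclotomic (p : ℕ) [Fact p.Prime] (K : Type*) [Field K] [CharZero K]
    [Algebra ℚ K] [IsCyclotomicExtension {p} ℚ K] :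
    ∃ (g : (ZMod p)ˣ) (σ : K ≃ₐ[ℚ] K), orderOf g = p - 1 ∧
      (∀ τ : K ≃ₐ[ℚ] K, τ ∈ Subgroup.zpowers σ) ∧
      ∀ ζ : K, ζ ^ p = 1 → σ ζ = ζ ^ (g : ZMod p).val := by
  have hirr := Polynomial.cyclotomic.irreducible_rat (Fact.out : p.Prime).pos
  obtain ⟨g, hg⟩ := IsCyclic.exists_generator (α := (ZMod p)ˣ)
  let e := IsCyclotomicExtension.autEquivPow K hirr
  refine ⟨g, e.symm g, ?_, fun τ => ?_, fun ζ hζ => ?_⟩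
  · rw [orderOf_eq_card_of_forall_mem_zpowers hg, Nat.card_eq_fintype_card, ZMod.card_units]
  · obtain ⟨i, hi⟩ := Subgroup.mem_zpowers_iff.mp (hg (e τ))
    refine Subgroup.mem_zpowers_iff.mpr ⟨i, ?_⟩
    rw [← map_zpow, hi, MulEquiv.symm_apply_apply]
  · have hz := IsCyclotomicExtension.zeta_spec p ℚ K
    obtain ⟨i, -, rfl⟩ := hz.eq_pow_of_pow_eq_one hζ
    have h1 := IsPrimitiveRoot.autToPow_spec ℚ hz (e.symm g)
    have h2 : IsPrimitiveRoot.autToPow ℚ hz (e.symm g) = g := e.apply_symm_apply g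
    rw [h2] at h1
    rw [map_pow, ← h1, ← pow_mul, ← pow_mul, mul_comm]

/-- If `W_{F,d}` is three-valued, then `d ≡ 1 (mod p−1)` and all values of `W_{F,d}` are
integers. -/
theorem weilSum_int_of_three_valued (F : Type*) [Field F] [Fintype F]
    (p : ℕ) [Fact p.Prime] [CharP F p] (d : ℕ) (hd : 0 < d)
    (hgcd : Nat.gcd d (Fintype.card F - 1) = 1)
    (h3 : Set.ncard {w : ℂ | ∃ a : F, a ≠ 0 ∧ weilSum F p d a = w} = 3) :
    d ≡ 1 [MOD p - 1] ∧ ∀ a : F, ∃ t : ℤ, weilSum F p d a = (t : ℂ) := by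
  classical
  let _ : Algebra (ZMod p) F := ZMod.algebra F p
  have hp : p.Prime := Fact.out
  obtain ⟨K, _, _, _, _⟩ : ∃ (K : Type) (_ : Field K) (_ : CharZero K) (_ : Algebra ℚ K),
      IsCyclotomicExtension {p} ℚ K :=
    ⟨CyclotomicField p ℚ, inferInstance, inferInstance, CyclotomicField.algebra p ℚ, inferInstance⟩
  obtain ⟨φ, z, hz, hφz⟩ : ∃ (φ : K →+* ℂ) (z : K), IsPrimitiveRoot z p ∧
      φ z = Complex.exp (2 * Real.pi * Complex.I / p) := by
    have := IsCyclotomicExtension.finiteDimensional {p} ℚ K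
    let φ : K →ₐ[ℚ] ℂ := IsAlgClosed.lift
    have hζ := (IsCyclotomicExtension.zeta_spec p ℚ K).map_of_injective φ.injective
    have hexp := Complex.isPrimitiveRoot_exp p hp.ne_zero
    obtain ⟨i, -, hi⟩ := hζ.eq_pow_of_pow_eq_one hexp.pow_eq_one
    rw [← map_pow] at hi
    refine ⟨φ, _, IsPrimitiveRoot.of_map_of_injective (f := φ) ?_ φ.injective, hi⟩
    exact hi.symm ▸ hexp
  obtain ⟨g, σ, hg, hgen, hσ⟩ := exists_generator_aut_cyclotomic p K
  have hχ := AddChar.zmodChar_primitive_of_primitive_root p hz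
  set χ : AddChar (ZMod p) K := AddChar.zmodChar p ((IsPrimitiveRoot.iff_def z p).mp hz).left
  let ψ : AddChar F K := χ.compAddMonoidHom (Algebra.trace (ZMod p) F).toAddMonoidHom
  have hψ_apply : ∀ x, ψ x = χ (Algebra.trace (ZMod p) F x) := fun _ => rfl
  have hψ : ψ.IsPrimitive := by
    refine AddChar.IsPrimitive.of_ne_one fun h => Algebra.trace_ne_zero (ZMod p) F ?_
    ext x
    have h1 : ψ x = 1 := by rw [h, AddChar.one_apply]
    rwa [hψ_apply, AddChar.IsPrimitive.zmod_char_eq_one_iff p hχ] at h1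
  have hσψ : ∀ x, σ (ψ x) = ψ (algebraMap (ZMod p) F g * x) := by
    intro x
    have h1 : ψ x ^ p = 1 := by
      rw [← AddChar.map_nsmul_eq_pow, nsmul_eq_mul, CharP.cast_eq_zero, zero_mul,
        AddChar.map_zero_eq_one]
    rw [hσ _ h1, ← Algebra.smul_def, hψ_apply, hψ_apply, map_smul, ← AddChar.map_nsmul_eq_pow,
      nsmul_eq_mul, ZMod.natCast_zmod_val, smul_eq_mul]
  have hφ : ∀ a, φ (addCharWeilSum ψ d a) = weilSum F p d a := by
    intro a
    simp only [addCharWeilSum, weilSum, map_sum, canonicalPsi]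
    refine Finset.sum_congr rfl fun x _ => ?_
    rw [hψ_apply, AddChar.zmodChar_apply, map_pow, hφz, ← Complex.exp_nat_mul]
    congr 1
    ring
  have hcard3 : ((Finset.univ.erase (0 : F)).image (addCharWeilSum ψ d)).card = 3 := by
    rw [← Finset.card_image_of_injective _ φ.injective, ← h3, ← Set.ncard_coe_finset]
    congr 1
    ext w
    simp [hφ]
  obtain ⟨hj, hfix⟩ := map_addCharWeilSum_eq_of_three_valued hp hψ hd hgcd (σ : K →+* K)
    (j := algebraMap (ZMod p) F g) (by simp) (by
      rintro rfl
      rw [Subsingleton.elim g 1]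
      simp) hσψ
    (fun w hw hσw => exists_int_eq_of_isIntegral_of_generator_fixes p hgen hw hσw) hcard3
  refine ⟨?_, fun a => ?_⟩
  · rw [← map_pow, (algebraMap (ZMod p) F).injective.eq_iff, ← Units.val_pow_eq_pow_val,
      Units.val_inj] at hj
    rw [← hg, ← pow_eq_pow_iff_modEq, pow_one, hj]
  · obtain ⟨t, ht⟩ := exists_int_eq_of_isIntegral_of_generator_fixes p hgen
      (isIntegral_addCharWeilSum ψ d a) (hfix a)
    exact ⟨t, by rw [← hφ, ht, map_intCast]⟩
end
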